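/- arXiv:1211.0627 — 2 statements merged into one kernel-verified Lean document; each statement's English description precedes it below -/
import Mathlib

section
/- Let G be a finite simple 3-connected planar graph different from K₃. Then |C(G)| - |E(G)| + |V(G)| = 2, where C(G) is the set of induced nonseparating cycles of G; equivalently, |C(G)| equals the number of faces in a planar drawing of G. -/
open SimpleGraph

variable {V : Type*} {W : Type*}

/-- A graph is 3-connected if deleting any set of at most two vertices
leaves a connected graph. -/
def ThreeConnected (G : SimpleGraph V) : Prop :=
  ∀ S : Set V, S.ncard ≤ 2 → (G.induce Sᶜ).Connected

/-- `C` induces a cycle in `G`: the induced subgraph on `C` is connected,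
`2`-regular and has at least three vertices. -/
def IsInducedCycle (G : SimpleGraph V) (C : Set V) : Prop :=
  3 ≤ C.ncard ∧ (G.induce C).Connected ∧
    ∀ x : C, ((G.induce C).neighborSet x).ncard = 2

/-- `C` is an induced nonseparating cycle of `G`: deleting `V(C)` leaves a
connected graph (the empty graph counts as connected). -/
def IsNonsepCycle (G : SimpleGraph V) (C : Set V) : Prop :=
  IsInducedCycle G C ∧ (G.induce Cᶜ).Preconnected

/-- The set `C(G)` of induced nonseparating cycles of `G`. -/
def nonsepCycles (G : SimpleGraph V) : Set (Set V) :=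
  {C | IsNonsepCycle G C}

/-- `H` is a minor of `G`: there is a minor model assigning to each vertex of `H`
a nonempty connected branch set in `G`, pairwise disjoint, with edges of `H`
realized by edges between the corresponding branch sets. -/
def IsMinor (H : SimpleGraph W) (G : SimpleGraph V) : Prop :=
  ∃ f : W → Set V, (∀ i, (f i).Nonempty) ∧ (∀ i, (G.induce (f i)).Connected) ∧
    (Pairwise fun i j => Disjoint (f i) (f j)) ∧
    ∀ i j, H.Adj i j → ∃ a ∈ f i, ∃ b ∈ f j, G.Adj a b

/-- The Hadwiger number of `G`: the largest `n` such that the complete graph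
`K_n` is a minor of `G`. -/
noncomputable def hadwigerNumber (G : SimpleGraph V) : ℕ :=
  sSup {n | IsMinor (⊤ : SimpleGraph (Fin n)) G}

/-- `G` is planar, i.e. embeddable in the plane; by Wagner's theorem this is
equivalent to having neither a `K₅` nor a `K_{3,3}` minor, which we take as the
definition. -/
def Planar (G : SimpleGraph V) : Prop :=
  ¬ IsMinor (⊤ : SimpleGraph (Fin 5)) G ∧
  ¬ IsMinor (completeBipartiteGraph (Fin 3) (Fin 3)) G

/-- Cut form of connectedness of `G.induce S`: a subset of `S` that meets `S` and is closed under
adjacency inside `S` is all of `S`. The empty set is connected in this sense. -/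
def CutConnected (G : SimpleGraph V) (S : Set V) : Prop :=
  ∀ A : Set V, (∃ a ∈ S, a ∈ A) → (∀ a ∈ S, a ∈ A → ∀ b ∈ S, G.Adj a b → b ∈ A) → S ⊆ A

theorem induce_preconnected_iff {G : SimpleGraph V} {S : Set V} :
    (G.induce S).Preconnected ↔ CutConnected G S := by
  constructor
  · intro h A ⟨a, haS, haA⟩ hA b hbS
    obtain ⟨p⟩ := h ⟨a, haS⟩ ⟨b, hbS⟩
    have key : ∀ (u w : S), (G.induce S).Walk u w → u.1 ∈ A → w.1 ∈ A := by
      intro u w p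
      induction p with
      | nil => exact id
      | @cons u v w huv _ ih => exact fun hu => ih (hA _ u.2 hu _ v.2 huv)
    exact key _ _ p haA
  · intro h a b
    have := h {w | ∃ hw : w ∈ S, (G.induce S).Reachable a ⟨w, hw⟩}
      ⟨a, a.2, a.2, Reachable.refl _⟩ ?_ b.2
    · exact this.2
    · rintro u huS ⟨_, hu⟩ w hwS huw
      exact ⟨hwS, hu.trans (Adj.reachable (by simpa using huw))⟩

theorem induce_connected_iff {G : SimpleGraph V} {S : Set V} :
    (G.induce S).Connected ↔ S.Nonempty ∧ CutConnected G S := by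
  rw [connected_iff, induce_preconnected_iff, and_comm, Set.nonempty_coe_sort]

theorem CutConnected.singleton (G : SimpleGraph V) (a : V) : CutConnected G {a} := by
  rintro A ⟨b, rfl, hb⟩ _ c rfl
  exact hb

theorem CutConnected.insert_of_adj {G : SimpleGraph V} {S : Set V} {a b : V}
    (hS : CutConnected G S) (hb : b ∈ S) (hab : G.Adj a b) : CutConnected G (insert a S) := by
  intro A ⟨c, hc, hcA⟩ hA
  have hSA : S ⊆ A := by
    apply hS A _ (by grind)
    rcases hc with rfl | hc
    · exact ⟨b, hb, hA _ (by simp) hcA _ (by simp [hb]) hab⟩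
    · exact ⟨c, hc, hcA⟩
  have := hA b (by simp [hb]) (hSA hb) a (by simp) hab.symm
  grind

/-- A proper nonempty part of a connected set has an edge to the remaining part. -/
theorem CutConnected.exists_adj {G : SimpleGraph V} {S A : Set V} (hS : CutConnected G S)
    {a b : V} (ha : a ∈ S) (haA : a ∈ A) (hb : b ∈ S) (hbA : b ∉ A) :
    ∃ u ∈ S, u ∈ A ∧ ∃ w ∈ S, w ∉ A ∧ G.Adj u w := by
  by_contra! h
  exact hbA (hS A ⟨a, ha, haA⟩ (fun u hu huA w hw huw => by
    by_contra hwA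
    exact h u hu huA w hw hwA huw) hb)

theorem not_cutConnected {G : SimpleGraph V} {S : Set V} (hS : ¬ CutConnected G S) :
    ∃ A ⊆ S, A.Nonempty ∧ (S \ A).Nonempty ∧ ∀ a ∈ A, ∀ b ∈ S, G.Adj a b → b ∈ A := by
  simp only [CutConnected, not_forall] at hS
  obtain ⟨A, ⟨a, haS, haA⟩, hA, hSA⟩ := hS
  obtain ⟨b, hbS, hbA⟩ := Set.not_subset.1 hSA
  exact ⟨S ∩ A, by simp, ⟨a, haS, haA⟩, ⟨b, hbS, by simp [hbA]⟩, by grind⟩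

/-- `Q` is (the vertex set of) a connected component of `G.induce S`. -/
structure IsComponent (G : SimpleGraph V) (S Q : Set V) : Prop where
  subset : Q ⊆ S
  conn : CutConnected G Q
  closed : ∀ u ∈ Q, ∀ w ∈ S, G.Adj u w → w ∈ Q

theorem exists_isComponent (G : SimpleGraph V) {S : Set V} {a : V} (ha : a ∈ S) :
    ∃ Q, IsComponent G S Q ∧ a ∈ Q := by
  let Q : Set V := {b | b ∈ S ∧ ∀ A : Set V, a ∈ A →
    (∀ u ∈ S, u ∈ A → ∀ w ∈ S, G.Adj u w → w ∈ A) → b ∈ A}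
  have haQ : a ∈ Q := ⟨ha, fun A h _ => h⟩
  have hcl : ∀ u ∈ Q, ∀ w ∈ S, G.Adj u w → w ∈ Q := fun u hu w hw huw =>
    ⟨hw, fun A haA hA => hA u hu.1 (hu.2 A haA hA) w hw huw⟩
  refine ⟨Q, ⟨fun b hb => hb.1, ?_, hcl⟩, haQ⟩
  intro B ⟨b, hbQ, hbB⟩ hB
  by_cases haB : a ∈ B
  · intro c hc
    exact (hc.2 (B ∩ Q) ⟨haB, haQ⟩ (fun u _ hu w hw huw =>
      ⟨hB u hu.2 hu.1 w (hcl u hu.2 w hw huw) huw, hcl u hu.2 w hw huw⟩)).1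
  · exact absurd hbB (hbQ.2 (Q \ B) ⟨haQ, haB⟩ (fun u _ hu w hw huw =>
      ⟨hcl u hu.1 w hw huw, fun hwB =>
        hu.2 (hB w (hcl u hu.1 w hw huw) hwB u hu.1 huw.symm)⟩)).2

theorem IsComponent.subset_of_mem {G : SimpleGraph V} {S Q A : Set V} (hQ : IsComponent G S Q)
    {a : V} (ha : a ∈ Q) (haA : a ∈ A) (hA : ∀ u ∈ A, ∀ w ∈ S, G.Adj u w → w ∈ A) : Q ⊆ A :=
  hQ.conn A ⟨a, ha, haA⟩ fun u _ huA w hw huw => hA u huA w (hQ.subset hw) huw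

/-- The condition defining `IsInducedCycle`, in terms of cuts and explicit neighbors. -/
def InducedCycle (G : SimpleGraph V) (C : Set V) : Prop :=
  C.Nonempty ∧ CutConnected G C ∧ ∀ u ∈ C, ∃ p ∈ C, ∃ q ∈ C, p ≠ q ∧ G.Adj u p ∧ G.Adj u q ∧
    ∀ w ∈ C, G.Adj u w → w = p ∨ w = q

theorem ncard_induce_neighborSet (G : SimpleGraph V) (C : Set V) (u : C) :
    ((G.induce C).neighborSet u).ncard = {w | w ∈ C ∧ G.Adj u w}.ncard := by
  rw [← Set.ncard_image_of_injective _ Subtype.val_injective]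
  congr 1
  ext w
  simp [and_comm]

theorem isInducedCycle_iff [Finite V] {G : SimpleGraph V} {C : Set V} :
    IsInducedCycle G C ↔ InducedCycle G C := by
  have hdeg : ∀ u, {w | w ∈ C ∧ G.Adj u w}.ncard = 2 ↔ ∃ p ∈ C, ∃ q ∈ C, p ≠ q ∧ G.Adj u p ∧
      G.Adj u q ∧ ∀ w ∈ C, G.Adj u w → w = p ∨ w = q := by
    intro u
    rw [Set.ncard_eq_two]
    constructor
    · rintro ⟨p, q, hpq, h⟩
      simp only [Set.ext_iff, Set.mem_ofPred_eq, Set.mem_insert_iff, Set.mem_singleton_iff] at h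
      exact ⟨p, by grind, q, by grind, hpq, by grind, by grind, by grind⟩
    · rintro ⟨p, hp, q, hq, hpq, hup, huq, h⟩
      refine ⟨p, q, hpq, ?_⟩
      ext w
      simp only [Set.mem_ofPred_eq, Set.mem_insert_iff, Set.mem_singleton_iff]
      grind
  simp only [IsInducedCycle, InducedCycle, induce_connected_iff, ncard_induce_neighborSet, hdeg,
    Subtype.forall]
  constructor
  · grind
  · rintro ⟨⟨u, hu⟩, hC, h⟩
    refine ⟨?_, ⟨⟨u, hu⟩, hC⟩, h⟩
    obtain ⟨p, hp, q, hq, hpq, hup, huq, -⟩ := h u hu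
    rw [← Set.ncard_eq_three.2 ⟨u, p, q, hup.ne, huq.ne, hpq, rfl⟩]
    exact Set.ncard_le_ncard (by grind)

theorem mem_nonsepCycles [Finite V] {G : SimpleGraph V} {C : Set V} :
    C ∈ nonsepCycles G ↔ InducedCycle G C ∧ CutConnected G Cᶜ := by
  rw [nonsepCycles, Set.mem_ofPred_eq, IsNonsepCycle, isInducedCycle_iff, induce_preconnected_iff]

/-- The edges from `S` to `C \ S`, as ordered pairs. -/
def boundaryPairs (G : SimpleGraph V) (C S : Set V) : Set (V × V) :=
  {e | e.1 ∈ S ∧ (e.2 ∈ C ∧ e.2 ∉ S) ∧ G.Adj e.1 e.2}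

theorem mem_boundaryPairs {G : SimpleGraph V} {C S : Set V} {e : V × V} :
    e ∈ boundaryPairs G C S ↔ e.1 ∈ S ∧ (e.2 ∈ C ∧ e.2 ∉ S) ∧ G.Adj e.1 e.2 := Iff.rfl

theorem ncard_boundaryPairs [Finite V] {G : SimpleGraph V} {C S : Set V} (hC : InducedCycle G C)
    (hS : S ⊆ C) : 2 * (G.induce S).edgeSet.ncard + (boundaryPairs G C S).ncard = 2 * S.ncard := by
  classical
  have := Fintype.ofFinite V
  have hdeg : ∀ u ∈ S.toFinset, (C.toFinset.filter (G.Adj u)).card = 2 := by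
    intro u hu
    have := (isInducedCycle_iff.2 hC).2.2 ⟨u, hS (by simpa using hu)⟩
    rw [ncard_induce_neighborSet, Set.ncard_eq_toFinset_card'] at this
    rw [← this]
    congr 1
    ext w
    simp
  have hsplit : ∀ u, (C.toFinset.filter (G.Adj u)).card =
      (S.toFinset.filter (G.Adj u)).card + ((C \ S).toFinset.filter (G.Adj u)).card := by
    intro u
    rw [← Finset.card_union_of_disjoint]
    · congr 1
      ext w
      have := @hS w
      simp only [Finset.mem_filter, Set.mem_toFinset, Finset.mem_union, Set.mem_sdiff]
      tauto
    · rw [Finset.disjoint_left]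
      simp +contextual
  have hsum := Finset.sum_congr rfl hdeg
  rw [Finset.sum_congr rfl fun u _ => hsplit u, Finset.sum_add_distrib, Finset.sum_const,
    smul_eq_mul, mul_comm] at hsum
  have h1 : ∑ u ∈ S.toFinset, (S.toFinset.filter (G.Adj u)).card =
      2 * (G.induce S).edgeSet.ncard := by
    rw [← coe_edgeFinset, Set.ncard_coe_finset, ← sum_degrees_eq_twice_card_edges,
      Finset.sum_subtype S.toFinset (p := (· ∈ S)) (by simp)]
    refine Finset.sum_congr rfl fun u _ => ?_
    rw [← card_neighborSet_eq_degree, ← Set.toFinset_card, ← Set.ncard_eq_toFinset_card',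
      ncard_induce_neighborSet, Set.ncard_eq_toFinset_card']
    congr 1
    ext w
    simp
  have h2 : ∑ u ∈ S.toFinset, ((C \ S).toFinset.filter (G.Adj u)).card =
      (boundaryPairs G C S).ncard := by
    rw [← Finset.card_sigma, Set.ncard_eq_toFinset_card']
    refine Finset.card_bij' (fun e _ => (e.1, e.2)) (fun e _ => ⟨e.1, e.2⟩) ?_ ?_ ?_ ?_ <;>
      simp [mem_boundaryPairs]
  rw [h1, h2] at hsum
  rw [hsum, Set.ncard_eq_toFinset_card']

theorem InducedCycle.diff_singleton [Finite V] {G : SimpleGraph V} {C : Set V}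
    (hC : InducedCycle G C) {x : V} (hx : x ∈ C) : CutConnected G (C \ {x}) := by
  by_contra h
  obtain ⟨A, hAC, ⟨a, ha⟩, ⟨b, hb⟩, hA⟩ := not_cutConnected h
  obtain ⟨p, hpC, q, hqC, hpq, hxp, hxq, hx2⟩ := hC.2.2 x hx
  obtain ⟨u, hu, huA, w, hw, hwA, huw⟩ :=
    hC.2.1.exists_adj (A := A) (hAC ha).1 ha hx (fun h => (hAC h).2 rfl)
  have hwx : w = x := by grind
  obtain ⟨u', hu', huA', w', hw', hwA', huw'⟩ :=
    hC.2.1.exists_adj (A := A ∪ {x}) (a := a) (b := b) (hAC ha).1 (by simp [ha]) hb.1.1 (by grind)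
  have hux : u' = x := by grind
  subst hwx hux
  have hb : boundaryPairs G C A = {(u, u')} := by
    ext ⟨c, d⟩
    simp only [boundaryPairs, Set.mem_ofPred_eq, Set.mem_singleton_iff, Prod.mk.injEq]
    have := huw.symm
    constructor
    · rintro ⟨hc, ⟨hd, hdA⟩, hcd⟩
      have hdu : d = u' := by grind
      subst hdu
      have := hx2 u hu huw.symm
      have := hx2 w' hw' huw'
      have := hx2 c (hAC hc).1 hcd.symm
      grind
    · rintro ⟨rfl, rfl⟩
      exact ⟨huA, ⟨hw, hwA⟩, huw⟩
  have := ncard_boundaryPairs hC (hAC.trans Set.sdiff_subset)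
  rw [hb, Set.ncard_singleton] at this
  omega

theorem CutConnected.ncard_boundaryPairs_le [Finite V] {G : SimpleGraph V} {C S : Set V}
    (hS : CutConnected G S) (hC : InducedCycle G C) (hSC : S ⊆ C) (hne : S.Nonempty) :
    (boundaryPairs G C S).ncard ≤ 2 := by
  have h := ncard_boundaryPairs hC hSC
  have := (induce_connected_iff.2 ⟨hne, hS⟩).card_vert_le_card_edgeSet_add_one
  rw [Nat.card_coe_set_eq, Nat.card_coe_set_eq] at this
  omega

/-- A connected part `S` of an induced cycle with two given outgoing edges has no further ones. -/
theorem CutConnected.eq_or_eq_of_adj [Finite V] {G : SimpleGraph V} {C S : Set V}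
    (hS : CutConnected G S) (hC : InducedCycle G C) (hSC : S ⊆ C) {a b c d : V}
    (ha : a ∈ S) (hb : b ∈ C) (hbS : b ∉ S) (hab : G.Adj a b)
    (hc : c ∈ S) (hd : d ∈ C) (hdS : d ∉ S) (hcd : G.Adj c d) (hne : b ≠ d)
    {u w : V} (hu : u ∈ S) (hw : w ∈ C) (hwS : w ∉ S) (huw : G.Adj u w) :
    u = a ∧ w = b ∨ u = c ∧ w = d := by
  by_contra h
  have hle := hS.ncard_boundaryPairs_le hC hSC ⟨a, ha⟩
  have : ({(a, b), (c, d), (u, w)} : Set (V × V)) ⊆ boundaryPairs G C S := by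
    rintro _ (rfl | rfl | rfl)
    exacts [⟨ha, ⟨hb, hbS⟩, hab⟩, ⟨hc, ⟨hd, hdS⟩, hcd⟩, ⟨hu, ⟨hw, hwS⟩, huw⟩]
  have h3 : ({(a, b), (c, d), (u, w)} : Set (V × V)).ncard = 3 :=
    Set.ncard_eq_three.2 ⟨_, _, _, by grind, by grind, by grind, rfl⟩
  have := Set.ncard_le_ncard this
  omega

/-- The remaining part of an induced cycle after removing two vertices `x`, `c` and an arc `S`
between them. -/
theorem InducedCycle.compl_arc [Finite V] {G : SimpleGraph V} {C S : Set V}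
    (hC : InducedCycle G C) (hS : CutConnected G S) (hSC : S ⊆ C) {x p l c : V} (hx : x ∈ C)
    (hxS : x ∉ S) (hp : p ∈ S) (hxp : G.Adj x p) (hc : c ∈ C) (hcS : c ∉ S) (hl : l ∈ S)
    (hcl : G.Adj c l) (hne : x ≠ c) :
    CutConnected G (C \ (S ∪ {x, c})) ∧
      (∀ u ∈ S, ∀ w ∈ C \ (S ∪ {x, c}), ¬ G.Adj u w) ∧
      ((C \ (S ∪ {x, c})).Nonempty → (∃ u ∈ C \ (S ∪ {x, c}), G.Adj x u) ∧
        ∃ u ∈ C \ (S ∪ {x, c}), G.Adj c u) := by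
  set B := C \ (S ∪ {x, c}) with hB
  have hSB : ∀ u ∈ S, ∀ w ∈ B, ¬ G.Adj u w := by
    intro u hu w hw huw
    have := hS.eq_or_eq_of_adj hC hSC hp hx hxS hxp.symm hl hc hcS hcl.symm hne hu hw.1
      (by grind) huw
    grind
  have hadj : ∀ A ⊆ B, A.Nonempty → (∀ a ∈ A, ∀ b ∈ B, G.Adj a b → b ∈ A) →
      (∃ u ∈ A, G.Adj x u) ∧ ∃ u ∈ A, G.Adj c u := by
    rintro A hAB ⟨a, ha⟩ hA
    have haB := hAB ha
    constructor
    · obtain ⟨u, hu, huA, w, hw, hwA, huw⟩ := (hC.diff_singleton hc).exists_adj (A := A)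
        (a := a) (b := x) (by grind) ha (by grind) (by grind)
      have := fun h => hSB w h u (hAB huA) huw.symm
      have := hA u huA w
      exact ⟨u, huA, by have := huw.symm; grind⟩
    · obtain ⟨u, hu, huA, w, hw, hwA, huw⟩ := (hC.diff_singleton hx).exists_adj (A := A)
        (a := a) (b := c) (by grind) ha (by grind) (by grind)
      have := fun h => hSB w h u (hAB huA) huw.symm
      have := hA u huA w
      exact ⟨u, huA, by have := huw.symm; grind⟩
  refine ⟨?_, hSB, fun h => hadj B subset_rfl h (by grind)⟩
  by_contra h
  obtain ⟨A, hAB, hAne, hBA, hA⟩ := not_cutConnected h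
  obtain ⟨⟨u, hu, hxu⟩, -⟩ := hadj A hAB hAne hA
  obtain ⟨⟨w, hw, hxw⟩, -⟩ := hadj (B \ A) Set.sdiff_subset hBA
    (fun a ha b hb hab => ⟨hb, fun h => ha.2 (hA b h a ha.1 hab.symm)⟩)
  obtain ⟨a, -, b, -, -, -, -, hx2⟩ := hC.2.2 x hx
  have := hx2 p (hSC hp) hxp
  have := hx2 u (hAB hu).1 hxu
  have := hx2 w hw.1.1 hxw
  have := hAB hu
  grind

theorem isMinor_top_fin {G : SimpleGraph V} (l : List (Set V))
    (hl : ∀ S ∈ l, S.Nonempty ∧ CutConnected G S)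
    (hp : l.Pairwise fun S T => Disjoint S T ∧ ∃ a ∈ S, ∃ b ∈ T, G.Adj a b) :
    IsMinor (⊤ : SimpleGraph (Fin l.length)) G := by
  rw [List.pairwise_iff_get] at hp
  refine ⟨l.get, fun i => (hl _ (l.get_mem i)).1,
    fun i => induce_connected_iff.2 (hl _ (l.get_mem i)), fun i j hij => ?_, fun i j hij => ?_⟩
  · rcases lt_or_gt_of_ne hij with h | h
    exacts [(hp i j h).1, (hp j i h).1.symm]
  · rcases lt_or_gt_of_ne hij.ne with h | h
    · exact (hp i j h).2
    · obtain ⟨a, ha, b, hb, hab⟩ := (hp j i h).2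
      exact ⟨b, hb, a, ha, hab.symm⟩

theorem isMinor_completeBipartiteGraph_fin {G : SimpleGraph V} (l m : List (Set V))
    (hconn : ∀ S ∈ l ++ m, S.Nonempty ∧ CutConnected G S)
    (hdisj : (l ++ m).Pairwise Disjoint)
    (hadj : ∀ S ∈ l, ∀ T ∈ m, ∃ a ∈ S, ∃ b ∈ T, G.Adj a b) :
    IsMinor (completeBipartiteGraph (Fin l.length) (Fin m.length)) G := by
  rw [List.pairwise_append, List.pairwise_iff_get, List.pairwise_iff_get] at hdisj
  have hf : ∀ i, Sum.elim l.get m.get i ∈ l ++ m := by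
    rintro (i | i)
    exacts [List.mem_append_left _ (l.get_mem i), List.mem_append_right _ (m.get_mem i)]
  refine ⟨Sum.elim l.get m.get, fun i => (hconn _ (hf i)).1,
    fun i => induce_connected_iff.2 (hconn _ (hf i)), ?_, ?_⟩
  · rintro (i | i) (j | j) hij
    · rcases lt_or_gt_of_ne (fun h => hij (congrArg _ h)) with h | h
      exacts [hdisj.1 i j h, (hdisj.1 j i h).symm]
    · exact hdisj.2.2 _ (l.get_mem i) _ (m.get_mem j)
    · exact (hdisj.2.2 _ (l.get_mem j) _ (m.get_mem i)).symm
    · rcases lt_or_gt_of_ne (fun h => hij (congrArg _ h)) with h | h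
      exacts [hdisj.2.1 i j h, (hdisj.2.1 j i h).symm]
  · rintro (i | i) (j | j) hij
    · simp at hij
    · exact hadj _ (l.get_mem i) _ (m.get_mem j)
    · obtain ⟨a, ha, b, hb, hab⟩ := hadj _ (l.get_mem j) _ (m.get_mem i)
      exact ⟨b, hb, a, ha, hab.symm⟩
    · simp at hij

theorem ncard_pair_le (a b : V) : ({a, b} : Set V).ncard ≤ 2 := by
  have := Set.ncard_insert_le a {b}
  rwa [Set.ncard_singleton] at this

theorem threeConnected_iff {G : SimpleGraph V} :
    ThreeConnected G ↔ ∀ S : Set V, S.ncard ≤ 2 → Sᶜ.Nonempty ∧ CutConnected G Sᶜ := by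
  simp only [ThreeConnected, induce_connected_iff]

theorem ThreeConnected.compl_pair {G : SimpleGraph V} (hG : ThreeConnected G) (a b : V) :
    CutConnected G {a, b}ᶜ :=
  (threeConnected_iff.1 hG _ (ncard_pair_le a b)).2

theorem nonempty_compl_of_ncard_lt [Finite V] {S : Set V} (h : S.ncard < Nat.card V) :
    Sᶜ.Nonempty := by
  rw [Set.nonempty_compl]
  rintro rfl
  simp [Set.ncard_univ] at h

theorem exists_ne_ne_ne [Finite V] (h : 4 ≤ Nat.card V) (a b c : V) :
    ∃ d, d ≠ a ∧ d ≠ b ∧ d ≠ c := by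
  have h3 : ({a, b, c} : Set V).ncard ≤ 3 := by
    have := Set.ncard_insert_le a {b, c}
    have := ncard_pair_le b c
    omega
  obtain ⟨d, hd⟩ := nonempty_compl_of_ncard_lt (S := {a, b, c}) (by omega)
  exact ⟨d, by simpa using hd⟩

/-- In a 3-connected graph with at least four vertices, every vertex has a neighbor outside
any given pair of vertices. -/
theorem ThreeConnected.exists_adj_ne_ne [Finite V] {G : SimpleGraph V} (hG : ThreeConnected G)
    (hV : 4 ≤ Nat.card V) {u a b : V} (ha : u ≠ a) (hb : u ≠ b) :
    ∃ w, w ≠ a ∧ w ≠ b ∧ G.Adj u w := by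
  obtain ⟨d, hda, hdb, hdu⟩ := exists_ne_ne_ne hV a b u
  obtain ⟨c, -, rfl, w, hw, -, h⟩ := (hG.compl_pair a b).exists_adj (A := {u}) (a := u) (b := d)
    (by simp [ha, hb]) rfl (by simp [hda, hdb]) hdu
  exact ⟨w, by grind, by grind, h⟩

/-- An edge of a 3-connected graph whose contraction leaves the graph 3-connected. -/
def IsContractible (G : SimpleGraph V) (x y : V) : Prop :=
  G.Adj x y ∧ ∀ z, CutConnected G {x, y, z}ᶜ

theorem IsContractible.symm {G : SimpleGraph V} {x y : V} (h : IsContractible G x y) :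
    IsContractible G y x :=
  ⟨h.1.symm, fun z => by rw [Set.insert_comm]; exact h.2 z⟩

theorem ThreeConnected.exists_isContractible [Finite V] {G : SimpleGraph V}
    (hG : ThreeConnected G) (hV : 4 ≤ Nat.card V) : ∃ x y, IsContractible G x y := by
  by_contra! hno
  have hsep : ∀ x y, G.Adj x y → ∃ z, z ≠ x ∧ z ≠ y ∧ ∃ A ⊆ ({x, y, z} : Set V)ᶜ, A.Nonempty ∧
      (({x, y, z} : Set V)ᶜ \ A).Nonempty ∧
      ∀ a ∈ A, ∀ b ∈ ({x, y, z} : Set V)ᶜ, G.Adj a b → b ∈ A := by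
    intro x y hxy
    obtain ⟨z, hz⟩ : ∃ z, ¬ CutConnected G {x, y, z}ᶜ := by
      by_contra! h
      exact hno x y ⟨hxy, h⟩
    refine ⟨z, ?_, ?_, not_cutConnected hz⟩
    · rintro rfl
      exact hz (by convert hG.compl_pair z y using 1; grind)
    · rintro rfl
      exact hz (by convert hG.compl_pair x z using 1; grind)
  let P : ℕ → Prop := fun n => ∃ x y z, ∃ Q ⊆ ({x, y, z} : Set V)ᶜ, G.Adj x y ∧ z ≠ x ∧ z ≠ y ∧
    Q.Nonempty ∧ (({x, y, z} : Set V)ᶜ \ Q).Nonempty ∧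
    (∀ a ∈ Q, ∀ b ∈ ({x, y, z} : Set V)ᶜ, G.Adj a b → b ∈ Q) ∧ Q.ncard = n
  have hP : ∃ n, P n := by
    have v : V := (Nat.card_pos_iff.1 (by omega : 0 < Nat.card V)).1.some
    obtain ⟨d, hd, -, -⟩ := exists_ne_ne_ne hV v v v
    obtain ⟨e, hed, -, -⟩ := exists_ne_ne_ne hV d d d
    obtain ⟨w, -, -, hvw⟩ := hG.exists_adj_ne_ne hV hd.symm hd.symm
    obtain ⟨z, hzx, hzy, A, hA, h1, h2, h3⟩ := hsep v w hvw
    exact ⟨_, v, w, z, A, hA, hvw, hzx, hzy, h1, h2, h3, rfl⟩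
  classical
  obtain ⟨x, y, z, Q, hQ, hxy, hzx, hzy, ⟨a, ha⟩, ⟨b, hb⟩, hcl, hn⟩ := Nat.find_spec hP
  obtain ⟨v, hv, hvQ, z', hz', hzQ, hvz⟩ := (hG.compl_pair x y).exists_adj (A := Q)
    (a := a) (b := b) (by grind) ha (by grind) hb.2
  obtain rfl : z' = z := by grind
  obtain ⟨w, hwv, hwz, A, hA, hAne, hAc, hAcl⟩ := hsep _ _ hvz
  obtain ⟨D, hD, ⟨d, hd⟩, ⟨e, he⟩, hDcl, hxD, hyD⟩ : ∃ D ⊆ ({v, z', w} : Set V)ᶜ, D.Nonempty ∧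
      (({v, z', w} : Set V)ᶜ \ D).Nonempty ∧
      (∀ a ∈ D, ∀ b ∈ ({v, z', w} : Set V)ᶜ, G.Adj a b → b ∈ D) ∧ x ∉ D ∧ y ∉ D := by
    by_cases h : x ∈ A ∨ y ∈ A
    · refine ⟨({v, z', w} : Set V)ᶜ \ A, Set.sdiff_subset, hAc, ?_, ?_, ?_, ?_⟩
      · obtain ⟨c, hc⟩ := hAne
        exact ⟨c, hA hc, fun h => h.2 hc⟩
      · exact fun a ha b hb hab => ⟨hb, fun h => ha.2 (hAcl b h a ha.1 hab.symm)⟩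
      · rintro ⟨h1, h2⟩
        exact h2 (hAcl y (by grind) x h1 hxy.symm)
      · rintro ⟨h1, h2⟩
        exact h2 (hAcl x (by grind) y h1 hxy)
    · exact ⟨A, hA, hAne, hAc, hAcl, by grind, by grind⟩
  obtain ⟨u, hu, huD, v', hv', hvD, huv⟩ := (hG.compl_pair z' w).exists_adj (A := D)
    (a := d) (b := e) (by grind) hd (by grind) he.2
  obtain rfl : v' = v := by grind
  have huQ : u ∈ Q := hcl v' hvQ u (by grind) huv.symm
  refine Nat.find_min hP (m := (D ∩ Q).ncard) ?_
    ⟨z', v', w, D ∩ Q, by grind, hvz.symm, hwz, hwv, ⟨u, huD, huQ⟩,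
      ⟨e, by grind⟩, ?_, rfl⟩
  · rw [← hn]
    exact Set.ncard_lt_ncard ⟨Set.inter_subset_right, fun h => hvD (h hvQ).1⟩
  · intro a ha b hb hab
    have := hDcl a ha.1 b (by grind) hab
    exact ⟨this, hcl a ha.2 b (by grind) hab⟩

/-- `L` and `B` are the two open arcs of the induced cycle `C` between `x` and `c`. -/
structure IsArcs (G : SimpleGraph V) (C : Set V) (x c : V) (L B : Set V) : Prop where
  mem_iff : ∀ u, u ∈ C ↔ u = x ∨ u = c ∨ u ∈ L ∨ u ∈ B
  ne : x ≠ c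
  left_notMem_left : x ∉ L
  left_notMem_right : x ∉ B
  right_notMem_left : c ∉ L
  right_notMem_right : c ∉ B
  disjoint : ∀ u ∈ L, u ∉ B
  conn_left : CutConnected G L
  conn_right : CutConnected G B
  adj_left : ∃ u ∈ L, G.Adj x u
  adj_right : ∃ u ∈ B, G.Adj x u
  adj_left' : ∃ u ∈ L, G.Adj c u
  adj_right' : ∃ u ∈ B, G.Adj c u
  not_adj : ∀ u ∈ L, ∀ w ∈ B, ¬ G.Adj u w

theorem InducedCycle.isArcs [Finite V] {G : SimpleGraph V} {C S : Set V}
    (hC : InducedCycle G C) (hS : CutConnected G S) (hSC : S ⊆ C) {x p l c : V} (hx : x ∈ C)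
    (hxS : x ∉ S) (hp : p ∈ S) (hxp : G.Adj x p) (hc : c ∈ C) (hcS : c ∉ S) (hl : l ∈ S)
    (hcl : G.Adj c l) (hne : x ≠ c) (hB : (C \ (S ∪ {x, c})).Nonempty) :
    IsArcs G C x c S (C \ (S ∪ {x, c})) := by
  obtain ⟨h1, h2, h3⟩ := hC.compl_arc hS hSC hx hxS hp hxp hc hcS hl hcl hne
  exact ⟨by grind, hne, hxS, by grind, hcS, by grind, by grind, hS, h1, ⟨p, hp, hxp⟩,
    (h3 hB).1, ⟨l, hl, hcl⟩, (h3 hB).2, h2⟩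

theorem IsArcs.exists_crossing {G : SimpleGraph V} {C L B : Set V} {x y c : V}
    (h : IsArcs G C x c L B) (hy : y ∉ C) (hcut : CutConnected G {x, y, c}ᶜ) :
    ∃ Q, IsComponent G (Cᶜ \ {y}) Q ∧ (∃ u ∈ L, ∃ w ∈ Q, G.Adj u w) ∧
      ∃ u ∈ B, ∃ w ∈ Q, G.Adj u w := by
  obtain ⟨hmem, hne, hxL, hxB, hcL, hcB, hLB, hL, hB, ⟨a, haL, hxa⟩, ⟨b, hbB, hxb⟩, hcL', hcB',
    hnadj⟩ := h
  obtain ⟨m, hm, hmM, n, hn, hnM, hmn⟩ := hcut.exists_adj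
    (A := L ∪ {r | ∃ Q, IsComponent G (Cᶜ \ {y}) Q ∧ r ∈ Q ∧ ∃ u ∈ L, ∃ w ∈ Q, G.Adj u w})
    (a := a) (b := b) (by grind) (Or.inl haL) (by grind) (by
      rintro (hb | ⟨Q, hQ, hb, -⟩)
      · exact hLB b hb hbB
      · have := hQ.subset hb
        grind)
  rcases hmM with hmL | ⟨Q, hQ, hmQ, hQL⟩
  · by_cases hnC : n ∈ C
    · have hn' : n ≠ x ∧ n ≠ y ∧ n ≠ c := by simpa using hn
      rcases (hmem n).1 hnC with h | h | h | h
      · exact absurd h hn'.1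
      · exact absurd h hn'.2.2
      · exact absurd (Or.inl h) hnM
      · exact absurd hmn (hnadj m hmL n h)
    · obtain ⟨Q, hQ, hnQ⟩ := exists_isComponent G (S := Cᶜ \ {y}) (a := n) (by grind)
      exact absurd (Or.inr ⟨Q, hQ, hnQ, m, hmL, n, hnQ, hmn⟩) hnM
  · by_cases hnC : n ∈ C
    · exact ⟨Q, hQ, hQL, n, by grind, m, hmQ, hmn.symm⟩
    · exact absurd (Or.inr ⟨Q, hQ, hQ.closed m hmQ n (by grind) hmn, hQL⟩) hnM

theorem IsComponent.exists_adj_of_compl {G : SimpleGraph V} {C Q : Set V} {y : V}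
    (hQ : IsComponent G (Cᶜ \ {y}) Q) (hne : Q.Nonempty) (hy : y ∉ C)
    (hconn : CutConnected G Cᶜ) : ∃ u ∈ Q, G.Adj y u := by
  obtain ⟨a, ha⟩ := hne
  obtain ⟨u, hu, huQ, w, hw, hwQ, huw⟩ := hconn.exists_adj (A := Q) (hQ.subset ha).1 ha hy
    (fun h => (hQ.subset h).2 rfl)
  have := hQ.closed u huQ w
  exact ⟨u, huQ, by have := huw.symm; grind⟩

/-- The `K₃,₃` minor formed by an induced cycle together with a component of the rest attached to
both arcs and a connected set attached to the vertices separating these arcs. -/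
theorem IsArcs.isMinor {G : SimpleGraph V} {C L B Q S : Set V} {x y c : V}
    (h : IsArcs G C x c L B) (hy : y ∉ C) (hxy : G.Adj x y) (hQ : IsComponent G (Cᶜ \ {y}) Q)
    (hQL : ∃ u ∈ L, ∃ w ∈ Q, G.Adj u w) (hQB : ∃ u ∈ B, ∃ w ∈ Q, G.Adj u w)
    (hyQ : ∃ u ∈ Q, G.Adj y u) (hS : CutConnected G S) (hcS : c ∈ S)
    (hSC : ∀ u ∈ S, u ∈ C → u = c) (hSQ : ∀ u ∈ S, u ∉ Q) (hySn : y ∉ S)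
    (hyS : ∃ u ∈ S, G.Adj y u) :
    IsMinor (completeBipartiteGraph (Fin 3) (Fin 3)) G := by
  obtain ⟨hmem, hne, hxL, hxB, hcL, hcB, hLB, hL, hB, ⟨a, haL, hxa⟩, ⟨b, hbB, hxb⟩,
    ⟨a', haL', hca'⟩, ⟨b', hbB', hcb'⟩, hnadj⟩ := h
  obtain ⟨q₁, hq₁, q₁', hq₁', h₁⟩ := hQL
  obtain ⟨q₂, hq₂, q₂', hq₂', h₂⟩ := hQB
  obtain ⟨u, hu, hyu⟩ := hyQ
  obtain ⟨s, hs, hys⟩ := hyS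
  have hQC := fun u hu => hQ.subset (a := u) hu
  refine isMinor_completeBipartiteGraph_fin [{x}, Q, S] [L, B, {y}] ?_ ?_ ?_
  · simp only [List.cons_append, List.nil_append, List.forall_mem_cons]
    exact ⟨⟨⟨x, rfl⟩, .singleton G x⟩, ⟨⟨u, hu⟩, hQ.conn⟩, ⟨⟨c, hcS⟩, hS⟩, ⟨⟨a, haL⟩, hL⟩,
      ⟨⟨b, hbB⟩, hB⟩, ⟨⟨y, rfl⟩, .singleton G y⟩, by simp⟩
  · simp only [List.cons_append, List.nil_append, List.pairwise_cons, List.forall_mem_cons,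
      Set.disjoint_left]
    and_intros <;> grind
  · simp only [List.forall_mem_cons]
    exact ⟨⟨⟨x, rfl, a, haL, hxa⟩, ⟨x, rfl, b, hbB, hxb⟩, ⟨x, rfl, y, rfl, hxy⟩, by simp⟩,
      ⟨⟨q₁', hq₁', q₁, hq₁, h₁.symm⟩, ⟨q₂', hq₂', q₂, hq₂, h₂.symm⟩,
        ⟨u, hu, y, rfl, hyu.symm⟩, by simp⟩,
      ⟨⟨c, hcS, a', haL', hca'⟩, ⟨c, hcS, b', hbB', hcb'⟩, ⟨s, hs, y, rfl, hys.symm⟩, by simp⟩,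
      by simp⟩

section Contractible

variable [Finite V] {G : SimpleGraph V} {C : Set V} {x y : V}

/-- If `C` is an induced nonseparating cycle containing exactly one end `x` of a contractible edge
`xy` of a planar graph, then `y` has no neighbors on `C` besides `x` and the neighbors of `x`. -/
theorem InducedCycle.adj_of_adj (hpl : Planar G) (hC : InducedCycle G C)
    (hC' : CutConnected G Cᶜ) (hxy : IsContractible G x y) (hx : x ∈ C) (hy : y ∉ C)
    {c : V} (hc : c ∈ C) (hyc : G.Adj y c) : c = x ∨ G.Adj x c := by
  by_contra! hcx
  obtain ⟨p, hp, q, hq, hpq, hxp, hxq, -⟩ := hC.2.2 x hx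
  obtain ⟨L, hL, hpL⟩ := exists_isComponent G (S := C \ {x, c}) (a := p) (by
    have := hxp.ne
    grind)
  have hLC := fun u hu => hL.subset (a := u) hu
  obtain ⟨l, hl, hlL, c', hc', hcL, hlc⟩ := (hC.diff_singleton hx).exists_adj (A := L) (a := p)
    (b := c) (by grind) hpL (by grind) (by grind)
  have := hL.closed l hlL c'
  obtain rfl : c' = c := by grind
  have hqL : q ∉ L := fun h => by
    have := hL.conn.eq_or_eq_of_adj hC (by grind) hpL hx (by grind) hxp.symm hlL hc hcL hlc
      hcx.1.symm h hx (by grind) hxq.symm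
    grind
  have harc := hC.isArcs hL.conn (by grind) hx (by grind) hpL hxp hc hcL hlL hlc.symm hcx.1.symm
    ⟨q, by have := hxq.ne; grind⟩
  obtain ⟨Q, hQ, hQL, hQB⟩ := harc.exists_crossing hy (hxy.2 c')
  refine hpl.2 (harc.isMinor (S := {c'}) hy hxy.1 hQ hQL hQB ?_ (.singleton G c') rfl (by simp) ?_
    (by grind) ⟨c', rfl, hyc⟩)
  · obtain ⟨-, -, w, hw, -⟩ := hQL
    exact hQ.exists_adj_of_compl ⟨w, hw⟩ hy hC'
  · rintro u rfl hu
    exact (hQ.subset hu).1 hc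

theorem InducedCycle.exists_adj_component (hG : ThreeConnected G) (hpl : Planar G)
    (hC : InducedCycle G C) (hC' : CutConnected G Cᶜ) (hxy : IsContractible G x y) (hx : x ∈ C)
    (hy : y ∉ C) {p : V} (hp : p ∈ C) (hxp : G.Adj x p) {Q : Set V}
    (hQ : IsComponent G (Cᶜ \ {y}) Q) (hQne : Q.Nonempty) : ∃ u ∈ Q, G.Adj p u := by
  by_contra! hpQ
  have hQC := fun u hu => hQ.subset (a := u) hu
  have hyQ := hQ.exists_adj_of_compl hQne hy hC'
  obtain ⟨r, hr⟩ := hQne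
  have hpx := hxp.ne
  obtain ⟨u₀, hu₀, hu₀Q, t, ht, htQ, hut⟩ := (hG.compl_pair x y).exists_adj (A := Q) (a := r)
    (b := p) (by grind) hr (by grind) (by grind)
  have htC : t ∈ C := by
    have := hQ.closed u₀ hu₀Q t
    grind
  obtain ⟨L, hL, hpL⟩ := exists_isComponent G (S := {u | u ∈ C \ {x} ∧ ∀ w ∈ Q, ¬ G.Adj u w})
    (a := p) ⟨by grind, hpQ⟩
  have hLC := fun u hu => hL.subset (a := u) hu
  have hLC' : L ⊆ C := fun u hu => (hLC u hu).1.1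
  have hxL : x ∉ L := fun h => (hLC x h).1.2 rfl
  obtain ⟨l, hl, hlL, c, hc, hcL, hlc⟩ := (hC.diff_singleton hx).exists_adj (A := L) (a := p)
    (b := t) (by grind) hpL (by grind) (fun h => (hLC t h).2 u₀ hu₀Q hut.symm)
  obtain ⟨s, hs, hcs⟩ : ∃ s ∈ Q, G.Adj c s := by
    by_contra! h
    exact hcL (hL.closed l hlL c ⟨hc, h⟩ hlc)
  have hxc : x ≠ c := fun h => hc.2 h.symm
  by_cases hB : (C \ (L ∪ {x, c})).Nonempty
  · have harc := hC.isArcs hL.conn hLC' hx hxL hpL hxp hc.1 hcL hlL hlc.symm hxc hB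
    obtain ⟨Q', hQ', hQL', hQB'⟩ := harc.exists_crossing hy (hxy.2 c)
    have hQC' := fun u hu => hQ'.subset (a := u) hu
    obtain ⟨a, ha, b, hb, hab⟩ := hQL'
    have hdisj : ∀ u ∈ Q, u ∉ Q' := fun u hu hu' =>
      (hLC a ha).2 b (hQ'.subset_of_mem hu' hu hQ.closed hb) hab
    obtain ⟨v, hv, hyv⟩ := hyQ
    refine hpl.2 (harc.isMinor (S := insert c Q) hy hxy.1 hQ' ⟨a, ha, b, hb, hab⟩ hQB'
      (hQ'.exists_adj_of_compl ⟨b, hb⟩ hy hC') (hQ.conn.insert_of_adj hs hcs) (by simp) ?_ ?_ ?_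
      ⟨v, by simp [hv], hyv⟩) <;> grind
  · obtain ⟨u, hu, huQ, w, hw, hwQ, huw⟩ := (hxy.2 c).exists_adj (A := Q) (a := r)
      (b := p) (by grind) hr (by grind) (by grind)
    have hwL : w ∈ L := by
      have := hQ.closed u huQ w
      by_contra hwL
      exact hB ⟨w, by grind⟩
    exact (hLC w hwL).2 u huQ huw.symm

/-- If `C` is an induced nonseparating cycle containing exactly one end `x` of a contractible edge
`xy` of a planar graph, then `y` does not separate the complement of `C`. -/
theorem InducedCycle.compl_diff_singleton (hG : ThreeConnected G) (hpl : Planar G)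
    (hC : InducedCycle G C) (hC' : CutConnected G Cᶜ) (hxy : IsContractible G x y) (hx : x ∈ C)
    (hy : y ∉ C) : CutConnected G (Cᶜ \ {y}) := by
  by_contra h
  obtain ⟨A, hA, ⟨a, ha⟩, ⟨b, hb⟩, hAcl⟩ := not_cutConnected h
  obtain ⟨Q₁, hQ₁, haQ⟩ := exists_isComponent G (hA ha)
  obtain ⟨Q₂, hQ₂, hbQ⟩ := exists_isComponent G hb.1
  have hdisj : ∀ u ∈ Q₁, u ∉ Q₂ := fun u h₁ h₂ =>
    hb.2 (hQ₁.subset_of_mem haQ ha hAcl (hQ₂.subset_of_mem h₂ h₁ hQ₁.closed hbQ))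
  have hQC₁ := fun u hu => hQ₁.subset (a := u) hu
  have hQC₂ := fun u hu => hQ₂.subset (a := u) hu
  obtain ⟨p, hp, q, hq, hpq, hxp, hxq, -⟩ := hC.2.2 x hx
  obtain ⟨p₁, hp₁, hpp₁⟩ := hC.exists_adj_component hG hpl hC' hxy hx hy hp hxp hQ₁ ⟨a, haQ⟩
  obtain ⟨p₂, hp₂, hpp₂⟩ := hC.exists_adj_component hG hpl hC' hxy hx hy hp hxp hQ₂ ⟨b, hbQ⟩
  obtain ⟨q₁, hq₁, hqq₁⟩ := hC.exists_adj_component hG hpl hC' hxy hx hy hq hxq hQ₁ ⟨a, haQ⟩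
  obtain ⟨q₂, hq₂, hqq₂⟩ := hC.exists_adj_component hG hpl hC' hxy hx hy hq hxq hQ₂ ⟨b, hbQ⟩
  obtain ⟨y₁, hy₁, hyy₁⟩ := hQ₁.exists_adj_of_compl ⟨a, haQ⟩ hy hC'
  obtain ⟨y₂, hy₂, hyy₂⟩ := hQ₂.exists_adj_of_compl ⟨b, hbQ⟩ hy hC'
  refine hpl.2 (isMinor_completeBipartiteGraph_fin [{p}, {q}, {y}] [{x}, Q₁, Q₂] ?_ ?_ ?_)
  · simp only [List.cons_append, List.nil_append, List.forall_mem_cons]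
    exact ⟨⟨⟨p, rfl⟩, .singleton G p⟩, ⟨⟨q, rfl⟩, .singleton G q⟩, ⟨⟨y, rfl⟩, .singleton G y⟩,
      ⟨⟨x, rfl⟩, .singleton G x⟩, ⟨⟨a, haQ⟩, hQ₁.conn⟩, ⟨⟨b, hbQ⟩, hQ₂.conn⟩, by simp⟩
  · have := hxp.ne
    have := hxq.ne
    simp only [List.cons_append, List.nil_append, List.pairwise_cons, List.forall_mem_cons,
      Set.disjoint_left]
    and_intros <;> grind
  · simp only [List.forall_mem_cons]
    exact ⟨⟨⟨p, rfl, x, rfl, hxp.symm⟩, ⟨p, rfl, p₁, hp₁, hpp₁⟩, ⟨p, rfl, p₂, hp₂, hpp₂⟩,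
      by simp⟩, ⟨⟨q, rfl, x, rfl, hxq.symm⟩, ⟨q, rfl, q₁, hq₁, hqq₁⟩, ⟨q, rfl, q₂, hq₂, hqq₂⟩,
      by simp⟩, ⟨⟨y, rfl, x, rfl, hxy.1.symm⟩, ⟨y, rfl, y₁, hy₁, hyy₁⟩, ⟨y, rfl, y₂, hy₂, hyy₂⟩,
      by simp⟩, by simp⟩

end Contractible

/-- `f` exhibits `H` as the graph obtained from `G` by contracting the edge `xy`. -/
structure IsContraction (G : SimpleGraph V) (H : SimpleGraph W) (f : V → W) (x y : V) : Prop where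
  adj : G.Adj x y
  surjective : Function.Surjective f
  eq_iff : ∀ u w, f u = f w ↔ u = w ∨ (u = x ∨ u = y) ∧ (w = x ∨ w = y)
  adj_iff : ∀ a b, H.Adj a b ↔ a ≠ b ∧ ∃ u w, f u = a ∧ f w = b ∧ G.Adj u w

theorem InducedCycle.diff_pair [Finite V] {G : SimpleGraph V} {C : Set V} {x p : V}
    (hC : InducedCycle G C) (hx : x ∈ C) (hp : p ∈ C) (hxp : G.Adj x p) :
    CutConnected G (C \ {x, p}) := by
  by_contra h
  have key : ∀ A ⊆ C \ {x, p}, A.Nonempty → (∀ a ∈ A, ∀ b ∈ C \ {x, p}, G.Adj a b → b ∈ A) →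
      ∃ a ∈ A, G.Adj x a := by
    rintro A hAC ⟨a, ha⟩ hA
    have haC := hAC ha
    obtain ⟨u, hu, huA, w, hw, hwA, huw⟩ := (hC.diff_singleton hp).exists_adj (A := A) (a := a)
      (b := x) (by grind) ha ⟨hx, hxp.ne⟩ (fun h => (hAC h).2 (by simp))
    have := hA u huA w
    obtain rfl : w = x := by grind
    exact ⟨u, huA, huw.symm⟩
  obtain ⟨A, hAC, hAne, hne, hA⟩ := not_cutConnected h
  obtain ⟨a, ha, hxa⟩ := key A hAC hAne hA
  obtain ⟨b, hb, hxb⟩ := key _ Set.sdiff_subset hne (fun a ha b hb hab =>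
    ⟨hb, fun h => ha.2 (hA b h a ha.1 hab.symm)⟩)
  obtain ⟨r, -, s, -, -, -, -, h2⟩ := hC.2.2 x hx
  have := h2 p hp hxp
  have := h2 a (hAC ha).1 hxa
  have := h2 b hb.1.1 hxb
  have := hAC ha
  grind

theorem inducedCycle_image_iff {G : SimpleGraph V} {H : SimpleGraph W} {f : V → W} {C : Set V}
    (hinj : Set.InjOn f C) (hadj : ∀ u ∈ C, ∀ w ∈ C, H.Adj (f u) (f w) ↔ G.Adj u w) :
    InducedCycle H (f '' C) ↔ InducedCycle G C := by
  have hmem : ∀ u ∈ C, ∀ A ⊆ C, f u ∈ f '' A ↔ u ∈ A := fun u hu A hA =>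
    ⟨fun ⟨w, hw, h⟩ => hinj (hA hw) hu h ▸ hw, fun h => ⟨u, h, rfl⟩⟩
  have hcut : CutConnected H (f '' C) ↔ CutConnected G C := by
    constructor
    · rintro h A ⟨a, haC, haA⟩ hA u hu
      have := h (f '' (C ∩ A)) ⟨f a, ⟨a, haC, rfl⟩, a, ⟨haC, haA⟩, rfl⟩ ?_ ⟨u, hu, rfl⟩
      · rw [hmem u hu _ Set.inter_subset_left] at this
        exact this.2
      · rintro _ ⟨b, hb, rfl⟩ hbA _ ⟨c, hc, rfl⟩ hbc
        rw [hmem b hb _ Set.inter_subset_left] at hbA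
        exact ⟨c, ⟨hc, hA b hb hbA.2 c hc ((hadj b hb c hc).1 hbc)⟩, rfl⟩
    · rintro h A ⟨_, ⟨a, ha, rfl⟩, haA⟩ hA _ ⟨u, hu, rfl⟩
      exact h (f ⁻¹' A) ⟨a, ha, haA⟩ (fun b hb hbA c hc hbc =>
        hA _ ⟨b, hb, rfl⟩ hbA _ ⟨c, hc, rfl⟩ ((hadj b hb c hc).2 hbc)) hu
  rw [InducedCycle, InducedCycle, hcut, Set.image_nonempty, Set.forall_mem_image]
  refine and_congr_right' (and_congr_right' (forall₂_congr fun u hu => ?_))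
  simp only [Set.exists_mem_image, Set.forall_mem_image]
  refine exists_congr fun p => and_congr_right fun hp => exists_congr fun q =>
    and_congr_right fun hq => ?_
  rw [hinj.ne_iff hp hq, hadj u hu p hp, hadj u hu q hq]
  refine and_congr_right' (and_congr_right' (and_congr_right' (forall₂_congr fun w hw => ?_)))
  rw [hadj u hu w hw, hinj.eq_iff hw hp, hinj.eq_iff hw hq]

namespace IsContraction

variable {G : SimpleGraph V} {H : SimpleGraph W} {f : V → W} {x y : V}

theorem symm (h : IsContraction G H f x y) : IsContraction G H f y x :=
  ⟨h.adj.symm, h.surjective, fun u w => by rw [h.eq_iff, or_comm (a := u = x),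
    or_comm (a := w = x)], h.adj_iff⟩

theorem map_adj (h : IsContraction G H f x y) {u w : V} (huw : G.Adj u w) (hne : f u ≠ f w) :
    H.Adj (f u) (f w) :=
  (h.adj_iff _ _).2 ⟨hne, u, w, rfl, rfl, huw⟩

theorem map_eq (h : IsContraction G H f x y) : f x = f y :=
  (h.eq_iff x y).2 (by simp)

theorem mem_of_map_eq {A : Set V} (h : IsContraction G H f x y)
    (hxA : x ∈ A ↔ y ∈ A) {u w : V} (huw : f u = f w) (hu : u ∈ A) : w ∈ A := by
  have := (h.eq_iff u w).1 huw
  grind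

theorem preimage_image (h : IsContraction G H f x y) {C : Set V} (hxC : x ∈ C ↔ y ∈ C) :
    f ⁻¹' (f '' C) = C :=
  Set.Subset.antisymm (fun _ ⟨_, hw, hwu⟩ => h.mem_of_map_eq hxC hwu hw)
    (Set.subset_preimage_image f C)

theorem preimage_image_of_mem (h : IsContraction G H f x y) {C : Set V} (hx : x ∈ C) :
    f ⁻¹' (f '' C) = insert y C := by
  rw [← h.preimage_image (C := insert y C) (by simp [hx]), Set.image_insert_eq, ← h.map_eq,
    Set.insert_eq_of_mem (Set.mem_image_of_mem f hx)]

theorem cutConnected_image (h : IsContraction G H f x y) {C : Set V} (hC : CutConnected G C) :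
    CutConnected H (f '' C) := by
  rintro A ⟨_, ⟨a, ha, rfl⟩, haA⟩ hA _ ⟨u, hu, rfl⟩
  refine hC (f ⁻¹' A) ⟨a, ha, haA⟩ (fun b hb hbA c hc hbc => ?_) hu
  by_cases hne : f b = f c
  · rwa [Set.mem_preimage, ← hne]
  · exact hA _ ⟨b, hb, rfl⟩ hbA _ ⟨c, hc, rfl⟩ (h.map_adj hbc hne)

theorem cutConnected_preimage_iff (h : IsContraction G H f x y) {D : Set W} :
    CutConnected G (f ⁻¹' D) ↔ CutConnected H D := by
  constructor
  · intro hD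
    have := h.cutConnected_image hD
    rwa [Set.image_preimage_eq D h.surjective] at this
  · rintro hD A ⟨a, haD, haA⟩ hA u hu
    have hxA : x ∈ f ⁻¹' D ∩ A ↔ y ∈ f ⁻¹' D ∩ A := by
      have hxy : x ∈ f ⁻¹' D ↔ y ∈ f ⁻¹' D := by simp [h.map_eq]
      constructor
      · rintro ⟨hx, hxA⟩
        exact ⟨hxy.1 hx, hA x hx hxA y (hxy.1 hx) h.adj⟩
      · rintro ⟨hy, hyA⟩
        exact ⟨hxy.2 hy, hA y hy hyA x (hxy.2 hy) h.adj.symm⟩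
    obtain ⟨w, hw, hwu⟩ := hD (f '' (f ⁻¹' D ∩ A)) ⟨f a, haD, a, ⟨haD, haA⟩, rfl⟩ (by
      rintro _ hb ⟨u, huA, rfl⟩ _ hw huw
      obtain ⟨-, u', w', hu', rfl, h'⟩ := (h.adj_iff _ _).1 huw
      have := h.mem_of_map_eq hxA hu'.symm huA
      exact ⟨w', ⟨hw, hA u' this.1 this.2 w' hw h'⟩, rfl⟩) hu
    exact (h.mem_of_map_eq hxA hwu hw).2

theorem planar (h : IsContraction G H f x y) (hpl : Planar G) : Planar H := by
  have key : ∀ {U : Type} (K : SimpleGraph U), IsMinor K H → IsMinor K G := by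
    rintro U K ⟨b, hne, hconn, hdisj, hadj⟩
    refine ⟨fun i => f ⁻¹' b i, fun i => (hne i).preimage h.surjective, fun i => ?_,
      fun i j hij => (hdisj hij).preimage f, fun i j hij => ?_⟩
    · have := hconn i
      rw [induce_connected_iff] at this ⊢
      exact ⟨this.1.preimage h.surjective, h.cutConnected_preimage_iff.2 this.2⟩
    · obtain ⟨c, hc, d, hd, hcd⟩ := hadj i j hij
      obtain ⟨-, u, w, rfl, rfl, huw⟩ := (h.adj_iff c d).1 hcd
      exact ⟨u, hc, w, hd, huw⟩
  exact ⟨fun h => hpl.1 (key _ h), fun h => hpl.2 (key _ h)⟩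

theorem threeConnected [Finite W] (h : IsContraction G H f x y) (hG : ThreeConnected G)
    (hc : IsContractible G x y) (hW : 3 ≤ Nat.card W) : ThreeConnected H := by
  rw [threeConnected_iff]
  refine fun S hS => ⟨nonempty_compl_of_ncard_lt (by omega), ?_⟩
  rw [← h.cutConnected_preimage_iff, Set.preimage_compl]
  by_cases hx : f x ∈ S
  · obtain ⟨z, hz⟩ : ∃ z, S ⊆ {f x, f z} := by
      have := Set.ncard_sdiff_singleton_add_one hx
      have : Nonempty W := ⟨f x⟩
      obtain ⟨a, ha⟩ := (Set.ncard_le_one_iff_subset_singleton (s := S \ {f x})).1 (by omega)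
      obtain ⟨z, rfl⟩ := h.surjective a
      exact ⟨z, Set.sdiff_subset_iff.1 ha⟩
    by_cases hzS : f z ∈ S
    · convert hc.2 z using 2
      ext u
      have := h.eq_iff u x
      have := h.eq_iff u z
      grind
    · convert hG.compl_pair x y using 2
      ext u
      have := h.eq_iff u x
      have := h.eq_iff u z
      grind
  · refine (threeConnected_iff.1 hG _ ?_).2
    refine (Set.ncard_le_ncard_of_injOn f (fun u hu => hu) fun u hu w hw huw => ?_).trans hS
    have hu : f u ∈ S := hu
    have hw : f w ∈ S := hw
    have := h.map_eq
    have := (h.eq_iff u w).1 huw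
    grind

end IsContraction

namespace IsContraction

variable {G : SimpleGraph V} {H : SimpleGraph W} {f : V → W} {x y : V}

theorem inducedCycle_image_iff (h : IsContraction G H f x y) {C : Set V} (hy : y ∉ C)
    (hN : x ∈ C → ∀ w ∈ C, G.Adj y w → w = x ∨ G.Adj x w) :
    InducedCycle H (f '' C) ↔ InducedCycle G C := by
  have hinj : Set.InjOn f C := fun u hu w hw huw => by
    have := (h.eq_iff u w).1 huw
    grind
  refine _root_.inducedCycle_image_iff hinj fun u hu w hw => ⟨fun huw => ?_, fun huw =>
    h.map_adj huw (hinj.ne hu hw huw.ne)⟩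
  obtain ⟨hne, u', w', hu', hw', h'⟩ := (h.adj_iff _ _).1 huw
  have hne' : u ≠ w := fun h => hne (by rw [h])
  have hu' := (h.eq_iff u' u).1 hu'
  have hw' := (h.eq_iff w' w).1 hw'
  have := h'.symm
  have := fun h => hN h u hu
  have := fun h => hN h w hw
  have := fun h : G.Adj x u => h.symm
  grind

/-- The image of an induced cycle through both ends of the contracted edge. -/
theorem inducedCycle_image (h : IsContraction G H f x y) {C : Set V} (hC : InducedCycle G C)
    (hx : x ∈ C) (hy : y ∈ C) (hne : ∀ z, C ≠ {x, y, z}) : InducedCycle H (f '' C) := by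
  have hpre : ∀ u w, u ∈ C → f w = f u → w ∈ C := fun u w hu hwu =>
    h.mem_of_map_eq (A := C) (by simp [hx, hy]) hwu.symm hu
  obtain ⟨p, hp, hpy, hxp, hxC⟩ : ∃ p ∈ C, p ≠ y ∧ G.Adj x p ∧
      ∀ w ∈ C, G.Adj x w → w = y ∨ w = p := by
    obtain ⟨a, ha, b, hb, hab, hxa, hxb, h2⟩ := hC.2.2 x hx
    rcases h2 y hy h.adj with rfl | rfl
    · exact ⟨b, hb, hab.symm, hxb, h2⟩
    · exact ⟨a, ha, hab, hxa, fun w hw hxw => (h2 w hw hxw).symm⟩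
  obtain ⟨q, hq, hqx, hyq, hyC⟩ : ∃ q ∈ C, q ≠ x ∧ G.Adj y q ∧
      ∀ w ∈ C, G.Adj y w → w = x ∨ w = q := by
    obtain ⟨a, ha, b, hb, hab, hxa, hxb, h2⟩ := hC.2.2 y hy
    rcases h2 x hx h.adj.symm with rfl | rfl
    · exact ⟨b, hb, hab.symm, hxb, h2⟩
    · exact ⟨a, ha, hab, hxa, fun w hw hxw => (h2 w hw hxw).symm⟩
  have hpx := hxp.ne
  have hqy := hyq.ne
  have hxy := h.adj.ne
  have htri : ∀ u ∈ C, G.Adj u x → G.Adj u y → False := by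
    intro u hu hux huy
    refine hne u (Set.Subset.antisymm ?_ (by grind))
    refine hC.2.1 _ ⟨x, hx, by simp⟩ ?_
    have := hxC u hu hux.symm
    have := hyC u hu huy.symm
    have hux' := hux.ne
    have huy' := huy.ne
    obtain ⟨a, ha, b, hb, -, -, -, h2⟩ := hC.2.2 u hu
    have := h2 x hx hux
    have := h2 y hy huy
    rintro a ha (rfl | rfl | rfl) b hb hab
    · grind
    · grind
    · have := h2 b hb hab
      grind
  refine ⟨hC.1.image f, h.cutConnected_image hC.2.1, ?_⟩
  rintro _ ⟨u, hu, rfl⟩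
  by_cases huxy : u = x ∨ u = y
  · have hfu : f u = f x := (h.eq_iff u x).2 (by grind)
    rw [hfu]
    refine ⟨f p, ⟨p, hp, rfl⟩, f q, ⟨q, hq, rfl⟩, ?_, ?_, ?_, ?_⟩
    · rw [Ne, h.eq_iff]
      have := htri p hp hxp.symm
      have := hyq.symm
      grind
    · refine h.map_adj hxp ?_
      rw [Ne, h.eq_iff]
      grind
    · rw [h.map_eq]
      refine h.map_adj hyq ?_
      rw [Ne, h.eq_iff]
      grind
    · rintro _ ⟨w, hw, rfl⟩ hw'
      obtain ⟨-, a, b, ha, hb, hab⟩ := (h.adj_iff _ _).1 hw'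
      have hbC := hpre w b hw hb
      have := hw'.ne
      have := h.map_eq
      have ha := (h.eq_iff a x).1 ha
      have := hxC b hbC
      have := hyC b hbC
      grind
  · obtain ⟨a, ha, b, hb, hab, hua, hub, h2⟩ := hC.2.2 u hu
    have := htri u hu
    refine ⟨f a, ⟨a, ha, rfl⟩, f b, ⟨b, hb, rfl⟩, ?_, ?_, ?_, ?_⟩
    · rw [Ne, h.eq_iff]
      grind
    · refine h.map_adj hua ?_
      rw [Ne, h.eq_iff]
      have := hua.ne
      grind
    · refine h.map_adj hub ?_
      rw [Ne, h.eq_iff]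
      have := hub.ne
      grind
    · rintro _ ⟨w, hw, rfl⟩ hw'
      obtain ⟨-, u', w', hu', hww, hab⟩ := (h.adj_iff _ _).1 hw'
      have hwC := hpre w w' hw hww
      have hu' := (h.eq_iff u' u).1 hu'
      have := h2 w' hwC
      grind

variable [Finite V] [Finite W]

theorem image_mem_nonsepCycles (h : IsContraction G H f x y) (hG : ThreeConnected G)
    (hpl : Planar G) (hc : IsContractible G x y) {C : Set V} (hC : C ∈ nonsepCycles G)
    (hne : ∀ z, C ≠ {x, y, z}) : f '' C ∈ nonsepCycles H := by
  have key : ∀ {x y : V}, IsContraction G H f x y → IsContractible G x y → (∀ z, C ≠ {x, y, z}) →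
      (x ∉ C → y ∉ C) → f '' C ∈ nonsepCycles H := by
    intro x y h hc hne himp
    rw [mem_nonsepCycles] at hC ⊢
    obtain ⟨hC, hC'⟩ := hC
    rw [← h.cutConnected_preimage_iff, Set.preimage_compl]
    by_cases hx : x ∈ C
    · by_cases hy : y ∈ C
      · rw [h.preimage_image (by simp [hx, hy])]
        exact ⟨h.inducedCycle_image hC hx hy hne, hC'⟩
      · rw [h.preimage_image_of_mem hx]
        refine ⟨(h.inducedCycle_image_iff hy fun _ w hw hyw => ?_).2 hC, ?_⟩
        · exact hC.adj_of_adj hpl hC' hc hx hy hw hyw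
        · convert hC.compl_diff_singleton hG hpl hC' hc hx hy using 1
          ext u
          simp [and_comm]
    · rw [h.preimage_image (by simp [hx, himp hx])]
      exact ⟨(h.inducedCycle_image_iff (himp hx) fun hx' => absurd hx' hx).2 hC, hC'⟩
  by_cases hx : x ∈ C
  · exact key h hc hne (absurd hx)
  · exact key h.symm hc.symm (fun z => by rw [Set.insert_comm]; exact hne z) fun _ => hx

end IsContraction

theorem ThreeConnected.exists_adj_notMem [Finite V] {G : SimpleGraph V} (hG : ThreeConnected G)
    (hV : 4 ≤ Nat.card V) {C : Set V} (hC : InducedCycle G C) {u : V} (hu : u ∈ C) :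
    ∃ w, w ∉ C ∧ G.Adj u w := by
  obtain ⟨a, -, b, -, -, hua, hub, h2⟩ := hC.2.2 u hu
  obtain ⟨w, hwa, hwb, huw⟩ := hG.exists_adj_ne_ne hV hua.ne hub.ne
  exact ⟨w, fun hw => by have := h2 w hw huw; grind, huw⟩

namespace IsContraction

variable {G : SimpleGraph V} {H : SimpleGraph W} {f : V → W} {x y : V}

theorem preimage_diff_mem_nonsepCycles [Finite V] [Finite W] (h : IsContraction G H f x y)
    {D : Set W} (hD : D ∈ nonsepCycles H) (hx : f x ∈ D)
    (hxy : ∀ w, f w ∈ D → w ≠ x → G.Adj y w → G.Adj x w)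
    (hout : ∃ w, f w ∉ D ∧ G.Adj y w) :
    ∃ C ∈ nonsepCycles G, (∀ z, C ≠ {x, y, z}) ∧ f '' C = D := by
  rw [mem_nonsepCycles] at hD
  have himg : f '' (f ⁻¹' D \ {y}) = D := by
    refine Set.Subset.antisymm ?_ fun d hd => ?_
    · rintro _ ⟨u, hu, rfl⟩
      exact hu.1
    · obtain ⟨u, rfl⟩ := h.surjective d
      by_cases huy : u = y
      · subst huy
        exact ⟨x, ⟨hx, h.adj.ne⟩, h.map_eq⟩
      · exact ⟨u, ⟨hd, huy⟩, rfl⟩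
  refine ⟨f ⁻¹' D \ {y}, ?_, fun z hz => ?_, himg⟩
  · rw [mem_nonsepCycles]
    constructor
    · rw [← h.inducedCycle_image_iff (by simp), himg]
      · exact hD.1
      · intro _ w hw hyw
        have := hxy w hw.1
        grind
    · obtain ⟨w, hw, hyw⟩ := hout
      have := (h.cutConnected_preimage_iff.2 hD.2).insert_of_adj (a := y) hw hyw
      convert this using 1
      ext u
      simp
      grind
  · have : y ∈ f ⁻¹' D \ {y} := hz ▸ by simp
    exact this.2 rfl

theorem preimage_inducedCycle (h : IsContraction G H f x y) {D : Set W} (hD : InducedCycle H D)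
    {p q : V} (hp : f p ∈ D) (hq : f q ∈ D) (hpq : p ≠ q) (hpy : p ≠ y) (hqx : q ≠ x)
    (hxp : G.Adj x p) (hyq : G.Adj y q) (hx : ∀ w, f w ∈ D → G.Adj x w → w = y ∨ w = p)
    (hy : ∀ w, f w ∈ D → G.Adj y w → w = x ∨ w = q) (hxD : f x ∈ D) :
    InducedCycle G (f ⁻¹' D) := by
  have hyD : f y ∈ D := h.map_eq ▸ hxD
  refine ⟨⟨x, hxD⟩, h.cutConnected_preimage_iff.2 hD.2.1, fun u hu => ?_⟩
  by_cases hux : u = x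
  · subst hux
    exact ⟨y, hyD, p, hp, hpy.symm, h.adj, hxp, hx⟩
  by_cases huy : u = y
  · subst huy
    exact ⟨x, hxD, q, hq, hqx.symm, h.adj.symm, hyq, hy⟩
  have huniq : ∀ a w, G.Adj u a → G.Adj u w → f w = f a → w = a := by
    intro a w hua huw hwa
    have := (h.eq_iff w a).1 hwa
    have := hua.symm
    have := huw.symm
    have := hx u hu
    have := hy u hu
    grind
  have hlift : ∀ A, H.Adj (f u) A → ∃ a, f a = A ∧ G.Adj u a := by
    intro A hA
    obtain ⟨-, u', a, hu', rfl, hadj⟩ := (h.adj_iff _ _).1 hA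
    have := (h.eq_iff u' u).1 hu'
    exact ⟨a, rfl, by grind⟩
  obtain ⟨A, hA, B, hB, hAB, huA, huB, h2⟩ := hD.2.2 (f u) hu
  obtain ⟨a, rfl, hua⟩ := hlift A huA
  obtain ⟨b, rfl, hub⟩ := hlift B huB
  refine ⟨a, hA, b, hB, fun h => hAB (by rw [h]), hua, hub, fun w hw huw => ?_⟩
  have hne : f u ≠ f w := by
    rw [Ne, h.eq_iff]
    have := huw.ne
    grind
  exact (h2 (f w) hw (h.map_adj huw hne)).imp (huniq _ _ hua huw) (huniq _ _ hub huw)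

theorem exists_mem_nonsepCycles [Finite V] [Finite W] (h : IsContraction G H f x y)
    (hG : ThreeConnected G) (hH : ThreeConnected H) (hV : 4 ≤ Nat.card V) (hW : 4 ≤ Nat.card W)
    {D : Set W} (hD : D ∈ nonsepCycles H) :
    ∃ C ∈ nonsepCycles G, (∀ z, C ≠ {x, y, z}) ∧ f '' C = D := by
  have hD' := mem_nonsepCycles.1 hD
  have himg := Set.image_preimage_eq D h.surjective
  have hcompl := h.cutConnected_preimage_iff.2 hD'.2
  rw [Set.preimage_compl] at hcompl
  have hmap := h.map_eq
  by_cases hx : f x ∈ D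
  swap
  · refine ⟨f ⁻¹' D, mem_nonsepCycles.2 ⟨?_, hcompl⟩, ?_, himg⟩
    · rw [← h.inducedCycle_image_iff (by simpa [← h.map_eq] using hx) (fun h => absurd h hx),
        himg]
      exact hD'.1
    · rintro z hz
      have : x ∈ f ⁻¹' D := hz ▸ by simp
      exact hx this
  obtain ⟨p', hp, q', hq, hpq, hxp, hxq, h2⟩ := hD'.1.2.2 (f x) hx
  obtain ⟨p, rfl⟩ := h.surjective p'
  obtain ⟨q, rfl⟩ := h.surjective q'
  have hpne : p ≠ x ∧ p ≠ y := ⟨fun e => hxp.ne (by rw [e]), fun e => hxp.ne (by rw [e, hmap])⟩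
  have hqne : q ≠ x ∧ q ≠ y := ⟨fun e => hxq.ne (by rw [e]), fun e => hxq.ne (by rw [e, hmap])⟩
  have hlift : ∀ w, w ≠ x → w ≠ y → H.Adj (f x) (f w) → G.Adj x w ∨ G.Adj y w := by
    intro w hwx hwy hw
    obtain ⟨-, u', w', hu', hw', hadj⟩ := (h.adj_iff _ _).1 hw
    have := (h.eq_iff u' x).1 hu'
    have := (h.eq_iff w' w).1 hw'
    grind
  have hp' := hlift p hpne.1 hpne.2 hxp
  have hq' := hlift q hqne.1 hqne.2 hxq
  have hnb : ∀ w, f w ∈ D → w ≠ x → w ≠ y → (G.Adj x w ∨ G.Adj y w) → w = p ∨ w = q := by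
    intro w hw hwx hwy hadj
    have hne : f x ≠ f w := by
      rw [Ne, h.eq_iff]
      grind
    have : H.Adj (f x) (f w) := by
      rcases hadj with hadj | hadj
      · exact h.map_adj hadj hne
      · rw [hmap] at hne ⊢
        exact h.map_adj hadj hne
    have := h2 _ hw this
    rw [h.eq_iff, h.eq_iff] at this
    grind
  have hout : ∀ u a b, (u = x ∨ u = y) → u ≠ a → u ≠ b →
      (∃ w, f w ∉ D ∧ G.Adj u w) ∨ ∃ w, f w ∈ D ∧ w ≠ a ∧ w ≠ b ∧ G.Adj u w := by
    intro u a b hu ha hb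
    obtain ⟨w, hwa, hwb, huw⟩ := hG.exists_adj_ne_ne hV ha hb
    by_cases hw : f w ∈ D
    · exact Or.inr ⟨w, hw, hwa, hwb, huw⟩
    · exact Or.inl ⟨w, hw, huw⟩
  have hadj : ∀ a b, a = p ∧ b = q ∨ a = q ∧ b = p →
      ((∃ w, f w ∉ D ∧ G.Adj x w) ∨ G.Adj x b) ∧ ((∃ w, f w ∉ D ∧ G.Adj y w) ∨ G.Adj y b) := by
    intro a b hab
    constructor
    · refine (hout x y a (by simp) h.adj.ne (by grind)).imp id ?_
      rintro ⟨w, hw, hwa, hwb, hxw⟩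
      have := hnb w hw hxw.ne' hwa (Or.inl hxw)
      grind
    · refine (hout y x a (by simp) h.adj.ne' (by grind)).imp id ?_
      rintro ⟨w, hw, hwa, hwb, hxw⟩
      have := hnb w hw hwa hxw.ne' (Or.inr hxw)
      grind
  have hor : (∃ w, f w ∉ D ∧ G.Adj x w) ∨ ∃ w, f w ∉ D ∧ G.Adj y w := by
    obtain ⟨d, hd, hxd⟩ := hH.exists_adj_notMem hW hD'.1 hx
    obtain ⟨w, rfl⟩ := h.surjective d
    rcases hlift w (by grind) (by grind) hxd with hw | hw
    · exact Or.inl ⟨w, hd, hw⟩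
    · exact Or.inr ⟨w, hd, hw⟩
  by_cases hA : G.Adj x p ∧ G.Adj x q ∧ ∃ w, f w ∉ D ∧ G.Adj y w
  · exact h.preimage_diff_mem_nonsepCycles hD hx (fun w hw hwx hyw => by
      have := hnb w hw hwx hyw.ne' (Or.inr hyw)
      grind) hA.2.2
  by_cases hB : G.Adj y p ∧ G.Adj y q ∧ ∃ w, f w ∉ D ∧ G.Adj x w
  · obtain ⟨C, hC, hne, hCD⟩ := h.symm.preimage_diff_mem_nonsepCycles hD (hmap ▸ hx)
      (fun w hw hwx hyw => by
        have := hnb w hw hyw.ne' hwx (Or.inl hyw)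
        grind) hB.2.2
    exact ⟨C, hC, fun z => by rw [Set.insert_comm]; exact hne z, hCD⟩
  refine ⟨f ⁻¹' D, mem_nonsepCycles.2 ⟨?_, hcompl⟩, ?_, himg⟩
  · have h₁ := hadj p q (by simp)
    have h₂ := hadj q p (by simp)
    have hcases : (G.Adj x p ∧ ¬ G.Adj x q ∧ G.Adj y q ∧ ¬ G.Adj y p) ∨
        (G.Adj x q ∧ ¬ G.Adj x p ∧ G.Adj y p ∧ ¬ G.Adj y q) := by
      clear * - h₁ h₂ hor hA hB hp' hq'
      generalize (∃ w, f w ∉ D ∧ G.Adj x w) = a at *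
      generalize (∃ w, f w ∉ D ∧ G.Adj y w) = b at *
      grind
    have hpq' : p ≠ q := fun h => hpq (by rw [h])
    have hx' : ∀ w, f w ∈ D → G.Adj x w → w = y ∨ w = p ∨ w = q := by
      intro w hw hxw
      have := hnb w hw hxw.ne'
      grind
    have hy' : ∀ w, f w ∈ D → G.Adj y w → w = x ∨ w = p ∨ w = q := by
      intro w hw hxw
      have := hnb w hw
      have := hxw.ne'
      grind
    rcases hcases with ⟨hxp, hnxq, hyq, hnyp⟩ | ⟨hxq, hnxp, hyp, hnyq⟩
    · exact h.preimage_inducedCycle hD'.1 hp hq hpq' hpne.2 hqne.1 hxp hyq (by grind) (by grind) hx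
    · exact h.preimage_inducedCycle hD'.1 hq hp hpq'.symm hqne.2 hpne.1 hxq hyp (by grind)
        (by grind) hx
  · intro z hz
    have hpz : p ∈ f ⁻¹' D := hp
    have hqz : q ∈ f ⁻¹' D := hq
    grind

end IsContraction

theorem InducedCycle.not_insert {G : SimpleGraph V} {C : Set V} {x y : V}
    (hC : InducedCycle G C) (hx : x ∈ C) (hy : y ∉ C) (hxy : G.Adj x y) :
    ¬ InducedCycle G (insert y C) := by
  intro hC'
  obtain ⟨p, hp, q, hq, hpq, hxp, hxq, -⟩ := hC.2.2 x hx
  obtain ⟨a, -, b, -, -, -, -, h2⟩ := hC'.2.2 x (by simp [hx])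
  have := h2 p (by simp [hp]) hxp
  have := h2 q (by simp [hq]) hxq
  have := h2 y (by simp) hxy
  grind

namespace IsContraction

variable [Finite V] [Finite W] {G : SimpleGraph V} {H : SimpleGraph W} {f : V → W} {x y : V}

/-- Two induced nonseparating cycles that differ by exchanging the ends of the contracted edge
give rise to a `K₅` minor. -/
theorem insert_ne_insert (h : IsContraction G H f x y) (hG : ThreeConnected G)
    (hpl : Planar G) (hH : ThreeConnected H) (hW : 4 ≤ Nat.card W) (hc : IsContractible G x y)
    {C C' : Set V} (hC : C ∈ nonsepCycles G) (hC' : C' ∈ nonsepCycles G) (hx : x ∈ C) (hy : y ∉ C)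
    (hy' : y ∈ C') (hx' : x ∉ C') : insert y C ≠ insert x C' := by
  intro heq
  have hD := mem_nonsepCycles.1 (h.image_mem_nonsepCycles hG hpl hc hC
    (fun z hz => hy (hz ▸ by simp)))
  rw [mem_nonsepCycles] at hC hC'
  have hpre := h.preimage_image_of_mem hx
  have hF := h.cutConnected_preimage_iff.2 hD.2
  rw [Set.preimage_compl, hpre] at hF
  have hout : ∀ u ∈ C, u ≠ x → ∃ w ∈ (insert y C)ᶜ, G.Adj u w := by
    intro u hu hux
    obtain ⟨d, hd, hud⟩ := hH.exists_adj_notMem hW hD.1 ⟨u, hu, rfl⟩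
    obtain ⟨-, u', w, hu', rfl, hadj⟩ := (h.adj_iff _ _).1 hud
    have := (h.eq_iff u' u).1 hu'
    refine ⟨w, ?_, by grind⟩
    rw [← hpre]
    exact hd
  obtain ⟨p, hp, q, hq, hpq, hxp, hxq, h2⟩ := hC.1.2.2 x hx
  have hyp : ∀ r ∈ C', G.Adj y r → r ≠ x → r = p ∨ r = q := by
    intro r hr hyr hrx
    have hrC : r ∈ insert y C := heq ▸ by simp [hr]
    have hrC : r ∈ C := by
      have := hyr.ne
      grind
    have := hC.1.adj_of_adj hpl hC.2 hc hx hy hrC hyr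
    grind
  obtain ⟨p', hp', q', hq', hpq', hyp', hyq', -⟩ := hC'.1.2.2 y hy'
  have h₁ := hyp p' hp' hyp' (by grind)
  have h₂ := hyp q' hq' hyq' (by grind)
  have hyp : G.Adj y p := by grind
  have hyq : G.Adj y q := by grind
  clear hp' hq' hyp' hyq' h₁ h₂ hpq' p' q'
  have hxp' := hxp.ne
  have hxq' := hxq.ne
  obtain ⟨a, ha, hpa⟩ := hout p hp hxp'.symm
  obtain ⟨b, hb, hqb⟩ := hout q hq hxq'.symm
  have hend : ∀ {S : Set V} {u : V}, CutConnected G (insert u S) → u ∉ S → a ∈ S →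
      ∃ w ∈ S, G.Adj u w := by
    intro S u hS hu ha
    obtain ⟨u', -, rfl, w, hw, hne, hadj⟩ := hS.exists_adj (A := {u}) (a := u) (b := a)
      (by simp) rfl (by simp [ha]) (by rintro rfl; exact hu ha)
    exact ⟨w, by grind, hadj⟩
  obtain ⟨c, hcF, hxc⟩ : ∃ w ∈ (insert y C)ᶜ, G.Adj x w := by
    refine hend ?_ (by simp [hx]) ha
    convert hC'.2 using 1
    rw [heq]
    ext u
    grind
  obtain ⟨d, hdF, hyd⟩ : ∃ w ∈ (insert y C)ᶜ, G.Adj y w := by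
    refine hend ?_ (by simp) ha
    convert hC.2 using 1
    ext u
    grind
  obtain ⟨e, he, hpe⟩ : ∃ e ∈ C \ {x, p}, G.Adj p e := by
    obtain ⟨r, hr, s, hs, hrs, hpr, hps, -⟩ := hC.1.2.2 p hp
    have := hpr.ne
    have := hps.ne
    by_cases hrx : r = x
    · exact ⟨s, by grind, hps⟩
    · exact ⟨r, by grind, hpr⟩
  have hqS : q ∈ C \ {x, p} := by grind
  refine hpl.1 (isMinor_top_fin [{x}, {y}, {p}, C \ {x, p}, (insert y C)ᶜ] ?_ ?_)
  · simp only [List.forall_mem_cons]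
    exact ⟨⟨⟨x, rfl⟩, .singleton G x⟩, ⟨⟨y, rfl⟩, .singleton G y⟩, ⟨⟨p, rfl⟩, .singleton G p⟩,
      ⟨⟨q, hqS⟩, hC.1.diff_pair hx hp hxp⟩, ⟨⟨a, ha⟩, hF⟩, by simp⟩
  · simp only [List.pairwise_cons, List.forall_mem_cons, Set.disjoint_left]
    refine ⟨⟨⟨?_, x, rfl, y, rfl, h.adj⟩, ⟨?_, x, rfl, p, rfl, hxp⟩, ⟨?_, x, rfl, q, hqS, hxq⟩,
      ⟨?_, x, rfl, c, hcF, hxc⟩, by simp⟩, ⟨⟨?_, y, rfl, p, rfl, hyp⟩, ⟨?_, y, rfl, q, hqS, hyq⟩,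
      ⟨?_, y, rfl, d, hdF, hyd⟩, by simp⟩, ⟨⟨?_, p, rfl, e, he, hpe⟩, ⟨?_, p, rfl, a, ha, hpa⟩,
      by simp⟩, ⟨⟨?_, q, hqS, b, hb, hqb⟩, by simp⟩, by simp, by simp⟩ <;> grind

theorem image_injOn (h : IsContraction G H f x y) (hG : ThreeConnected G)
    (hpl : Planar G) (hH : ThreeConnected H) (hW : 4 ≤ Nat.card W) (hc : IsContractible G x y) :
    Set.InjOn (f '' ·) (nonsepCycles G) := by
  intro C hC C' hC' heq
  have heq : f ⁻¹' (f '' C) = f ⁻¹' (f '' C') := congrArg (f ⁻¹' ·) heq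
  have hmem : ∀ C : Set V, x ∈ C ∧ y ∈ C ∧ f ⁻¹' (f '' C) = C ∨
      x ∈ C ∧ y ∉ C ∧ f ⁻¹' (f '' C) = insert y C ∨ x ∉ C ∧ y ∈ C ∧ f ⁻¹' (f '' C) = insert x C ∨
      x ∉ C ∧ y ∉ C ∧ f ⁻¹' (f '' C) = C := by
    intro C
    by_cases hx : x ∈ C <;> by_cases hy : y ∈ C <;> simp only [hx, hy, not_true, not_false_eq_true,
      true_and, false_and, or_false, false_or]
    · exact h.preimage_image (by simp [hx, hy])
    · exact h.preimage_image_of_mem hx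
    · exact h.symm.preimage_image_of_mem hy
    · exact h.preimage_image (by simp [hx, hy])
  have hcyc := (mem_nonsepCycles.1 hC).1
  have hcyc' := (mem_nonsepCycles.1 hC').1
  rcases hmem C with ⟨hx, hy, h₁⟩ | ⟨hx, hy, h₁⟩ | ⟨hx, hy, h₁⟩ | ⟨hx, hy, h₁⟩ <;>
  rcases hmem C' with ⟨hx', hy', h₂⟩ | ⟨hx', hy', h₂⟩ | ⟨hx', hy', h₂⟩ | ⟨hx', hy', h₂⟩ <;>
  rw [h₁, h₂] at heq
  · exact heq
  · exact absurd (heq ▸ hcyc) (hcyc'.not_insert hx' hy' h.adj)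
  · exact absurd (heq ▸ hcyc) (hcyc'.not_insert hy' hx' h.adj.symm)
  · exact absurd (heq ▸ hx) hx'
  · exact absurd (heq ▸ hcyc') (hcyc.not_insert hx hy h.adj)
  · grind
  · exact absurd heq (h.insert_ne_insert hG hpl hH hW hc hC hC' hx hy hy' hx')
  · grind
  · exact absurd (heq ▸ hcyc') (hcyc.not_insert hy hx h.adj.symm)
  · exact absurd heq (h.symm.insert_ne_insert hG hpl hH hW hc.symm hC hC' hy hx hx' hy')
  · grind
  · grind
  · grind
  · grind
  · grind
  · exact heq

end IsContraction

theorem inducedCycle_triple {G : SimpleGraph V} {a b c : V} (hab : G.Adj a b) (hac : G.Adj a c)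
    (hbc : G.Adj b c) : InducedCycle G {a, b, c} := by
  refine ⟨⟨a, by simp⟩,
    ((CutConnected.singleton G c).insert_of_adj rfl hbc).insert_of_adj (by simp) hab, ?_⟩
  have hirr : ∀ u, ¬ G.Adj u u := fun u h => h.ne rfl
  rintro u (rfl | rfl | rfl)
  · exact ⟨b, by simp, c, by simp, hbc.ne, hab, hac, by grind⟩
  · exact ⟨a, by simp, c, by simp, hac.ne, hab.symm, hbc, by grind⟩
  · exact ⟨a, by simp, b, by simp, hab.ne, hac.symm, hbc.symm, by grind⟩

namespace IsContraction

variable {G : SimpleGraph V} {H : SimpleGraph W} {f : V → W} {x y : V}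

theorem ncard_edgeSet [Finite V] (h : IsContraction G H f x y) :
    G.edgeSet.ncard = H.edgeSet.ncard + 1 + {z | G.Adj x z ∧ G.Adj y z}.ncard := by
  set Z := {z | G.Adj x z ∧ G.Adj y z} with hZ
  set R := {s(x, y)} ∪ (fun z => s(y, z)) '' Z with hR
  have hmap := h.map_eq
  have hRG : R ⊆ G.edgeSet := by
    rintro _ (rfl | ⟨z, hz, rfl⟩)
    · exact h.adj
    · exact hz.2
  have hmem : ∀ u w, s(u, w) ∈ R ↔ (u = x ∧ w = y ∨ u = y ∧ w = x) ∨
      (u = y ∧ w ∈ Z ∨ w = y ∧ u ∈ Z) := by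
    intro u w
    simp only [hR, Set.mem_union, Set.mem_singleton_iff, Set.mem_image, Sym2.eq_iff]
    grind
  have hZx : ∀ z, z ∈ Z → G.Adj x z ∧ G.Adj y z := fun z hz => hz
  have hZ' : ∀ z, G.Adj x z → G.Adj y z → z ∈ Z := fun z hx hy => ⟨hx, hy⟩
  have hRcard : R.ncard = 1 + Z.ncard := by
    rw [hR, Set.ncard_union_eq, Set.ncard_singleton, Set.ncard_image_of_injective]
    · intro a b hab
      have := Sym2.eq_iff.1 hab
      grind
    · rw [Set.disjoint_singleton_left]
      rintro ⟨z, hz, hzy⟩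
      have := Sym2.eq_iff.1 hzy
      have := (hZx z hz).1.ne
      have := (hZx z hz).2.ne
      grind
  have himg : Sym2.map f '' (G.edgeSet \ R) = H.edgeSet := by
    ext e
    constructor
    · rintro ⟨e, he, rfl⟩
      induction e with | _ u w
      rw [Set.mem_sdiff, hmem, mem_edgeSet] at he
      have := he.1.ne
      rw [Sym2.map_mk, mem_edgeSet]
      refine h.map_adj he.1 ?_
      rw [Ne, h.eq_iff]
      grind
    · induction e with | _ a b
      intro hab
      obtain ⟨hne, u, w, rfl, rfl, huw⟩ := (h.adj_iff a b).1 hab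
      rw [Ne, h.eq_iff] at hne
      by_cases hR' : s(u, w) ∈ R
      · rcases (hmem u w).1 hR' with h' | ⟨rfl, hw⟩ | ⟨rfl, hu⟩
        · grind
        · refine ⟨s(x, w), ⟨(hZx w hw).1, ?_⟩, by rw [Sym2.map_mk, hmap]⟩
          rw [hmem]
          have := h.adj.ne
          grind
        · refine ⟨s(u, x), ⟨(hZx u hu).1.symm, ?_⟩, by rw [Sym2.map_mk, hmap]⟩
          rw [hmem]
          have := h.adj.ne
          grind
      · exact ⟨s(u, w), ⟨huw, hR'⟩, rfl⟩
  have hinj : Set.InjOn (Sym2.map f) (G.edgeSet \ R) := by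
    have key : ∀ u w u' w', G.Adj u w → G.Adj u' w' → s(u, w) ∉ R → s(u', w') ∉ R →
        f u = f u' → f w = f w' → s(u, w) = s(u', w') := by
      intro u w u' w' huw huw' he he' hu hw
      rw [hmem] at he he'
      rw [h.eq_iff] at hu hw
      have := huw.ne
      have := huw'.ne
      have := huw.symm
      have := huw'.symm
      rw [Sym2.eq_iff]
      have := hZ' w
      have := hZ' u
      have := hZ' w'
      have := hZ' u'
      grind
    rintro e he e' he' hee
    induction e with | _ u w
    induction e' with | _ u' w'
    rcases Sym2.eq_iff.1 hee with ⟨hu, hw⟩ | ⟨hu, hw⟩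
    · exact key u w u' w' he.1 he'.1 he.2 he'.2 hu hw
    · rw [Sym2.eq_swap (a := u')]
      rw [Sym2.eq_swap (a := u'), Set.mem_sdiff, mem_edgeSet] at he'
      exact key u w w' u' he.1 he'.1 he.2 he'.2 hu hw
  rw [← himg, hinj.ncard_image, ← Set.ncard_sdiff_add_ncard_of_subset hRG, hRcard,
    add_assoc]

theorem ncard_nonsepCycles [Finite V] [Finite W] (h : IsContraction G H f x y)
    (hG : ThreeConnected G) (hpl : Planar G) (hH : ThreeConnected H) (hV : 4 ≤ Nat.card V)
    (hW : 4 ≤ Nat.card W) (hc : IsContractible G x y) :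
    (nonsepCycles G).ncard =
      (nonsepCycles H).ncard + {z | G.Adj x z ∧ G.Adj y z}.ncard := by
  set Z := {z | G.Adj x z ∧ G.Adj y z} with hZ
  set T := (fun z => ({x, y, z} : Set V)) '' Z with hT
  have hxy := h.adj.ne
  have hTG : T ⊆ nonsepCycles G := by
    rintro _ ⟨z, ⟨hxz, hyz⟩, rfl⟩
    exact mem_nonsepCycles.2 ⟨inducedCycle_triple h.adj hxz hyz, hc.2 z⟩
  have hmem : ∀ C ∈ nonsepCycles G, C ∉ T → ∀ z, C ≠ {x, y, z} := by
    rintro C hC hCT z rfl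
    refine hCT ⟨z, ?_, rfl⟩
    have hdeg := (mem_nonsepCycles.1 hC).1.2.2
    obtain ⟨a, ha, b, hb, hab, hxa, hxb, -⟩ := hdeg x (by simp)
    obtain ⟨a', ha', b', hb', hab', hya, hyb, -⟩ := hdeg y (by simp)
    have := hxa.ne
    have := hxb.ne
    have := hya.ne
    have := hyb.ne
    exact ⟨by grind, by grind⟩
  have hTcard : T.ncard = Z.ncard := by
    refine Set.InjOn.ncard_image fun a ha b hb hab => ?_
    have hab : ({x, y, a} : Set V) = {x, y, b} := hab
    have : a ∈ ({x, y, b} : Set V) := hab ▸ by simp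
    have := ha.1.ne
    have := ha.2.ne
    grind
  have himg : (f '' ·) '' (nonsepCycles G \ T) = nonsepCycles H := by
    ext D
    constructor
    · rintro ⟨C, ⟨hC, hCT⟩, rfl⟩
      exact h.image_mem_nonsepCycles hG hpl hc hC (hmem C hC hCT)
    · intro hD
      obtain ⟨C, hC, hne, rfl⟩ := h.exists_mem_nonsepCycles hG hH hV hW hD
      refine ⟨C, ⟨hC, ?_⟩, rfl⟩
      rintro ⟨z, -, rfl⟩
      exact hne z rfl
  rw [← himg, ((h.image_injOn hG hpl hH hW hc).mono Set.sdiff_subset).ncard_image,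
    ← Set.ncard_sdiff_add_ncard_of_subset hTG, hTcard]

end IsContraction

theorem exists_isContraction {V : Type*} [Finite V] {G : SimpleGraph V} {x y : V}
    (hxy : G.Adj x y) : ∃ (H : SimpleGraph {u // u ≠ y}) (f : V → {u // u ≠ y}),
      IsContraction G H f x y ∧ Nat.card V = Nat.card {u // u ≠ y} + 1 := by
  classical
  let f : V → {u // u ≠ y} := fun u => if h : u = y then ⟨x, hxy.ne⟩ else ⟨u, h⟩
  refine ⟨⟨fun a b => a ≠ b ∧ ∃ u w, f u = a ∧ f w = b ∧ G.Adj u w,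
    ⟨fun a b ⟨hab, u, w, hu, hw, huw⟩ => ⟨hab.symm, w, u, hw, hu, huw.symm⟩⟩,
    ⟨fun a h => h.1 rfl⟩⟩, f, ⟨hxy, fun a => ⟨a, by simp [f, a.2]⟩, fun u w => ?_,
    fun a b => Iff.rfl⟩, ?_⟩
  · have := hxy.ne
    simp only [f]
    split_ifs <;> simp only [Subtype.mk.injEq] <;> grind
  · have := Set.ncard_add_ncard_compl {y}
    rw [Set.ncard_singleton] at this
    rw [← this, add_comm]
    rfl

theorem ThreeConnected.eq_top [Finite V] {G : SimpleGraph V} (hG : ThreeConnected G)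
    (hV : Nat.card V ≤ 4) : G = ⊤ := by
  ext u w
  refine ⟨fun h => h.ne, fun hne => ?_⟩
  have hcard := Set.ncard_add_ncard_compl {u, w}
  rw [Set.ncard_pair hne] at hcard
  have := (threeConnected_iff.1 hG {u, w}ᶜ (by omega)).2
  rw [compl_compl] at this
  obtain ⟨u', -, rfl, w', hw', hne', hadj⟩ := this.exists_adj (A := {u}) (a := u) (b := w)
    (by simp) rfl (by simp) hne.symm
  obtain rfl : w' = w := by grind
  exact hadj

theorem mem_nonsepCycles_top_iff [Finite V] (hV : Nat.card V = 4) {C : Set V} :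
    C ∈ nonsepCycles (⊤ : SimpleGraph V) ↔ ∃ v, {v}ᶜ = C := by
  rw [mem_nonsepCycles]
  have hcard := Set.ncard_add_ncard_compl C
  constructor
  · rintro ⟨⟨⟨u, hu⟩, -, h⟩, -⟩
    obtain ⟨p, hp, q, hq, hpq, hup, huq, h2⟩ := h u hu
    have : C.ncard = 3 := Set.ncard_eq_three.2 ⟨u, p, q, hup.ne, huq.ne, hpq, by
      ext w
      have := h2 w
      grind [top_adj]⟩
    obtain ⟨v, hv⟩ := Set.ncard_eq_one.1 (show Cᶜ.ncard = 1 by omega)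
    exact ⟨v, by rw [← hv, compl_compl]⟩
  · rintro ⟨v, rfl⟩
    rw [compl_compl, Set.ncard_singleton] at hcard
    obtain ⟨a, b, c, hab, hac, hbc, h⟩ := Set.ncard_eq_three.1
      (show ({v}ᶜ : Set V).ncard = 3 by omega)
    rw [compl_compl, h]
    exact ⟨inducedCycle_triple hab hac hbc, .singleton _ v⟩

theorem ncard_nonsepCycles_top [Finite V] (hV : Nat.card V = 4) :
    (nonsepCycles (⊤ : SimpleGraph V)).ncard = 4 := by
  have : nonsepCycles (⊤ : SimpleGraph V) = (compl ∘ ({·})) '' Set.univ := by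
    ext C
    simp [mem_nonsepCycles_top_iff hV]
  rw [this, Set.ncard_image_of_injective _ (compl_injective.comp Set.singleton_injective),
    Set.ncard_univ, hV]

theorem ncard_edgeSet_top [Finite V] :
    (⊤ : SimpleGraph V).edgeSet.ncard = (Nat.card V).choose 2 := by
  classical
  have := Fintype.ofFinite V
  rw [← coe_edgeFinset, Set.ncard_coe_finset, card_edgeFinset_top_eq_card_choose_two,
    Nat.card_eq_fintype_card]

theorem ncard_nonsepCycles_add_card_eq {V : Type*} [Finite V] {G : SimpleGraph V}
    (hG : ThreeConnected G) (hpl : Planar G) (hV : 4 ≤ Nat.card V) :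
    (nonsepCycles G).ncard + Nat.card V = G.edgeSet.ncard + 2 := by
  generalize hn : Nat.card V = n at *
  induction n, hV using Nat.le_induction generalizing V with
  | base =>
    rw [hG.eq_top hn.le, ncard_nonsepCycles_top hn, ncard_edgeSet_top, hn]
    decide
  | succ n hn4 ih =>
    obtain ⟨x, y, hc⟩ := hG.exists_isContractible (by omega)
    obtain ⟨H, f, h, hW⟩ := exists_isContraction hc.1
    have hH := h.threeConnected hG hc (by omega)
    have := ih hH (h.planar hpl) (by omega)
    have := h.ncard_nonsepCycles hG hpl hH (by omega) (by omega) hc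
    have := h.ncard_edgeSet
    omega

/-- For a finite simple 3-connected planar graph `G` different from `K₃`,
`|C(G)| - |E(G)| + |V(G)| = 2`. -/
theorem stmt14 [Finite V] (G : SimpleGraph V) (hG : ThreeConnected G)
    (hpl : Planar G) (hK3 : ¬ Nonempty (G ≃g (⊤ : SimpleGraph (Fin 3)))) :
    ((nonsepCycles G).ncard : ℤ) - (G.edgeSet.ncard : ℤ) + (Nat.card V : ℤ) = 2 := by
  have h2 : 2 < Nat.card V := by
    by_contra! h
    have := (threeConnected_iff.1 hG Set.univ (by rwa [Set.ncard_univ])).1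
    simp at this
  have h3 : Nat.card V ≠ 3 := fun h => by
    refine hK3 ?_
    rw [hG.eq_top (by omega)]
    exact ⟨Iso.completeGraph (Finite.equivFinOfCardEq h)⟩
  have := ncard_nonsepCycles_add_card_eq hG hpl (by omega)
  omega
end

section
/- Let G be a finite simple 3-connected graph whose chromatic number satisfies χ(G) ≤ h(G) (as asserted by Hadwiger's conjecture), where h(G) is the Hadwiger number. Then C(χ(G),3) - C(χ(G),2) + C(χ(G),1) ≤ |C(G)| - |E(G)| + |V(G)|, where C(n,k) denotes the binomial coefficient and C(G) is the set of induced nonseparating cycles of G. -/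
open SimpleGraph

variable {V : Type*} {W : Type*}

namespace SimpleGraph

/-- `G` restricted to `A` is preconnected: a nonempty subset of `A` closed under adjacency
within `A` is all of `A`. -/
def PreconnectedOn (G : SimpleGraph V) (A : Set V) : Prop :=
  ∀ B ⊆ A, B.Nonempty → (∀ x ∈ B, ∀ y ∈ A, G.Adj x y → y ∈ B) → A ⊆ B

/-- `G` induces on `C` a connected `2`-regular graph. -/
def CycleOn (G : SimpleGraph V) (C : Set V) : Prop :=
  C.Nonempty ∧ G.PreconnectedOn C ∧
    ∀ x ∈ C, ∃ a ∈ C, ∃ b ∈ C, a ≠ b ∧ ∀ y ∈ C, G.Adj x y ↔ y = a ∨ y = b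

/-- The induced nonseparating cycles of `G` restricted to `U`. -/
def nonsepIn (G : SimpleGraph V) (U : Set V) : Set (Set V) :=
  {C | C ⊆ U ∧ G.CycleOn C ∧ G.PreconnectedOn (U \ C)}

/-- `G` restricted to `U` is 3-connected. -/
def ThreeConnectedOn (G : SimpleGraph V) (U : Set V) : Prop :=
  3 ≤ U.ncard ∧ ∀ S : Set V, S.ncard ≤ 2 → G.PreconnectedOn (U \ S)

/-- The edges of `G` with both ends in `U`. -/
def edgesIn (G : SimpleGraph V) (U : Set V) : Set (Sym2 V) :=
  {e | e ∈ G.edgeSet ∧ ∀ x ∈ e, x ∈ U}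

/-- The Euler characteristic of the 2-complex obtained from `G` restricted to `U` by attaching
a disc to each induced nonseparating cycle. -/
noncomputable def eulerIn (G : SimpleGraph V) (U : Set V) : ℤ :=
  (G.nonsepIn U).ncard - (G.edgesIn U).ncard + U.ncard

/-- Identify `v` with `u`; the vertex `v` remains but is meant to be discarded. -/
def contractInto (G : SimpleGraph V) (u v : V) : SimpleGraph V where
  Adj a b := a ≠ b ∧ (G.Adj a b ∨ (a = u ∧ G.Adj v b) ∨ (b = u ∧ G.Adj v a))
  symm := ⟨by intro a b; simp only [G.adj_comm]; tauto⟩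
  loopless := ⟨by intro a; simp⟩

/-- Add all edges between vertices of `S`. -/
def addClique (G : SimpleGraph V) (S : Set V) : SimpleGraph V where
  Adj a b := G.Adj a b ∨ (a ≠ b ∧ a ∈ S ∧ b ∈ S)
  symm := ⟨by intro a b; simp only [G.adj_comm]; tauto⟩
  loopless := ⟨by intro a; simp⟩

lemma contractInto_adj {G : SimpleGraph V} {u v a b : V} : (G.contractInto u v).Adj a b ↔
    a ≠ b ∧ (G.Adj a b ∨ (a = u ∧ G.Adj v b) ∨ (b = u ∧ G.Adj v a)) := Iff.rfl

lemma addClique_adj {G : SimpleGraph V} {S : Set V} {a b : V} :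
    (G.addClique S).Adj a b ↔ G.Adj a b ∨ (a ≠ b ∧ a ∈ S ∧ b ∈ S) := Iff.rfl

section Preconnected

variable {G H : SimpleGraph V} {A B : Set V} {u v : V}

lemma preconnected_induce_iff_preconnectedOn : (G.induce A).Preconnected ↔ G.PreconnectedOn A := by
  constructor
  · rintro h B hBA ⟨x, hx⟩ hcl y hy
    have : ∀ z : A, (G.induce A).Reachable ⟨x, hBA hx⟩ z → z.1 ∈ B := by
      intro z hz
      rw [reachable_iff_reflTransGen] at hz
      induction hz with
      | refl => exact hx
      | tail _ h ih => exact hcl _ ih _ (Subtype.property _) h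
    exact this ⟨y, hy⟩ (h _ _)
  · intro h x y
    have := h {z | ∃ hz : z ∈ A, (G.induce A).Reachable x ⟨z, hz⟩} (fun z hz => hz.1)
      ⟨x.1, x.2, Reachable.refl _⟩ (by
        rintro z ⟨hz, hr⟩ w hw hzw
        exact ⟨hw, hr.trans (Adj.reachable (by simpa using hzw))⟩) y.2
    exact this.2

lemma PreconnectedOn.mono (h : G.PreconnectedOn A)
    (hGH : ∀ x ∈ A, ∀ y ∈ A, G.Adj x y → H.Adj x y) : H.PreconnectedOn A :=
  fun B hB hne hcl => h B hB hne fun x hx y hy hxy => hcl x hx y hy (hGH x (hB hx) y hy hxy)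

lemma PreconnectedOn.exists_adj (h : G.PreconnectedOn A) (hu : u ∈ A) (hv : v ∈ A)
    (huv : u ≠ v) : ∃ w ∈ A, G.Adj u w := by
  by_contra! hno
  have := h {u} (by simpa) ⟨u, rfl⟩ (by
    rintro x rfl y hy hxy
    exact absurd hxy (hno y hy)) hv
  exact huv this.symm

lemma PreconnectedOn.union (hA : G.PreconnectedOn A) (hB : G.PreconnectedOn B)
    (hz : (A ∩ B).Nonempty) : G.PreconnectedOn (A ∪ B) := by
  obtain ⟨z, hzA, hzB⟩ := hz
  intro X hX hne hcl
  have key : ∀ Y ⊆ A ∪ B, G.PreconnectedOn Y → (X ∩ Y).Nonempty → Y ⊆ X := fun Y hYAB hY hXY =>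
    (hY (X ∩ Y) Set.inter_subset_right hXY fun x hx y hy hxy =>
      ⟨hcl x hx.1 y (hYAB hy) hxy, hy⟩).trans Set.inter_subset_left
  have kA := key A Set.subset_union_left hA
  have kB := key B Set.subset_union_right hB
  obtain ⟨x, hx⟩ := hne
  rcases hX hx with h | h
  · have h1 := kA ⟨x, hx, h⟩
    exact Set.union_subset h1 (kB ⟨z, h1 hzA, hzB⟩)
  · have h1 := kB ⟨x, hx, h⟩
    exact Set.union_subset (kA ⟨z, h1 hzB, hzA⟩) h1

lemma PreconnectedOn.insert (hA : G.PreconnectedOn A)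
    (h : A.Nonempty → ∃ w ∈ A, G.Adj v w) : G.PreconnectedOn (insert v A) := by
  intro X hX hne hcl
  have key : (X ∩ A).Nonempty → A ⊆ X := fun hXY =>
    (hA (X ∩ A) Set.inter_subset_right hXY fun x hx y hy hxy =>
      ⟨hcl x hx.1 y (Or.inr hy) hxy, hy⟩).trans Set.inter_subset_left
  rintro y (rfl | hy)
  · by_contra hyX
    obtain ⟨x, hx⟩ := hne
    have hxA : x ∈ A := by
      rcases hX hx with rfl | h
      · exact absurd hx hyX
      · exact h
    obtain ⟨w, hw, hyw⟩ := h ⟨x, hxA⟩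
    exact hyX (hcl w (key ⟨x, hx, hxA⟩ hw) y (Or.inl rfl) hyw.symm)
  · obtain ⟨x, hx⟩ := hne
    rcases hX hx with rfl | h'
    · obtain ⟨w, hw, hyw⟩ := h ⟨y, hy⟩
      exact key ⟨w, hcl _ hx w (Or.inr hw) hyw, hw⟩ hy
    · exact key ⟨x, hx, h'⟩ hy

lemma PreconnectedOn.contractInto (huv : u ≠ v) (hu : u ∈ A) (hv : v ∈ A)
    (hA : G.PreconnectedOn A) : (G.contractInto u v).PreconnectedOn (A \ {v}) := by
  classical
  intro B hB hne hcl
  have h := hA {x | x ∈ B ∨ (x = v ∧ u ∈ B)} (by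
    rintro x (hx | ⟨rfl, _⟩)
    · exact (hB hx).1
    · exact hv) (hne.mono fun x hx => Or.inl hx) (by
    simp only [contractInto_adj, Set.mem_sdiff, Set.mem_singleton_iff] at hcl
    rintro x (hx | ⟨rfl, hx⟩) y hy hxy
    · by_cases hyv : y = v
      · subst hyv
        refine Or.inr ⟨rfl, ?_⟩
        by_cases hxu : x = u
        · exact hxu ▸ hx
        · exact hcl x hx u ⟨hu, huv⟩ ⟨hxu, Or.inr (Or.inr ⟨rfl, hxy.symm⟩)⟩
      · exact Or.inl (hcl x hx y ⟨hy, hyv⟩ ⟨hxy.ne, Or.inl hxy⟩)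
    · by_cases hyu : y = u
      · exact Or.inl (hyu ▸ hx)
      · exact Or.inl (hcl u hx y ⟨hy, hxy.ne'⟩ ⟨Ne.symm hyu, Or.inr (Or.inl ⟨rfl, hxy⟩)⟩))
  rintro x ⟨hx, hxv⟩
  rcases h hx with h | h
  · exact h
  · exact absurd h.1 hxv

lemma PreconnectedOn.of_contractInto (huv : G.Adj u v) (hu : u ∈ A) (hv : v ∈ A)
    (hA : (G.contractInto u v).PreconnectedOn (A \ {v})) : G.PreconnectedOn A := by
  intro B hB hne hcl
  have hiff : u ∈ B ↔ v ∈ B := ⟨fun h => hcl u h v hv huv, fun h => hcl v h u hu huv.symm⟩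
  have h := hA (B \ {v}) (Set.sdiff_subset_sdiff_left hB) (by
    obtain ⟨x, hx⟩ := hne
    by_cases hxv : x = v
    · exact ⟨u, hiff.2 (hxv ▸ hx), huv.ne⟩
    · exact ⟨x, hx, hxv⟩) (by
    rintro x ⟨hx, hxv⟩ y ⟨hy, hyv⟩ ⟨hxy, h | ⟨rfl, h⟩ | ⟨rfl, h⟩⟩
    · exact ⟨hcl x hx y hy h, hyv⟩
    · exact ⟨hcl v (hiff.1 hx) y hy h, hyv⟩
    · exact ⟨hiff.2 (hcl x hx v hv h.symm), hyv⟩)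
  intro x hx
  by_cases hxv : x = v
  · subst hxv
    exact hiff.1 (h ⟨hu, huv.ne⟩).1
  · exact (h ⟨hx, hxv⟩).1

end Preconnected

section Cycle

variable {G H : SimpleGraph V} {C : Set V} {x y : V}

lemma isInducedCycle_iff [Finite V] : IsInducedCycle G C ↔ G.CycleOn C := by
  have hdeg : ∀ x : C, (((G.induce C).neighborSet x).ncard = 2 ↔
      ∃ a ∈ C, ∃ b ∈ C, a ≠ b ∧ ∀ y ∈ C, G.Adj x y ↔ y = a ∨ y = b) := by
    intro x
    rw [Set.ncard_eq_two]
    constructor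
    · rintro ⟨a, b, hab, h⟩
      refine ⟨a, a.2, b, b.2, fun h => hab (Subtype.ext h), fun y hy => ?_⟩
      have := Set.ext_iff.1 h ⟨y, hy⟩
      simpa [Subtype.ext_iff] using this
    · rintro ⟨a, ha, b, hb, hab, h⟩
      refine ⟨⟨a, ha⟩, ⟨b, hb⟩, by simpa using hab, ?_⟩
      ext ⟨y, hy⟩
      simpa [Subtype.ext_iff] using h y hy
  unfold IsInducedCycle CycleOn
  rw [connected_iff, preconnected_induce_iff_preconnectedOn, Set.nonempty_coe_sort]
  constructor
  · rintro ⟨-, ⟨h2, h3⟩, h4⟩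
    exact ⟨h3, h2, fun x hx => (hdeg ⟨x, hx⟩).1 (h4 _)⟩
  · rintro ⟨h1, h2, h3⟩
    refine ⟨?_, ⟨h2, h1⟩, fun x => (hdeg x).2 (h3 x x.2)⟩
    obtain ⟨x, hx⟩ := h1
    obtain ⟨a, ha, b, hb, hab, h⟩ := h3 x hx
    have hxa : x ≠ a := ((h a ha).2 (Or.inl rfl)).ne
    have hxb : x ≠ b := ((h b hb).2 (Or.inr rfl)).ne
    rw [← Set.ncard_eq_three.2 ⟨x, a, b, hxa, hxb, hab, rfl⟩]
    exact Set.ncard_le_ncard (by simp [Set.insert_subset_iff, hx, ha, hb]) (Set.toFinite _)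

lemma CycleOn.three_le [Finite V] (h : G.CycleOn C) : 3 ≤ C.ncard :=
  (isInducedCycle_iff.2 h).1

lemma CycleOn.congr (h : G.CycleOn C) (hGH : ∀ x ∈ C, ∀ y ∈ C, G.Adj x y ↔ H.Adj x y) :
    H.CycleOn C := by
  refine ⟨h.1, h.2.1.mono fun x hx y hy => (hGH x hx y hy).1, fun x hx => ?_⟩
  obtain ⟨a, ha, b, hb, hab, h'⟩ := h.2.2 x hx
  exact ⟨a, ha, b, hb, hab, fun y hy => by rw [← hGH x hx y hy, h' y hy]⟩

lemma CycleOn.image (h : G.CycleOn C) (f : V → V) (hf : Set.InjOn f C)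
    (hGH : ∀ x ∈ C, ∀ y ∈ C, G.Adj x y ↔ H.Adj (f x) (f y)) : H.CycleOn (f '' C) := by
  refine ⟨h.1.image f, ?_, ?_⟩
  · intro B hB hne hcl
    have := h.2.1 (C ∩ f ⁻¹' B) Set.inter_subset_left (by
      obtain ⟨x, hx⟩ := hne
      obtain ⟨y, hy, rfl⟩ := hB hx
      exact ⟨y, hy, hx⟩) (fun x hx y hy hxy =>
        ⟨hy, hcl _ hx.2 _ ⟨y, hy, rfl⟩ ((hGH x hx.1 y hy).1 hxy)⟩)
    rintro _ ⟨x, hx, rfl⟩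
    exact (this hx).2
  · rintro _ ⟨x, hx, rfl⟩
    obtain ⟨a, ha, b, hb, hab, h'⟩ := h.2.2 x hx
    refine ⟨f a, ⟨a, ha, rfl⟩, f b, ⟨b, hb, rfl⟩, fun h => hab (hf ha hb h), ?_⟩
    rintro _ ⟨y, hy, rfl⟩
    rw [← hGH x hx y hy, h' y hy, hf.eq_iff hy ha, hf.eq_iff hy hb]

/-- A cycle stays connected when one edge is removed. -/
lemma CycleOn.preconnectedOn_deleteEdges [Finite V] (h : G.CycleOn C) :
    (G.deleteEdges {s(x, y)}).PreconnectedOn C := by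
  intro B hB hne hcl
  have hcyc : (G.induce C).IsCycles := fun v _ => (isInducedCycle_iff.2 h).2.2 v
  have hreach : ∀ p q : C, (G.induce C).Adj p q → s(p.1, q.1) = s(x, y) → p.1 ∈ B → q.1 ∈ B := by
    intro p q hpq heq hp
    have hr := hcyc.reachable_deleteEdges hpq
    rw [reachable_iff_reflTransGen] at hr
    have key : ∀ z : C, Relation.ReflTransGen ((G.induce C).deleteEdges {s(p, q)}).Adj p z →
        z.1 ∈ B := by
      intro z hz
      induction hz with
      | refl => exact hp
      | @tail b c _ hbc ih =>
        refine hcl _ ih _ c.2 ?_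
        rw [deleteEdges_adj] at hbc ⊢
        refine ⟨hbc.1, fun h' => hbc.2 ?_⟩
        simp only [Set.mem_singleton_iff] at h' ⊢
        rw [← heq] at h'
        exact Sym2.map.injective Subtype.val_injective (by simpa using h')
    exact key q hr
  refine h.2.1 B hB hne fun p hp q hq hpq => ?_
  by_cases heq : s(p, q) = s(x, y)
  · exact hreach ⟨p, hB hp⟩ ⟨q, hq⟩ hpq heq hp
  · exact hcl p hp q hq (by rw [deleteEdges_adj]; exact ⟨hpq, heq⟩)

end Cycle

section Counting

variable {G H : SimpleGraph V} {U C : Set V} {u v : V}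

lemma ncard_edgesIn_insert [Finite V] (hv : v ∉ U) : (G.edgesIn (insert v U)).ncard =
    (G.edgesIn U).ncard + {x ∈ U | G.Adj v x}.ncard := by
  have hunion : G.edgesIn (insert v U) =
      G.edgesIn U ∪ (fun x => s(v, x)) '' {x ∈ U | G.Adj v x} := by
    ext e
    induction e with | _ a b =>
    simp only [edgesIn, mem_edgeSet, Sym2.mem_iff, forall_eq_or_imp, forall_eq, Set.mem_insert_iff,
      Set.mem_ofPred_eq, Set.mem_union, Set.mem_image, Sym2.eq_iff]
    constructor
    · rintro ⟨hab, rfl | ha, rfl | hb⟩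
      · exact absurd hab (G.irrefl)
      · exact Or.inr ⟨b, ⟨hb, hab⟩, Or.inl ⟨rfl, rfl⟩⟩
      · exact Or.inr ⟨a, ⟨ha, hab.symm⟩, Or.inr ⟨rfl, rfl⟩⟩
      · exact Or.inl ⟨hab, ha, hb⟩
    · rintro (⟨h, ha, hb⟩ | ⟨x, ⟨hx, hvx⟩, ⟨rfl, rfl⟩ | ⟨rfl, rfl⟩⟩)
      · exact ⟨h, Or.inr ha, Or.inr hb⟩
      · exact ⟨hvx, Or.inl rfl, Or.inr hx⟩
      · exact ⟨hvx.symm, Or.inr hx, Or.inl rfl⟩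
  rw [hunion, Set.ncard_union_eq _ (Set.toFinite _) (Set.toFinite _), Set.ncard_image_of_injective]
  · intro a b hab
    exact Sym2.congr_right.1 hab
  · rw [Set.disjoint_left]
    rintro _ h ⟨x, -, rfl⟩
    exact hv (h.2 v (Sym2.mem_mk_left v x))

lemma edgesIn_congr (h : ∀ x ∈ U, ∀ y ∈ U, G.Adj x y ↔ H.Adj x y) :
    G.edgesIn U = H.edgesIn U := by
  ext e
  induction e with | _ a b =>
  simp only [edgesIn, mem_edgeSet, Sym2.mem_iff, forall_eq_or_imp, forall_eq, Set.mem_ofPred_eq]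
  constructor
  · rintro ⟨hab, ha, hb⟩
    exact ⟨(h a ha b hb).1 hab, ha, hb⟩
  · rintro ⟨hab, ha, hb⟩
    exact ⟨(h a ha b hb).2 hab, ha, hb⟩

lemma ncard_edgesIn_of_complete [Finite V] (h : ∀ x ∈ U, ∀ y ∈ U, x ≠ y → G.Adj x y) :
    (G.edgesIn U).ncard = U.ncard.choose 2 := by
  induction U, Set.toFinite U using Set.Finite.induction_on with
  | empty =>
    rw [Set.ncard_empty, Nat.choose_zero_succ, Set.ncard_eq_zero]
    ext e
    induction e with | _ a b =>
    simp only [edgesIn, Set.mem_ofPred_eq, Set.mem_empty_iff_false, iff_false, not_and]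
    exact fun _ h => h a (Sym2.mem_mk_left a b)
  | @insert a s ha _ ih =>
    rw [ncard_edgesIn_insert ha, ih fun x hx y hy => h x (Or.inr hx) y (Or.inr hy),
      Set.ncard_insert_of_notMem ha]
    have : {x ∈ s | G.Adj a x} = s := by
      ext x
      simp only [Set.mem_ofPred_eq, and_iff_left_iff_imp]
      exact fun hx => h a (Or.inl rfl) x (Or.inr hx) fun h => ha (h ▸ hx)
    rw [this, Nat.choose_succ_succ' _ 1, Nat.choose_one_right, add_comm]

lemma preconnectedOn_of_complete (h : ∀ x ∈ U, ∀ y ∈ U, x ≠ y → G.Adj x y) :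
    G.PreconnectedOn U := by
  rintro B hB ⟨x, hx⟩ hcl y hy
  by_cases hxy : x = y
  · exact hxy ▸ hx
  · exact hcl x hx y hy (h x (hB hx) y hy hxy)

lemma nonsepIn_of_complete [Finite V] (h : ∀ x ∈ U, ∀ y ∈ U, x ≠ y → G.Adj x y) :
    G.nonsepIn U = {C | C ⊆ U ∧ C.ncard = 3} := by
  ext C
  simp only [nonsepIn, Set.mem_ofPred_eq]
  constructor
  · rintro ⟨hC, hcyc, -⟩
    refine ⟨hC, ?_⟩
    obtain ⟨x, hx⟩ := hcyc.1
    obtain ⟨a, ha, b, hb, hab, hadj⟩ := hcyc.2.2 x hx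
    refine le_antisymm ?_ hcyc.three_le
    have : C ⊆ {x, a, b} := by
      intro y hy
      by_cases hxy : x = y
      · exact Or.inl hxy.symm
      · exact Or.inr ((hadj y hy).1 (h x (hC hx) y (hC hy) hxy))
    have hxa : x ≠ a := ((hadj a ha).2 (Or.inl rfl)).ne
    have hxb : x ≠ b := ((hadj b hb).2 (Or.inr rfl)).ne
    rw [← Set.ncard_eq_three.2 ⟨x, a, b, hxa, hxb, hab, rfl⟩]
    exact Set.ncard_le_ncard this (Set.toFinite _)
  · rintro ⟨hC, hcard⟩
    refine ⟨hC, ⟨?_, ?_, ?_⟩, ?_⟩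
    · exact Set.nonempty_of_ncard_ne_zero (by omega)
    · exact preconnectedOn_of_complete fun x hx y hy => h x (hC hx) y (hC hy)
    · intro x hx
      have h2 : (C \ {x}).ncard = 2 := by rw [Set.ncard_sdiff_singleton_of_mem hx, hcard]
      obtain ⟨a, b, hab, heq⟩ := Set.ncard_eq_two.1 h2
      have ha : a ∈ C \ {x} := by simp [heq]
      have hb : b ∈ C \ {x} := by simp [heq]
      refine ⟨a, ha.1, b, hb.1, hab, fun y hy => ⟨fun hxy => ?_, ?_⟩⟩
      · have : y ∈ C \ {x} := ⟨hy, hxy.ne'⟩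
        simpa [heq] using this
      · rintro (rfl | rfl)
        · exact h x (hC hx) _ (hC hy) (Ne.symm ha.2)
        · exact h x (hC hx) _ (hC hy) (Ne.symm hb.2)
    · exact preconnectedOn_of_complete fun x hx y hy => h x hx.1 y hy.1

lemma eulerIn_of_complete [Finite V] (h : ∀ x ∈ U, ∀ y ∈ U, x ≠ y → G.Adj x y) :
    G.eulerIn U = (U.ncard.choose 3 : ℤ) - U.ncard.choose 2 + U.ncard := by
  have : (G.nonsepIn U).ncard = U.ncard.choose 3 := by
    rw [nonsepIn_of_complete h, Set.ncard_powerset_ncard (Set.toFinite U)]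
  rw [eulerIn, this, ncard_edgesIn_of_complete h]

end Counting

section Contraction

variable {G : SimpleGraph V} {U C : Set V} {u v p q : V}

/-- The image of a vertex set when `v` is identified with `u`. -/
def collapse (u v : V) (D : Set V) : Set V :=
  {x | x ≠ v ∧ (x ∈ D ∨ x = u ∧ v ∈ D)}

lemma collapse_eq_of_notMem (hv : v ∉ C) : collapse u v C = C := by
  ext x
  simp only [collapse, Set.mem_ofPred_eq, hv, and_false, or_false, and_iff_right_iff_imp]
  rintro hx rfl
  exact hv hx

lemma mem_nonsepIn_of_contractInto_of_notMem (hu : u ∈ U) (hv : v ∈ U) (huv : G.Adj u v)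
    (hC : C ∈ (G.contractInto u v).nonsepIn (U \ {v})) (huC : u ∉ C) : C ∈ G.nonsepIn U := by
  obtain ⟨hCU, hcyc, hpc⟩ := hC
  have hvC : v ∉ C := fun h => (hCU h).2 rfl
  refine ⟨fun x hx => (hCU hx).1, hcyc.congr ?_, ?_⟩
  · intro x hx y hy
    rw [contractInto_adj]
    have hxu : x ≠ u := fun h => huC (h ▸ hx)
    have hyu : y ≠ u := fun h => huC (h ▸ hy)
    simp only [hxu, hyu, false_and, or_false, and_iff_right_iff_imp]
    exact fun h => h.ne
  · refine PreconnectedOn.of_contractInto huv ⟨hu, huC⟩ ⟨hv, hvC⟩ ?_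
    rwa [Set.sdiff_sdiff_comm]

lemma mem_nonsepIn_of_contractInto_of_adj (hv : v ∈ U)
    (hC : C ∈ (G.contractInto u v).nonsepIn (U \ {v})) (huC : u ∈ C)
    (hpq : ∀ y ∈ C, (G.contractInto u v).Adj u y → y = p ∨ y = q)
    (hp : G.Adj u p) (hq : G.Adj u q)
    (hout : ((U \ {v}) \ C).Nonempty → ∃ w ∈ (U \ {v}) \ C, G.Adj v w) : C ∈ G.nonsepIn U := by
  obtain ⟨hCU, hcyc, hpc⟩ := hC
  have hvC : v ∉ C := fun h => (hCU h).2 rfl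
  have hadj : ∀ y ∈ C, (G.contractInto u v).Adj u y → G.Adj u y := by
    intro y hy h
    rcases hpq y hy h with rfl | rfl <;> assumption
  refine ⟨fun x hx => (hCU hx).1, hcyc.congr ?_, ?_⟩
  · refine fun x hx y hy => ⟨fun h => ?_, fun h => ⟨h.ne, Or.inl h⟩⟩
    rcases h.2 with h' | ⟨rfl, -⟩ | ⟨rfl, -⟩
    · exact h'
    · exact hadj y hy h
    · exact (hadj x hx h.symm).symm
  · have heq : U \ C = insert v ((U \ {v}) \ C) := by
      ext x
      simp only [Set.mem_sdiff, Set.mem_insert_iff, Set.mem_singleton_iff]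
      by_cases hxv : x = v
      · subst hxv
        simp [hv, hvC]
      · simp [hxv]
    rw [heq]
    refine PreconnectedOn.insert (hpc.mono ?_) hout
    rintro x hx y hy ⟨-, h | ⟨rfl, -⟩ | ⟨rfl, -⟩⟩
    · exact h
    · exact absurd huC hx.2
    · exact absurd huC hy.2

lemma insert_mem_nonsepIn_of_contractInto_of_adj (hu : u ∈ U) (hv : v ∈ U) (huv : u ≠ v)
    (hC : C ∈ (G.contractInto u v).nonsepIn (U \ {v})) (huC : u ∈ C)
    (hpq : ∀ y ∈ C, (G.contractInto u v).Adj u y → y = p ∨ y = q)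
    (hp : G.Adj v p) (hq : G.Adj v q)
    (hout : ((U \ {v}) \ C).Nonempty → ∃ w ∈ (U \ {v}) \ C, G.Adj u w) :
    insert v (C \ {u}) ∈ G.nonsepIn U := by
  classical
  obtain ⟨hCU, hcyc, hpc⟩ := hC
  have hvC : v ∉ C := fun h => (hCU h).2 rfl
  have hadj : ∀ y ∈ C, (G.contractInto u v).Adj u y ↔ y ≠ u ∧ G.Adj v y := by
    refine fun y hy => ⟨fun h => ⟨h.ne', ?_⟩, fun h => ⟨h.1.symm, Or.inr (Or.inl ⟨rfl, h.2⟩)⟩⟩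
    rcases hpq y hy h with rfl | rfl <;> assumption
  have hswap : ∀ x ∈ C, x ≠ u → Equiv.swap u v x = x := fun x hx hxu =>
    Equiv.swap_apply_of_ne_of_ne hxu fun h => hvC (h ▸ hx)
  have himage : Equiv.swap u v '' C = insert v (C \ {u}) := by
    ext x
    simp only [Set.mem_image, Set.mem_insert_iff, Set.mem_sdiff, Set.mem_singleton_iff]
    constructor
    · rintro ⟨y, hy, rfl⟩
      by_cases hyu : y = u
      · subst hyu
        simp
      · rw [hswap y hy hyu]
        exact Or.inr ⟨hy, hyu⟩
    · rintro (rfl | ⟨hx, hxu⟩)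
      · exact ⟨u, huC, by simp⟩
      · exact ⟨x, hx, hswap x hx hxu⟩
  refine ⟨?_, ?_, ?_⟩
  · rintro x (rfl | hx)
    · exact hv
    · exact (hCU hx.1).1
  · rw [← himage]
    refine hcyc.image _ (Equiv.injective _).injOn fun x hx y hy => ?_
    by_cases hxu : x = u <;> by_cases hyu : y = u
    · subst hxu hyu
      simp
    · subst hxu
      rw [hadj y hy, hswap y hy hyu, Equiv.swap_apply_left]
      simp [hyu]
    · subst hyu
      rw [adj_comm, hadj x hx, hswap x hx hxu, Equiv.swap_apply_left, G.adj_comm x]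
      simp [hxu]
    · rw [hswap x hx hxu, hswap y hy hyu, contractInto_adj]
      simp only [hxu, hyu, false_and, or_false, and_iff_right_iff_imp]
      exact fun h => h.ne
  · have heq : U \ insert v (C \ {u}) = insert u ((U \ {v}) \ C) := by
      ext x
      simp only [Set.mem_sdiff, Set.mem_insert_iff, Set.mem_singleton_iff]
      by_cases hxu : x = u
      · subst hxu
        simp [hu, huv]
      · simp [hxu, and_assoc]
    rw [heq]
    refine PreconnectedOn.insert (hpc.mono ?_) hout
    rintro x hx y hy ⟨-, h | ⟨rfl, -⟩ | ⟨rfl, -⟩⟩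
    · exact h
    · exact absurd huC hx.2
    · exact absurd huC hy.2

lemma insert_mem_nonsepIn_of_contractInto (hv : v ∈ U) (huv : G.Adj u v)
    (hC : C ∈ (G.contractInto u v).nonsepIn (U \ {v})) (huC : u ∈ C)
    (hpC : p ∈ C) (hqC : q ∈ C) (hpq' : p ≠ q)
    (hpq : ∀ y ∈ C, (G.contractInto u v).Adj u y ↔ y = p ∨ y = q)
    (hp : G.Adj u p) (hq : G.Adj v q) (hp' : ¬ G.Adj v p) (hq' : ¬ G.Adj u q) :
    insert v C ∈ G.nonsepIn U := by
  obtain ⟨hCU, hcyc, hpc⟩ := hC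
  have hvC : v ∉ C := fun h => (hCU h).2 rfl
  have hsd : insert v C \ {v} = C := by simp [hvC]
  have huq : q ≠ u := ((hpq q hqC).2 (Or.inr rfl)).ne'
  have hu_adj : ∀ y ∈ C, G.Adj u y ↔ y = p := by
    refine fun y hy => ⟨fun h => ?_, fun h => h ▸ hp⟩
    rcases (hpq y hy).1 ⟨h.ne, Or.inl h⟩ with rfl | rfl
    · rfl
    · exact absurd h hq'
  have hv_adj : ∀ y ∈ C, G.Adj v y ↔ y = u ∨ y = q := by
    refine fun y hy => ⟨fun h => ?_, fun h => ?_⟩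
    · by_cases hyu : y = u
      · exact Or.inl hyu
      · rcases (hpq y hy).1 ⟨Ne.symm hyu, Or.inr (Or.inl ⟨rfl, h⟩)⟩ with rfl | rfl
        · exact absurd h hp'
        · exact Or.inr rfl
    · rcases h with rfl | rfl
      · exact huv.symm
      · exact hq
  refine ⟨Set.insert_subset hv fun x hx => (hCU hx).1, ⟨⟨u, Or.inr huC⟩, ?_, ?_⟩, ?_⟩
  · refine PreconnectedOn.of_contractInto huv (Or.inr huC) (Or.inl rfl) ?_
    rw [hsd]
    exact hcyc.2.1
  · rintro x (rfl | hx)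
    · refine ⟨u, Or.inr huC, q, Or.inr hqC, huq.symm, ?_⟩
      rintro y (rfl | hy)
      · simp only [SimpleGraph.irrefl, false_iff, not_or]
        exact ⟨huv.ne', hq.ne⟩
      · exact hv_adj y hy
    · by_cases hxu : x = u
      · subst hxu
        refine ⟨p, Or.inr hpC, v, Or.inl rfl, fun h => hvC (h ▸ hpC), ?_⟩
        rintro y (rfl | hy)
        · simp [huv]
        · rw [hu_adj y hy]
          simp only [iff_self_or]
          rintro rfl
          exact absurd hy hvC
      · obtain ⟨a, ha, b, hb, hab, h⟩ := hcyc.2.2 x hx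
        by_cases hxq : x = q
        · subst hxq
          obtain ⟨c, hc, hcu, h'⟩ : ∃ c ∈ C, c ≠ u ∧
              ∀ y ∈ C, (G.contractInto u v).Adj x y ↔ y = u ∨ y = c := by
            rcases (h u huC).1 ((hpq x hx).2 (Or.inr rfl)).symm with rfl | rfl
            · exact ⟨b, hb, hab.symm, h⟩
            · exact ⟨a, ha, hab, fun y hy => by rw [h y hy, or_comm]⟩
          refine ⟨v, Or.inl rfl, c, Or.inr hc, fun h => hvC (h ▸ hc), ?_⟩
          rintro y (rfl | hy)
          · simp [hq.symm]
          · have hyv : y ≠ v := fun h => hvC (h ▸ hy)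
            by_cases hyu : y = u
            · subst hyu
              simp [hyv, Ne.symm hcu, show ¬ G.Adj x y from fun h => hq' h.symm]
            · have := h' y hy
              simp only [contractInto_adj, hxu, hyu, false_and, or_false, false_or] at this
              simp only [hyv, false_or, ← this]
              exact ⟨fun h => ⟨h.ne, h⟩, fun h => h.2⟩
        · have hxv : ¬ G.Adj x v := fun h' => by
            rcases (hv_adj x hx).1 h'.symm with h' | h' <;> contradiction
          refine ⟨a, Or.inr ha, b, Or.inr hb, hab, ?_⟩
          rintro y (rfl | hy)
          · simp only [hxv, false_iff, not_or]
            exact ⟨fun h => hvC (h ▸ ha), fun h => hvC (h ▸ hb)⟩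
          · rw [← h y hy, contractInto_adj]
            simp only [hxu, false_and, G.adj_comm v x, hxv, and_false, or_false,
              iff_and_self]
            exact fun h => h.ne
  · have heq : U \ insert v C = (U \ {v}) \ C := by
      ext x
      simp [and_assoc]
    rw [heq]
    refine hpc.mono ?_
    rintro x hx y hy ⟨-, h | ⟨rfl, -⟩ | ⟨rfl, -⟩⟩
    · exact h
    · exact absurd huC hx.2
    · exact absurd huC hy.2

lemma exists_collapse_eq [Finite V] (hU : G.ThreeConnectedOn U) (hu : u ∈ U) (hv : v ∈ U)
    (huv : G.Adj u v) (hC : C ∈ (G.contractInto u v).nonsepIn (U \ {v})) :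
    ∃ D ∈ G.nonsepIn U, collapse u v D = C := by
  have hvC : v ∉ C := fun h => (hC.1 h).2 rfl
  by_cases huC : u ∉ C
  · exact ⟨C, mem_nonsepIn_of_contractInto_of_notMem hu hv huv hC huC, collapse_eq_of_notMem hvC⟩
  rw [not_not] at huC
  obtain ⟨p, hpC, q, hqC, hne, hpq⟩ := hC.2.1.2.2 u huC
  have hpq' := fun y hy => (hpq y hy).1
  have hup : p ≠ u := ((hpq p hpC).2 (Or.inl rfl)).ne'
  have huq : q ≠ u := ((hpq q hqC).2 (Or.inr rfl)).ne'
  have hpv : p ≠ v := fun h => hvC (h ▸ hpC)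
  have hqv : q ≠ v := fun h => hvC (h ▸ hqC)
  have hp : G.Adj u p ∨ G.Adj v p := by
    have := (hpq p hpC).2 (Or.inl rfl)
    simpa [contractInto_adj, hup, Ne.symm hup] using this
  have hq : G.Adj u q ∨ G.Adj v q := by
    have := (hpq q hqC).2 (Or.inr rfl)
    simpa [contractInto_adj, huq, Ne.symm huq] using this
  have hvy : ∀ y ∈ C, G.Adj v y → y = u ∨ y = p ∨ y = q := by
    intro y hy h
    by_cases hyu : y = u
    · exact Or.inl hyu
    · exact Or.inr (hpq' y hy ⟨Ne.symm hyu, Or.inr (Or.inl ⟨rfl, h⟩)⟩)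
  have huy : ∀ y ∈ C, G.Adj u y → y = p ∨ y = q := fun y hy h => hpq' y hy ⟨h.ne, Or.inl h⟩
  have hpair : ∀ a b : V, G.PreconnectedOn (U \ {a, b}) := fun a b =>
    hU.2 _ (Set.ncard_insert_le a {b} |>.trans (by simp))
  have hcolC := collapse_eq_of_notMem (u := u) hvC
  have hcolswap : collapse u v (insert v (C \ {u})) = C := by
    ext x
    simp only [collapse, Set.mem_ofPred_eq, Set.mem_insert_iff, Set.mem_sdiff,
      Set.mem_singleton_iff]
    grind
  have hcolins : collapse u v (insert v C) = C := by
    ext x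
    simp only [collapse, Set.mem_ofPred_eq, Set.mem_insert_iff]
    grind
  by_cases hout_v : ((U \ {v}) \ C).Nonempty → ∃ w ∈ (U \ {v}) \ C, G.Adj v w
  · by_cases h : G.Adj u p ∧ G.Adj u q
    · exact ⟨C, mem_nonsepIn_of_contractInto_of_adj hv hC huC hpq' h.1 h.2 hout_v, hcolC⟩
    by_cases h' : G.Adj v p ∧ G.Adj v q
    · refine ⟨_, insert_mem_nonsepIn_of_contractInto_of_adj hu hv huv.ne hC huC hpq' h'.1 h'.2
        ?_, hcolswap⟩
      rintro ⟨w, ⟨hw, hwv⟩, hwC⟩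
      obtain ⟨c, d, hcd, hucd, hdC⟩ : ∃ c d : V, (∀ y, y = p ∨ y = q → y = c ∨ y = d) ∧
          ¬ G.Adj u c ∧ d ∈ C := by
        by_cases hup' : G.Adj u p
        · exact ⟨q, p, by tauto, by tauto, hpC⟩
        · exact ⟨p, q, by tauto, by tauto, hqC⟩
      have hdu : u ≠ d := by
        rintro rfl
        rcases hcd p (Or.inl rfl) with h1 | h1 <;> rcases hcd q (Or.inr rfl) with h2 | h2 <;>
          simp_all
      obtain ⟨z, hz, huz⟩ := (hpair v d).exists_adj (u := u) (v := w)
        ⟨hu, by simp [huv.ne, hdu]⟩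
        ⟨hw, by simp only [Set.mem_insert_iff, Set.mem_singleton_iff, not_or] at hwv ⊢
                exact ⟨hwv, fun h => hwC (h ▸ hdC)⟩⟩ (fun h => hwC (h ▸ huC))
      simp only [Set.mem_sdiff, Set.mem_insert_iff, Set.mem_singleton_iff, not_or] at hz
      refine ⟨z, ⟨⟨hz.1, hz.2.1⟩, fun hzC => ?_⟩, huz⟩
      rcases hcd z (huy z hzC huz) with rfl | rfl
      · exact hucd huz
      · exact hz.2.2 rfl
    by_cases hup' : G.Adj u p
    · exact ⟨_, insert_mem_nonsepIn_of_contractInto hv huv hC huC hpC hqC hne hpq hup'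
        (by tauto) (by tauto) (by tauto), hcolins⟩
    · exact ⟨_, insert_mem_nonsepIn_of_contractInto hv huv hC huC hqC hpC hne.symm
        (fun y hy => by rw [hpq y hy, or_comm])
        (by tauto) (by tauto) (by tauto) (by tauto), hcolins⟩
  · push Not at hout_v
    obtain ⟨⟨w, ⟨hw, hwv⟩, hwC⟩, hout⟩ := hout_v
    have hwv' : w ≠ v := hwv
    have hwp : w ≠ p := fun h => hwC (h ▸ hpC)
    have hwq : w ≠ q := fun h => hwC (h ▸ hqC)
    have hwu : w ≠ u := fun h => hwC (h ▸ huC)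
    have hv_nbr : ∀ z ∈ U, G.Adj v z → z = u ∨ z = p ∨ z = q := by
      intro z hz hvz
      by_cases hzC : z ∈ C
      · exact hvy z hzC hvz
      · exact absurd hvz (hout z ⟨⟨hz, hvz.ne'⟩, hzC⟩)
    have hvp : G.Adj v p := by
      obtain ⟨z, hz, hvz⟩ := (hpair u q).exists_adj (u := v) (v := w)
        ⟨hv, by simp [huv.ne', Ne.symm hqv]⟩ ⟨hw, by simp [hwu, hwq]⟩ hwv'.symm
      simp only [Set.mem_sdiff, Set.mem_insert_iff, Set.mem_singleton_iff, not_or] at hz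
      rcases hv_nbr z hz.1 hvz with h | rfl | h
      · exact absurd h hz.2.1
      · exact hvz
      · exact absurd h hz.2.2
    have hvq : G.Adj v q := by
      obtain ⟨z, hz, hvz⟩ := (hpair u p).exists_adj (u := v) (v := w)
        ⟨hv, by simp [huv.ne', Ne.symm hpv]⟩ ⟨hw, by simp [hwu, hwp]⟩ hwv'.symm
      simp only [Set.mem_sdiff, Set.mem_insert_iff, Set.mem_singleton_iff, not_or] at hz
      rcases hv_nbr z hz.1 hvz with h | h | rfl
      · exact absurd h hz.2.1
      · exact absurd h hz.2.2
      · exact hvz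
    refine ⟨_, insert_mem_nonsepIn_of_contractInto_of_adj hu hv huv.ne hC huC hpq' hvp hvq
      fun _ => ?_, hcolswap⟩
    by_contra! hno
    have := hpair p q {u, v} (by
      rintro x (rfl | rfl)
      · exact ⟨hu, by simp [Ne.symm hup, Ne.symm huq]⟩
      · exact ⟨hv, by simp [Ne.symm hpv, Ne.symm hqv]⟩) ⟨u, Or.inl rfl⟩ (by
      rintro x hx y ⟨hy, hypq⟩ hxy
      simp only [Set.mem_insert_iff, Set.mem_singleton_iff, not_or] at hx hypq ⊢
      rcases hx with rfl | rfl
      · by_cases hyv : y = v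
        · exact Or.inr hyv
        by_cases hyC : y ∈ C
        · have := huy y hyC hxy
          tauto
        · exact absurd hxy (hno y ⟨⟨hy, hyv⟩, hyC⟩)
      · have := hv_nbr y hy hxy
        tauto) (show w ∈ U \ {p, q} from ⟨hw, by simp [hwp, hwq]⟩)
    simp [hwu, hwv'] at this

lemma triangle_mem_nonsepIn (hp : p ∈ U) (hu : u ∈ U) (hv : v ∈ U) (huv : G.Adj u v)
    (hup : G.Adj u p) (hvp : G.Adj v p) (hpc : G.PreconnectedOn (U \ {u, v, p})) :
    {u, v, p} ∈ G.nonsepIn U := by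
  have hcomplete : ∀ x ∈ ({u, v, p} : Set V), ∀ y ∈ ({u, v, p} : Set V), x ≠ y → G.Adj x y := by
    have h1 := huv.symm
    have h2 := hup.symm
    have h3 := hvp.symm
    rintro x (rfl | rfl | rfl) y (rfl | rfl | rfl) hxy <;> first | assumption | contradiction
  refine ⟨by simp [Set.insert_subset_iff, hp, hu, hv], ⟨⟨u, Or.inl rfl⟩,
    preconnectedOn_of_complete hcomplete, ?_⟩, hpc⟩
  rintro x (rfl | rfl | rfl)
  · refine ⟨v, by simp, p, by simp, hvp.ne, ?_⟩
    rintro y (rfl | rfl | rfl) <;> simp [huv, hup, huv.ne, hup.ne]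
  · refine ⟨u, by simp, p, by simp, hup.ne, ?_⟩
    rintro y (rfl | rfl | rfl) <;> simp [huv.symm, hvp, huv.ne', hvp.ne]
  · refine ⟨u, by simp, v, by simp, huv.ne, ?_⟩
    rintro y (rfl | rfl | rfl) <;> simp [hup.symm, hvp.symm, hup.ne', hvp.ne']

lemma ncard_edgesIn_contractInto [Finite V] (hu : u ∈ U) (hv : v ∈ U) (huv : G.Adj u v) :
    (G.edgesIn U).ncard = ((G.contractInto u v).edgesIn (U \ {v})).ncard + 1 +
      {x ∈ U | G.Adj u x ∧ G.Adj v x}.ncard := by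
  set W := U \ {u, v} with hW
  have huW : u ∉ W := by simp [hW]
  have hvW : v ∉ insert u W := by simp [hW, huv.ne']
  have hU1 : U = insert v (insert u W) := by
    ext x
    simp only [hW, Set.mem_insert_iff, Set.mem_sdiff, Set.mem_singleton_iff]
    by_cases hxv : x = v <;> by_cases hxu : x = u <;> simp_all
  have hU2 : U \ {v} = insert u W := by
    rw [hU1, Set.insert_sdiff_self_of_notMem hvW]
  have hcongr : (G.contractInto u v).edgesIn W = G.edgesIn W := by
    refine edgesIn_congr fun x hx y hy => ?_
    have hxu : x ≠ u := fun h => huW (h ▸ hx)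
    have hyu : y ≠ u := fun h => huW (h ▸ hy)
    simp only [contractInto_adj, hxu, hyu, false_and, or_false, and_iff_right_iff_imp]
    exact fun h => h.ne
  have h1 : {x ∈ insert u W | G.Adj v x} = insert u {x ∈ W | G.Adj v x} := by
    ext x
    simp only [Set.mem_insert_iff, Set.mem_ofPred_eq]
    constructor
    · rintro ⟨rfl | h, h'⟩
      · exact Or.inl rfl
      · exact Or.inr ⟨h, h'⟩
    · rintro (rfl | h)
      · exact ⟨Or.inl rfl, huv.symm⟩
      · exact ⟨Or.inr h.1, h.2⟩
  have h2 : {x ∈ W | (G.contractInto u v).Adj u x} =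
      {x ∈ W | G.Adj u x} ∪ {x ∈ W | G.Adj v x} := by
    ext x
    simp only [Set.mem_union, Set.mem_ofPred_eq, contractInto_adj]
    constructor
    · rintro ⟨hx, -, h | h | ⟨rfl, -⟩⟩
      · exact Or.inl ⟨hx, h⟩
      · exact Or.inr ⟨hx, h.2⟩
      · exact absurd hx huW
    · rintro (h | h)
      · exact ⟨h.1, h.2.ne, Or.inl h.2⟩
      · exact ⟨h.1, fun h' => huW (h' ▸ h.1), Or.inr (Or.inl ⟨trivial, h.2⟩)⟩
  have h3 : {x ∈ U | G.Adj u x ∧ G.Adj v x} = {x ∈ W | G.Adj u x} ∩ {x ∈ W | G.Adj v x} := by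
    ext x
    simp only [hW, Set.mem_inter_iff, Set.mem_ofPred_eq, Set.mem_sdiff, Set.mem_insert_iff,
      Set.mem_singleton_iff]
    constructor
    · rintro ⟨hx, h, h'⟩
      have : ¬ (x = u ∨ x = v) := not_or.2 ⟨h.ne', h'.ne'⟩
      exact ⟨⟨⟨hx, this⟩, h⟩, ⟨hx, this⟩, h'⟩
    · rintro ⟨⟨⟨hx, -⟩, h⟩, -, h'⟩
      exact ⟨hx, h, h'⟩
  have huW' : u ∉ {x ∈ W | G.Adj v x} := fun h => huW h.1
  rw [h3, hU2, ncard_edgesIn_insert huW, h2, hcongr, hU1, ncard_edgesIn_insert hvW,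
    ncard_edgesIn_insert huW, h1, Set.ncard_insert_of_notMem huW']
  have := Set.ncard_union_add_ncard_inter {x ∈ W | G.Adj u x} {x ∈ W | G.Adj v x}
    (Set.toFinite _) (Set.toFinite _)
  omega

/-- Contracting an edge does not increase the Euler characteristic if every triangle on this
edge is nonseparating. -/
lemma eulerIn_contractInto_le [Finite V] (hU : G.ThreeConnectedOn U) (hu : u ∈ U) (hv : v ∈ U)
    (huv : G.Adj u v) (hpc : ∀ p ∈ U, G.PreconnectedOn (U \ {u, v, p})) :
    (G.contractInto u v).eulerIn (U \ {v}) ≤ G.eulerIn U := by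
  set T : Set (Set V) := (fun p => {u, v, p}) '' {x ∈ U | G.Adj u x ∧ G.Adj v x} with hT
  have hTsub : T ⊆ G.nonsepIn U := by
    rintro _ ⟨p, ⟨hp, hup, hvp⟩, rfl⟩
    exact triangle_mem_nonsepIn hp hu hv huv hup hvp (hpc p hp)
  have hTcard : T.ncard = {x ∈ U | G.Adj u x ∧ G.Adj v x}.ncard := by
    refine Set.InjOn.ncard_image ?_
    rintro p ⟨-, hup, hvp⟩ q - hpq
    have : p ∈ ({u, v, q} : Set V) := by
      rw [← show ({u, v, p} : Set V) = {u, v, q} from hpq]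
      simp
    simpa [hup.ne', hvp.ne'] using this
  have hsub : (G.contractInto u v).nonsepIn (U \ {v}) ⊆ collapse u v '' (G.nonsepIn U \ T) := by
    intro C hC
    obtain ⟨D, hD, hDC⟩ := exists_collapse_eq hU hu hv huv hC
    refine ⟨D, ⟨hD, ?_⟩, hDC⟩
    rintro ⟨p, -, rfl⟩
    have h3 := hC.2.1.three_le
    have hle : C ⊆ {u, p} := by
      rw [← hDC]
      rintro x ⟨hxv, hx⟩
      simp only [Set.mem_insert_iff, Set.mem_singleton_iff] at hx ⊢
      tauto
    have := (Set.ncard_le_ncard hle (Set.toFinite _)).trans (Set.ncard_insert_le u {p})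
    simp at this
    omega
  have hle := (Set.ncard_le_ncard hsub (Set.toFinite _)).trans
    (Set.ncard_image_le (Set.toFinite _))
  rw [Set.ncard_sdiff hTsub (Set.toFinite _), hTcard] at hle
  have hTle := Set.ncard_le_ncard hTsub (Set.toFinite _)
  have hE := ncard_edgesIn_contractInto hu hv huv
  have hV := Set.ncard_sdiff_singleton_add_one hv (Set.toFinite _)
  unfold eulerIn
  omega

end Contraction

section ThreeSeparation

/-- Every triangle `a b c` of `G` restricted to `U` has an induced nonseparating cycle through
the edge `a b` avoiding `c`. -/
def EdgesHaveCycleAvoiding (G : SimpleGraph V) (U : Set V) : Prop :=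
  ∀ a ∈ U, ∀ b ∈ U, ∀ c ∈ U, G.Adj a b → G.Adj b c → G.Adj a c →
    ∃ C ∈ G.nonsepIn U, a ∈ C ∧ b ∈ C ∧ c ∉ C

/-- The set `S` of three vertices separates `V₁ \ S` from `V₂ \ S` in `G` restricted to `U`. -/
structure IsThreeSeparation (G : SimpleGraph V) (U S V₁ V₂ : Set V) : Prop where
  union : V₁ ∪ V₂ = U
  inter : V₁ ∩ V₂ = S
  card : S.ncard = 3
  left : (V₁ \ S).Nonempty
  right : (V₂ \ S).Nonempty
  sep : ∀ x ∈ V₁ \ S, ∀ y ∈ V₂ \ S, ¬ G.Adj x y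

variable {G : SimpleGraph V} {U S V₁ V₂ C C₁ C₂ A X : Set V} {x y z : V} {K : Sym2 V → Set V}

/-- The edges that are added when `S` is made a clique. -/
def virtualEdges (G : SimpleGraph V) (S : Set V) : Set (Sym2 V) :=
  (G.addClique S).edgeSet \ G.edgeSet

lemma mk_mem_virtualEdges : s(x, y) ∈ G.virtualEdges S ↔ x ≠ y ∧ x ∈ S ∧ y ∈ S ∧ ¬ G.Adj x y := by
  simp only [virtualEdges, Set.mem_sdiff, mem_edgeSet, addClique_adj]
  tauto

lemma exists_third (hS : S.ncard = 3) (hx : x ∈ S) (hy : y ∈ S) (hxy : x ≠ y) :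
    ∃ z ∈ S, z ≠ x ∧ z ≠ y ∧ ∀ w ∈ S, w = x ∨ w = y ∨ w = z := by
  obtain ⟨a, b, c, hab, hac, hbc, rfl⟩ := Set.ncard_eq_three.1 hS
  simp only [Set.mem_insert_iff, Set.mem_singleton_iff] at *
  rcases hx with rfl | rfl | rfl <;> rcases hy with rfl | rfl | rfl <;>
    first
    | exact absurd rfl hxy
    | exact ⟨a, by simp, by grind, by grind, by grind⟩
    | exact ⟨b, by simp, by grind, by grind, by grind⟩
    | exact ⟨c, by simp, by grind, by grind, by grind⟩

lemma CycleOn.exists_notMem (hC : (G.addClique S).CycleOn C) (hS : S.ncard = 3) (hCS : C ≠ S) :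
    ∃ z ∈ S, z ∉ C := by
  by_contra! hsub
  refine hCS (Set.Subset.antisymm (hC.2.1 S hsub ?_ ?_) hsub)
  · exact Set.nonempty_of_ncard_ne_zero (by omega)
  · intro x hx y hy hxy
    obtain ⟨a, b, c, hab, hac, hbc, rfl⟩ := Set.ncard_eq_three.1 hS
    obtain ⟨p, hp, q, hq, hpq, h⟩ := hC.2.2 x (hsub x hx)
    have ha := h a (hsub a (by simp))
    have hb := h b (hsub b (by simp))
    have hc := h c (hsub c (by simp))
    have hy' := h y hy
    simp only [addClique_adj, Set.mem_insert_iff, Set.mem_singleton_iff] at *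
    grind

namespace IsThreeSeparation

lemma symm (h : G.IsThreeSeparation U S V₁ V₂) : G.IsThreeSeparation U S V₂ V₁ where
  union := by rw [Set.union_comm, h.union]
  inter := by rw [Set.inter_comm, h.inter]
  card := h.card
  left := h.right
  right := h.left
  sep := fun x hx y hy hxy => h.sep y hy x hx hxy.symm

lemma subset_left (h : G.IsThreeSeparation U S V₁ V₂) : S ⊆ V₁ :=
  h.inter ▸ Set.inter_subset_left

lemma left_subset (h : G.IsThreeSeparation U S V₁ V₂) : V₁ ⊆ U :=
  h.union ▸ Set.subset_union_left

lemma mem_of_mem (h : G.IsThreeSeparation U S V₁ V₂) (h₁ : x ∈ V₁) (h₂ : x ∈ V₂) : x ∈ S :=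
  h.inter ▸ ⟨h₁, h₂⟩

lemma mem_or_mem (h : G.IsThreeSeparation U S V₁ V₂) (hx : x ∈ U) : x ∈ V₁ ∨ x ∈ V₂ := by
  rwa [← h.union] at hx

lemma left_ncard_lt [Finite V] (h : G.IsThreeSeparation U S V₁ V₂) : V₁.ncard < U.ncard := by
  refine Set.ncard_lt_ncard ⟨h.left_subset, fun hle => ?_⟩ (Set.toFinite _)
  obtain ⟨x, hx, hxS⟩ := h.right
  exact hxS (h.mem_of_mem (hle (h.symm.left_subset hx)) hx)

lemma four_le_left [Finite V] (h : G.IsThreeSeparation U S V₁ V₂) : 4 ≤ V₁.ncard := by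
  obtain ⟨x, hx, hxS⟩ := h.left
  have := Set.ncard_le_ncard (Set.insert_subset hx h.subset_left) (Set.toFinite _)
  rw [Set.ncard_insert_of_notMem hxS, h.card] at this
  omega

lemma threeConnectedOn_left [Finite V] (h : G.IsThreeSeparation U S V₁ V₂)
    (hU : G.ThreeConnectedOn U) : (G.addClique S).ThreeConnectedOn V₁ := by
  refine ⟨by have := h.four_le_left; omega, fun T hT B hB hne hcl => ?_⟩
  obtain ⟨s, hs, hsT⟩ : ∃ s ∈ S, s ∉ T := by
    by_contra! hsub
    have := Set.ncard_le_ncard hsub (Set.toFinite _)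
    have := h.card
    omega
  have hclG : ∀ x ∈ B, ∀ y ∈ V₁ \ T, G.Adj x y → y ∈ B := fun x hx y hy hxy =>
    hcl x hx y hy (Or.inl hxy)
  by_cases hBS : (B ∩ S).Nonempty
  · obtain ⟨b, hbB, hbS⟩ := hBS
    have hSB : ∀ t ∈ S, t ∉ T → t ∈ B := by
      intro t ht htT
      by_cases hbt : b = t
      · exact hbt ▸ hbB
      · exact hcl b hbB t ⟨h.subset_left ht, htT⟩ (Or.inr ⟨hbt, hbS, ht⟩)
    have := hU.2 T hT (B ∪ (V₂ \ T)) ?_ (hne.mono Set.subset_union_left) ?_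
    · rintro x ⟨hx, hxT⟩
      rcases this ⟨h.left_subset hx, hxT⟩ with hx' | hx'
      · exact hx'
      · exact hSB x (h.mem_of_mem hx hx'.1) hxT
    · rintro x (hx | hx)
      · exact ⟨h.left_subset (hB hx).1, (hB hx).2⟩
      · exact ⟨h.symm.left_subset hx.1, hx.2⟩
    · rintro x hx y ⟨hyU, hyT⟩ hxy
      by_cases hy₂ : y ∈ V₂
      · exact Or.inr ⟨hy₂, hyT⟩
      have hy₁ := (h.mem_or_mem hyU).resolve_right hy₂
      have hyS : y ∉ S := fun hyS => hy₂ (h.symm.subset_left hyS)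
      rcases hx with hx | hx
      · exact Or.inl (hclG x hx y ⟨hy₁, hyT⟩ hxy)
      · by_cases hxS : x ∈ S
        · exact Or.inl (hclG x (hSB x hxS hx.2) y ⟨hy₁, hyT⟩ hxy)
        · exact absurd hxy.symm (h.sep y ⟨hy₁, hyS⟩ x ⟨hx.1, hxS⟩)
  · exfalso
    have := hU.2 T hT B (fun x hx => ⟨h.left_subset (hB hx).1, (hB hx).2⟩) hne ?_
      ⟨h.left_subset (h.subset_left hs), hsT⟩
    · exact hBS ⟨s, this, hs⟩
    · rintro x hx y ⟨hyU, hyT⟩ hxy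
      have hxS : x ∉ S := fun hxS => hBS ⟨x, hx, hxS⟩
      by_cases hy₁ : y ∈ V₁
      · exact hclG x hx y ⟨hy₁, hyT⟩ hxy
      · have hy₂ := (h.mem_or_mem hyU).resolve_left hy₁
        exact absurd hxy (h.sep x ⟨(hB hx).1, hxS⟩ y ⟨hy₂, fun hyS => hy₁ (h.subset_left hyS)⟩)

/-- A part of the right side that is closed within this side is adjacent to all of `S`. -/
lemma exists_adj_of_closed [Finite V] (h : G.IsThreeSeparation U S V₁ V₂)
    (hU : G.ThreeConnectedOn U) {B : Set V} (hB : B ⊆ V₂ \ S) (hne : B.Nonempty)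
    (hcl : ∀ x ∈ B, ∀ y ∈ V₂ \ S, G.Adj x y → y ∈ B) {s : V} (hs : s ∈ S) :
    ∃ x ∈ B, G.Adj x s := by
  by_contra! hno
  have hcard : (S \ {s}).ncard ≤ 2 := by
    rw [Set.ncard_sdiff_singleton_of_mem hs, h.card]
  have := hU.2 _ hcard B (fun x hx => ⟨h.symm.left_subset (hB hx).1, fun h' => (hB hx).2 h'.1⟩)
    hne ?_ ⟨h.left_subset (h.subset_left hs), by simp⟩
  · exact (hB this).2 hs
  · rintro x hx y ⟨hyU, hyS⟩ hxy
    have hys : y ≠ s := fun hys => hno x hx (hys ▸ hxy)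
    have hyS' : y ∉ S := fun h' => hyS ⟨h', hys⟩
    rcases h.mem_or_mem hyU with hy | hy
    · exact absurd hxy.symm (h.sep y ⟨hy, hyS'⟩ x (hB hx))
    · exact hcl x hx y ⟨hy, hyS'⟩ hxy

lemma preconnectedOn_side [Finite V] (h : G.IsThreeSeparation U S V₁ V₂)
    (hU : G.ThreeConnectedOn U) (hX : X ⊆ S) (hne : X.Nonempty) :
    G.PreconnectedOn ((V₂ \ S) ∪ X) := by
  intro B hB hBne hcl
  have hXB : (B ∩ (V₂ \ S)).Nonempty → X ⊆ B := by
    intro hne' s hs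
    obtain ⟨x, hx, hxs⟩ := h.exists_adj_of_closed hU Set.inter_subset_right hne'
      (fun x hx y hy hxy => ⟨hcl x hx.1 y (Or.inl hy) hxy, hy⟩) (hX hs)
    exact hcl x hx.1 s (Or.inr hs) hxs
  have hDB : (B ∩ X).Nonempty → V₂ \ S ⊆ B := by
    rintro ⟨s, hsB, hsX⟩ y hy
    by_contra hyB
    obtain ⟨x, hx, hxs⟩ := h.exists_adj_of_closed hU (B := (V₂ \ S) \ B) Set.sdiff_subset
      ⟨y, hy, hyB⟩
      (fun x hx y hy hxy => ⟨hy, fun hyB => hx.2 (hcl y hyB x (Or.inl hx.1) hxy.symm)⟩) (hX hsX)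
    exact hx.2 (hcl s hsB x (Or.inl hx.1) hxs.symm)
  obtain ⟨b, hb⟩ := hBne
  obtain ⟨s, hs⟩ := hne
  rcases hB hb with hb' | hb'
  · have hX' := hXB ⟨b, hb, hb'⟩
    exact Set.union_subset (hDB ⟨s, hX' hs, hs⟩) hX'
  · have hD' := hDB ⟨b, hb, hb'⟩
    obtain ⟨d, hd⟩ := h.right
    exact Set.union_subset hD' (hXB ⟨d, hD' hd, hd⟩)

lemma preconnectedOn_union [Finite V] (h : G.IsThreeSeparation U S V₁ V₂)
    (hU : G.ThreeConnectedOn U) (hA : (G.addClique S).PreconnectedOn A)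
    (hAS : (A ∩ S).Nonempty) : G.PreconnectedOn (A ∪ (V₂ \ S)) := by
  intro B hB hBne hcl
  have hside := h.preconnectedOn_side hU (X := A ∩ S) Set.inter_subset_right hAS
  have hsub : (V₂ \ S) ∪ (A ∩ S) ⊆ A ∪ (V₂ \ S) := by
    rintro x (hx | hx)
    · exact Or.inr hx
    · exact Or.inl hx.1
  have key : (B ∩ ((V₂ \ S) ∪ (A ∩ S))).Nonempty → (V₂ \ S) ∪ (A ∩ S) ⊆ B := fun hne =>
    (hside _ Set.inter_subset_right hne fun x hx y hy hxy =>
      ⟨hcl x hx.1 y (hsub hy) hxy, hy⟩).trans Set.inter_subset_left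
  have hBA : (B ∩ A).Nonempty := by
    obtain ⟨b, hb⟩ := hBne
    rcases hB hb with hb' | hb'
    · exact ⟨b, hb, hb'⟩
    · obtain ⟨s, hs⟩ := hAS
      exact ⟨s, key ⟨b, hb, Or.inl hb'⟩ (Or.inr hs), hs.1⟩
  have hAB : A ⊆ B := by
    refine (hA _ Set.inter_subset_right hBA ?_).trans Set.inter_subset_left
    rintro x ⟨hxB, hxA⟩ y hy (hxy | ⟨-, hx, hy'⟩)
    · exact ⟨hcl x hxB y (Or.inl hy) hxy, hy⟩
    · exact ⟨key ⟨x, hxB, Or.inr ⟨hxA, hx⟩⟩ (Or.inr ⟨hy, hy'⟩), hy⟩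
  obtain ⟨s, hs⟩ := hAS
  exact Set.union_subset hAB (Set.subset_union_left.trans (key ⟨s, hAB hs.1, Or.inr hs⟩))

lemma mem_nonsepIn_of_left [Finite V] (h : G.IsThreeSeparation U S V₁ V₂)
    (hU : G.ThreeConnectedOn U) (hC : C ∈ (G.addClique S).nonsepIn V₁) (hCS : C ≠ S)
    (hreal : ∀ x ∈ C, x ∈ S → ∀ y ∈ C, y ∈ S → x ≠ y → G.Adj x y) : C ∈ G.nonsepIn U := by
  obtain ⟨hC₁, hcyc, hpc⟩ := hC
  obtain ⟨z, hzS, hzC⟩ := hcyc.exists_notMem h.card hCS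
  refine ⟨hC₁.trans h.left_subset, hcyc.congr fun x hx y hy => ?_, ?_⟩
  · rw [addClique_adj]
    exact ⟨fun h' => h'.elim id fun h' => hreal x hx h'.2.1 y hy h'.2.2 h'.1, Or.inl⟩
  · have := h.preconnectedOn_union hU hpc ⟨z, ⟨h.subset_left hzS, hzC⟩, hzS⟩
    convert this using 1
    ext w
    have h1 : w ∈ U ↔ w ∈ V₁ ∨ w ∈ V₂ := by rw [← h.union]; rfl
    have h2 : w ∈ S ↔ w ∈ V₁ ∧ w ∈ V₂ := by rw [← h.inter]; rfl
    have h3 := @hC₁ w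
    simp only [Set.mem_sdiff, Set.mem_union]
    tauto

lemma exists_two_adj_of_union (h : G.IsThreeSeparation U S V₁ V₂)
    (hC₁ : C₁ ∈ (G.addClique S).nonsepIn V₁) (hC₂ : C₂ ∈ (G.addClique S).nonsepIn V₂)
    (hxC₁ : x ∈ C₁) (hyC₁ : y ∈ C₁) (hxC₂ : x ∈ C₂) (hyC₂ : y ∈ C₂) (hx : x ∈ S) (hy : y ∈ S)
    (hxy : x ≠ y) (hS₁ : ∀ w ∈ C₁, w ∈ S → w = x ∨ w = y)
    (hS₂ : ∀ w ∈ C₂, w ∈ S → w = x ∨ w = y) (hadj : ¬ G.Adj x y) {w : V} (hw : w ∈ C₁) :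
    ∃ a ∈ C₁ ∪ C₂, ∃ b ∈ C₁ ∪ C₂, a ≠ b ∧ ∀ t ∈ C₁ ∪ C₂, G.Adj w t ↔ t = a ∨ t = b := by
  have hmem := fun {w} => h.mem_of_mem (x := w)
  have hother : ∀ {D : Set V}, (G.addClique S).CycleOn D → ∀ p ∈ D, ∀ q ∈ D,
      (G.addClique S).Adj p q → ∃ a ∈ D, a ≠ q ∧ a ≠ p ∧
        ∀ t ∈ D, (G.addClique S).Adj p t ↔ t = q ∨ t = a := by
    intro D hD p hp q hq hpq
    obtain ⟨a, ha, b, hb, hab, h'⟩ := hD.2.2 p hp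
    have hpa := ((h' a ha).2 (Or.inl rfl)).ne'
    have hpb := ((h' b hb).2 (Or.inr rfl)).ne'
    rcases (h' q hq).1 hpq with rfl | rfl
    · exact ⟨b, hb, hab.symm, hpb, h'⟩
    · exact ⟨a, ha, hab, hpa, fun t ht => by rw [h' t ht, or_comm]⟩
  have hends : ∀ p q : V, p ∈ C₁ → p ∈ C₂ → q ∈ C₁ → q ∈ C₂ → p ∈ S → q ∈ S → p ≠ q →
      (∀ w ∈ C₁, w ∈ S → w = p ∨ w = q) → (∀ w ∈ C₂, w ∈ S → w = p ∨ w = q) → ¬ G.Adj p q →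
      ∃ a ∈ C₁ ∪ C₂, ∃ b ∈ C₁ ∪ C₂, a ≠ b ∧ ∀ t ∈ C₁ ∪ C₂, G.Adj p t ↔ t = a ∨ t = b := by
    intro p q hp₁ hp₂ hq₁ hq₂ hpS hqS hpq hS₁ hS₂ hnadj
    have hpqH : (G.addClique S).Adj p q := Or.inr ⟨hpq, hpS, hqS⟩
    obtain ⟨a, ha, haq, hap, ha'⟩ := hother hC₁.2.1 p hp₁ q hq₁ hpqH
    obtain ⟨b, hb, hbq, hbp, hb'⟩ := hother hC₂.2.1 p hp₂ q hq₂ hpqH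
    have haS : a ∉ S := fun haS => (hS₁ a ha haS).elim hap haq
    have hbS : b ∉ S := fun hbS => (hS₂ b hb hbS).elim hbp hbq
    have ha₂ : a ∉ C₂ := fun h' => haS (hmem (hC₁.1 ha) (hC₂.1 h'))
    have hb₁ : b ∉ C₁ := fun h' => hbS (hmem (hC₁.1 h') (hC₂.1 hb))
    refine ⟨a, Or.inl ha, b, Or.inr hb, fun hab => ha₂ (hab ▸ hb), ?_⟩
    intro t ht
    have hpS' : ∀ t, t ∉ S → ((G.addClique S).Adj p t ↔ G.Adj p t) := by
      intro t ht
      simp [addClique_adj, ht]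
    by_cases htS : t ∈ S
    · have : t = p ∨ t = q := ht.elim (fun h' => hS₁ t h' htS) fun h' => hS₂ t h' htS
      have hta : t ≠ a := fun h' => haS (h' ▸ htS)
      have htb : t ≠ b := fun h' => hbS (h' ▸ htS)
      rcases this with rfl | rfl <;> simp [hnadj, hta, htb]
    · have htq : t ≠ q := fun h' => htS (h' ▸ hqS)
      rw [← hpS' t htS]
      rcases ht with ht | ht
      · have htb : t ≠ b := fun h' => hb₁ (h' ▸ ht)
        rw [ha' t ht]
        simp [htq, htb]
      · have hta : t ≠ a := fun h' => ha₂ (h' ▸ ht)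
        rw [hb' t ht]
        simp [htq, hta]
  by_cases hwx : w = x
  · subst hwx
    exact hends w y hxC₁ hxC₂ hyC₁ hyC₂ hx hy hxy hS₁ hS₂ hadj
  by_cases hwy : w = y
  · subst hwy
    exact hends w x hyC₁ hyC₂ hxC₁ hxC₂ hy hx hxy.symm (fun t ht ht' => (hS₁ t ht ht').symm)
      (fun t ht ht' => (hS₂ t ht ht').symm) fun h' => hadj h'.symm
  have hwS : w ∉ S := fun h' => (hS₁ w hw h').elim hwx hwy
  obtain ⟨a, ha, b, hb, hab, h'⟩ := hC₁.2.1.2.2 w hw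
  refine ⟨a, Or.inl ha, b, Or.inl hb, hab, fun t ht => ?_⟩
  by_cases ht₁ : t ∈ C₁
  · rw [← h' t ht₁, addClique_adj]
    simp [hwS]
  · have ht₂ : t ∈ C₂ := ht.resolve_left ht₁
    have htS : t ∉ S := fun htS => by
      rcases hS₂ t ht₂ htS with rfl | rfl <;> contradiction
    have hta : t ≠ a := fun h' => ht₁ (h' ▸ ha)
    have htb : t ≠ b := fun h' => ht₁ (h' ▸ hb)
    simp [hta, htb, h.sep w ⟨hC₁.1 hw, hwS⟩ t ⟨hC₂.1 ht₂, htS⟩]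

/-- Induced nonseparating cycles of the two sides sharing exactly one virtual edge are glued to an
induced nonseparating cycle. -/
lemma union_mem_nonsepIn [Finite V] (h : G.IsThreeSeparation U S V₁ V₂)
    (hC₁ : C₁ ∈ (G.addClique S).nonsepIn V₁) (hC₂ : C₂ ∈ (G.addClique S).nonsepIn V₂)
    (hxC₁ : x ∈ C₁) (hyC₁ : y ∈ C₁) (hxC₂ : x ∈ C₂) (hyC₂ : y ∈ C₂) (hx : x ∈ S) (hy : y ∈ S)
    (hxy : x ≠ y) (hS₁ : ∀ w ∈ C₁, w ∈ S → w = x ∨ w = y)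
    (hS₂ : ∀ w ∈ C₂, w ∈ S → w = x ∨ w = y) (hadj : ¬ G.Adj x y) :
    C₁ ∪ C₂ ∈ G.nonsepIn U := by
  have hxyH : (G.addClique S).Adj x y := Or.inr ⟨hxy, hx, hy⟩
  have hmem := fun {w} => h.mem_of_mem (x := w)
  have hpath : ∀ {D : Set V}, (G.addClique S).CycleOn D → x ∈ D → y ∈ D →
      (∀ w ∈ D, w ∈ S → w = x ∨ w = y) → G.PreconnectedOn D := by
    intro D hD hxD hyD hSD
    refine (hD.preconnectedOn_deleteEdges (x := x) (y := y)).mono fun p hp q hq hpq => ?_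
    rw [deleteEdges_adj, addClique_adj, Set.mem_singleton_iff, Sym2.eq_iff] at hpq
    rcases hpq with ⟨hpq | ⟨hne, hpS, hqS⟩, hpq'⟩
    · exact hpq
    · have := hSD p hp hpS
      have := hSD q hq hqS
      grind
  have hrest : ∀ {D W : Set V}, (G.addClique S).PreconnectedOn (W \ D) → x ∈ D → y ∈ D →
      G.PreconnectedOn (W \ D) := by
    intro D W hD hxD hyD
    refine hD.mono ?_
    rintro p hp q hq (hpq | ⟨hne, hpS, hqS⟩)
    · exact hpq
    · obtain ⟨z, -, -, -, hz⟩ := exists_third h.card hx hy hxy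
      have := hz p hpS
      have := hz q hqS
      have := hp.2
      have := hq.2
      grind
  obtain ⟨z, hzS, hzx, hzy, hz⟩ := exists_third h.card hx hy hxy
  have hzC₁ : z ∉ C₁ := fun h' => (hS₁ z h' hzS).elim hzx hzy
  have hzC₂ : z ∉ C₂ := fun h' => (hS₂ z h' hzS).elim hzx hzy
  refine ⟨Set.union_subset (hC₁.1.trans h.left_subset) (hC₂.1.trans h.symm.left_subset),
    ⟨⟨x, Or.inl hxC₁⟩, ?_, ?_⟩, ?_⟩
  · exact (hpath hC₁.2.1 hxC₁ hyC₁ hS₁).union (hpath hC₂.2.1 hxC₂ hyC₂ hS₂) ⟨x, hxC₁, hxC₂⟩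
  · rintro w (hw | hw)
    · exact h.exists_two_adj_of_union hC₁ hC₂ hxC₁ hyC₁ hxC₂ hyC₂ hx hy hxy hS₁ hS₂ hadj hw
    · rw [Set.union_comm]
      exact h.symm.exists_two_adj_of_union hC₂ hC₁ hxC₂ hyC₂ hxC₁ hyC₁ hx hy hxy hS₂ hS₁ hadj hw
  · have := (hrest hC₁.2.2 hxC₁ hyC₁).union (hrest hC₂.2.2 hxC₂ hyC₂)
      ⟨z, ⟨h.subset_left hzS, hzC₁⟩, h.symm.subset_left hzS, hzC₂⟩
    convert this using 1
    ext w
    have h1 : w ∈ U ↔ w ∈ V₁ ∨ w ∈ V₂ := by rw [← h.union]; rfl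
    have h2 := fun h₁ : w ∈ V₁ => fun h₂ : w ∈ V₂ => hz w (hmem h₁ h₂)
    have h3 := @hC₁.1 w
    have h4 := @hC₂.1 w
    simp only [Set.mem_sdiff, Set.mem_union]
    grind

variable {D : Set V} {K₁ K₂ : Sym2 V → Set V}

lemma mem_and_mem_of_adj (h : G.IsThreeSeparation U S V₁ V₂) (hx : x ∈ U) (hy : y ∈ U)
    (hxy : G.Adj x y) : (x ∈ V₁ ∧ y ∈ V₁) ∨ (x ∈ V₂ ∧ y ∈ V₂) := by
  by_contra! hno
  rcases h.mem_or_mem hx with hx' | hx' <;> rcases h.mem_or_mem hy with hy' | hy'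
  · exact hno.1 hx' hy'
  · exact h.sep x ⟨hx', fun hS => hno.2 (h.symm.subset_left hS) hy'⟩ y
      ⟨hy', fun hS => hno.1 hx' (h.subset_left hS)⟩ hxy
  · exact h.sep y ⟨hy', fun hS => hno.2 hx' (h.symm.subset_left hS)⟩ x
      ⟨hx', fun hS => hno.1 (h.subset_left hS) hy'⟩ hxy.symm
  · exact hno.2 hx' hy'

lemma exists_nonsepIn_of_virtualEdges (h : G.IsThreeSeparation U S V₁ V₂)
    (hA : (G.addClique S).EdgesHaveCycleAvoiding V₂) :
    ∃ K : Sym2 V → Set V, ∀ e ∈ G.virtualEdges S, K e ∈ (G.addClique S).nonsepIn V₂ ∧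
      ∀ w ∈ S, w ∈ K e ↔ w ∈ e := by
  have : ∀ e : Sym2 V, ∃ C : Set V, e ∈ G.virtualEdges S → C ∈ (G.addClique S).nonsepIn V₂ ∧
      ∀ w ∈ S, w ∈ C ↔ w ∈ e := by
    intro e
    by_cases he : e ∈ G.virtualEdges S
    · induction e with | _ x y =>
      obtain ⟨hxy, hx, hy, -⟩ := mk_mem_virtualEdges.1 he
      obtain ⟨z, hz, hzx, hzy, hw⟩ := exists_third h.card hx hy hxy
      obtain ⟨C, hC, hxC, hyC, hzC⟩ := hA x (h.symm.subset_left hx) y (h.symm.subset_left hy)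
        z (h.symm.subset_left hz) (Or.inr ⟨hxy, hx, hy⟩) (Or.inr ⟨hzy.symm, hy, hz⟩)
        (Or.inr ⟨hzx.symm, hx, hz⟩)
      refine ⟨C, fun _ => ⟨hC, fun w hwS => ?_⟩⟩
      rw [Sym2.mem_iff]
      rcases hw w hwS with rfl | rfl | rfl <;> simp_all
    · exact ⟨∅, fun h' => absurd h' he⟩
  choose K hK using this
  exact ⟨K, hK⟩

/-- An induced nonseparating cycle of the left side extends to one of the whole graph. -/
lemma exists_lift [Finite V] (h : G.IsThreeSeparation U S V₁ V₂) (hU : G.ThreeConnectedOn U)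
    (hK : ∀ e ∈ G.virtualEdges S, K e ∈ (G.addClique S).nonsepIn V₂ ∧ ∀ w ∈ S, w ∈ K e ↔ w ∈ e)
    (hC : C ∈ (G.addClique S).nonsepIn V₁) (hCS : C ≠ S) :
    ∃ D ∈ G.nonsepIn U, D ∩ V₁ = C ∧
      (D = C ∨ ∃ e ∈ G.virtualEdges S, D = C ∪ K e ∧ ∀ w ∈ S, w ∈ C ↔ w ∈ e) := by
  by_cases hreal : ∀ x ∈ C, x ∈ S → ∀ y ∈ C, y ∈ S → x ≠ y → G.Adj x y
  · exact ⟨C, h.mem_nonsepIn_of_left hU hC hCS hreal, Set.inter_eq_left.2 hC.1, Or.inl rfl⟩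
  push Not at hreal
  obtain ⟨x, hxC, hx, y, hyC, hy, hxy, hadj⟩ := hreal
  obtain ⟨z, hz, hzx, hzy, hw⟩ := exists_third h.card hx hy hxy
  obtain ⟨z', hz', hzC'⟩ := hC.2.1.exists_notMem h.card hCS
  have hzC : z ∉ C := by
    rcases hw z' hz' with rfl | rfl | rfl <;> first | contradiction | assumption
  have hS : ∀ w ∈ C, w ∈ S → w = x ∨ w = y := by
    intro w hwC hwS
    rcases hw w hwS with rfl | rfl | rfl
    · exact Or.inl rfl
    · exact Or.inr rfl
    · contradiction
  have he : s(x, y) ∈ G.virtualEdges S := mk_mem_virtualEdges.2 ⟨hxy, hx, hy, hadj⟩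
  obtain ⟨hKe, hKS⟩ := hK _ he
  simp only [Sym2.mem_iff] at hKS
  refine ⟨C ∪ K s(x, y), h.union_mem_nonsepIn hC hKe hxC hyC ((hKS x hx).2 (Or.inl rfl))
    ((hKS y hy).2 (Or.inr rfl)) hx hy hxy hS (fun w hw hwS => (hKS w hwS).1 hw) hadj, ?_,
    Or.inr ⟨_, he, rfl, fun w hwS => ?_⟩⟩
  · rw [Set.union_inter_distrib_right, Set.inter_eq_left.2 hC.1, Set.union_eq_left]
    rintro w ⟨hwK, hw₁⟩
    have hwS := h.mem_of_mem hw₁ (hKe.1 hwK)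
    rcases (hKS w hwS).1 hwK with rfl | rfl <;> assumption
  · rw [Sym2.mem_iff]
    refine ⟨fun hwC => hS w hwC hwS, ?_⟩
    rintro (rfl | rfl) <;> assumption

lemma lift_eq_union [Finite V] (h : G.IsThreeSeparation U S V₁ V₂)
    (hK₁ : ∀ e ∈ G.virtualEdges S, K₁ e ∈ (G.addClique S).nonsepIn V₁ ∧ ∀ w ∈ S, w ∈ K₁ e ↔ w ∈ e)
    (hC₁ : C₁ ∈ (G.addClique S).nonsepIn V₁) (hC₁S : C₁ ≠ S)
    (hC₂ : C₂ ∈ (G.addClique S).nonsepIn V₂) (hC₂S : C₂ ≠ S)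
    (hD₁ : D = C₁ ∨ ∃ e ∈ G.virtualEdges S, D = C₁ ∪ K₂ e ∧ ∀ w ∈ S, w ∈ C₁ ↔ w ∈ e)
    (hD₂ : D = C₂ ∨ ∃ e ∈ G.virtualEdges S, D = C₂ ∪ K₁ e ∧ ∀ w ∈ S, w ∈ C₂ ↔ w ∈ e)
    (hi₁ : D ∩ V₁ = C₁) (hi₂ : D ∩ V₂ = C₂) :
    ∃ e ∈ G.virtualEdges S, D = K₁ e ∪ K₂ e := by
  have hsub : ∀ {C : Set V}, (G.addClique S).CycleOn C → C ⊆ S → C = S := fun hC hCS =>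
    Set.eq_of_subset_of_ncard_le hCS (by rw [h.card]; exact hC.three_le) (Set.toFinite _)
  rcases hD₁ with rfl | ⟨e, he, hDe, hCe⟩
  · refine absurd (hsub hC₂.2.1 fun w hw => ?_) hC₂S
    rw [← hi₂] at hw
    exact h.mem_of_mem (hC₁.1 hw.1) hw.2
  rcases hD₂ with rfl | ⟨e', he', hDe', hCe'⟩
  · refine absurd (hsub hC₁.2.1 fun w hw => ?_) hC₁S
    rw [← hi₁] at hw
    exact h.mem_of_mem hw.2 (hC₂.1 hw.1)
  have hee : e = e' := by
    have hsub : ∀ f ∈ G.virtualEdges S, ∀ w ∈ f, w ∈ S := by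
      intro f hf w hw
      induction f with | _ x y =>
      obtain ⟨-, hx, hy, -⟩ := mk_mem_virtualEdges.1 hf
      rcases Sym2.mem_iff.1 hw with rfl | rfl <;> assumption
    have hmem : ∀ w ∈ S, w ∈ C₁ ↔ w ∈ C₂ := by
      intro w hw
      rw [← hi₁, ← hi₂]
      exact ⟨fun h' => ⟨h'.1, h.symm.subset_left hw⟩, fun h' => ⟨h'.1, h.subset_left hw⟩⟩
    refine Sym2.ext fun w => ⟨fun hw => ?_, fun hw => ?_⟩
    · have hwS := hsub e he w hw
      exact (hCe' w hwS).1 ((hmem w hwS).1 ((hCe w hwS).2 hw))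
    · have hwS := hsub e' he' w hw
      exact (hCe w hwS).1 ((hmem w hwS).2 ((hCe' w hwS).2 hw))
  subst hee
  refine ⟨e, he, ?_⟩
  have h₁ : K₁ e ⊆ C₁ := by
    rw [← hi₁, hDe']
    exact fun w hw => ⟨Or.inr hw, (hK₁ e he).1.1 hw⟩
  rw [hDe]
  refine Set.Subset.antisymm (Set.union_subset (fun w hw => ?_) Set.subset_union_right)
    (Set.union_subset_union_left _ h₁)
  have hwD : w ∈ C₂ ∪ K₁ e := hDe' ▸ hDe ▸ Or.inl hw
  refine hwD.elim (fun hw₂ => ?_) Or.inl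
  have hwS := h.mem_of_mem (hC₁.1 hw) (hC₂.1 hw₂)
  exact Or.inl (((hK₁ e he).2 w hwS).2 ((hCe w hwS).1 hw))

lemma ncard_nonsepIn_add_le [Finite V] (h : G.IsThreeSeparation U S V₁ V₂)
    (hU : G.ThreeConnectedOn U) (h₁ : (G.addClique S).EdgesHaveCycleAvoiding V₁)
    (h₂ : (G.addClique S).EdgesHaveCycleAvoiding V₂) :
    ((G.addClique S).nonsepIn V₁).ncard + ((G.addClique S).nonsepIn V₂).ncard ≤
      (G.nonsepIn U).ncard + (G.virtualEdges S).ncard + 2 := by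
  obtain ⟨K₁, hK₁⟩ := h.symm.exists_nonsepIn_of_virtualEdges h₁
  obtain ⟨K₂, hK₂⟩ := h.exists_nonsepIn_of_virtualEdges h₂
  choose! Φ₁ hΦ₁ hi₁ hd₁ using fun C (hC : C ∈ (G.addClique S).nonsepIn V₁ ∧ C ≠ S) =>
    h.exists_lift hU hK₂ hC.1 hC.2
  choose! Φ₂ hΦ₂ hi₂ hd₂ using fun C (hC : C ∈ (G.addClique S).nonsepIn V₂ ∧ C ≠ S) =>
    h.symm.exists_lift hU hK₁ hC.1 hC.2
  have hc₁ : (Φ₁ '' ((G.addClique S).nonsepIn V₁ \ {S})).ncard =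
      ((G.addClique S).nonsepIn V₁ \ {S}).ncard :=
    Set.InjOn.ncard_image fun C hC D hD hCD => by rw [← hi₁ C hC, ← hi₁ D hD, hCD]
  have hc₂ : (Φ₂ '' ((G.addClique S).nonsepIn V₂ \ {S})).ncard =
      ((G.addClique S).nonsepIn V₂ \ {S}).ncard :=
    Set.InjOn.ncard_image fun C hC D hD hCD => by rw [← hi₂ C hC, ← hi₂ D hD, hCD]
  have hs₁ := Set.pred_ncard_le_ncard_sdiff_singleton ((G.addClique S).nonsepIn V₁) S
  have hs₂ := Set.pred_ncard_le_ncard_sdiff_singleton ((G.addClique S).nonsepIn V₂) S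
  have hunion : (Φ₁ '' ((G.addClique S).nonsepIn V₁ \ {S}) ∪
      Φ₂ '' ((G.addClique S).nonsepIn V₂ \ {S})).ncard ≤ (G.nonsepIn U).ncard := by
    refine Set.ncard_le_ncard ?_ (Set.toFinite _)
    rintro _ (⟨C, hC, rfl⟩ | ⟨C, hC, rfl⟩)
    · exact hΦ₁ C hC
    · exact hΦ₂ C hC
  have hinter : (Φ₁ '' ((G.addClique S).nonsepIn V₁ \ {S}) ∩
      Φ₂ '' ((G.addClique S).nonsepIn V₂ \ {S})).ncard ≤ (G.virtualEdges S).ncard := by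
    refine (Set.ncard_le_ncard (t := (fun e => K₁ e ∪ K₂ e) '' G.virtualEdges S) ?_
      (Set.toFinite _)).trans (Set.ncard_image_le (Set.toFinite _))
    rintro _ ⟨⟨C₁, hC₁, rfl⟩, C₂, hC₂, hCC⟩
    obtain ⟨e, he, hDe⟩ := h.lift_eq_union (D := Φ₁ C₁) hK₁ hC₁.1 hC₁.2 hC₂.1 hC₂.2
      (hd₁ C₁ hC₁) (hCC ▸ hd₂ C₂ hC₂) (hi₁ C₁ hC₁) (hCC ▸ hi₂ C₂ hC₂)
    exact ⟨e, he, hDe.symm⟩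
  have := Set.ncard_union_add_ncard_inter (Φ₁ '' ((G.addClique S).nonsepIn V₁ \ {S}))
    (Φ₂ '' ((G.addClique S).nonsepIn V₂ \ {S}))
  omega

lemma ncard_edgesIn_add [Finite V] (h : G.IsThreeSeparation U S V₁ V₂) :
    ((G.addClique S).edgesIn V₁).ncard + ((G.addClique S).edgesIn V₂).ncard =
      (G.edgesIn U).ncard + (G.virtualEdges S).ncard + 3 := by
  have hS : ((G.addClique S).edgesIn S).ncard = 3 := by
    rw [ncard_edgesIn_of_complete fun x hx y hy hxy => Or.inr ⟨hxy, hx, hy⟩, h.card]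
    rfl
  have hinter : (G.addClique S).edgesIn V₁ ∩ (G.addClique S).edgesIn V₂ =
      (G.addClique S).edgesIn S := by
    ext e
    simp only [edgesIn, Set.mem_inter_iff, Set.mem_ofPred_eq, ← h.inter]
    exact ⟨fun h' => ⟨h'.1.1, fun x hx => ⟨h'.1.2 x hx, h'.2.2 x hx⟩⟩,
      fun h' => ⟨⟨h'.1, fun x hx => (h'.2 x hx).1⟩, h'.1, fun x hx => (h'.2 x hx).2⟩⟩
  have hunion : (G.addClique S).edgesIn V₁ ∪ (G.addClique S).edgesIn V₂ =
      G.edgesIn U ∪ G.virtualEdges S := by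
    ext e
    induction e with | _ x y =>
    simp only [Set.mem_union, mk_mem_virtualEdges, edgesIn, Set.mem_ofPred_eq, mem_edgeSet,
      Sym2.mem_iff, forall_eq_or_imp, forall_eq, addClique_adj]
    constructor
    · rintro (⟨hxy, hx, hy⟩ | ⟨hxy, hx, hy⟩) <;> by_cases hadj : G.Adj x y
      · exact Or.inl ⟨hadj, h.left_subset hx, h.left_subset hy⟩
      · have := hxy.resolve_left hadj
        exact Or.inr ⟨this.1, this.2.1, this.2.2, hadj⟩
      · exact Or.inl ⟨hadj, h.symm.left_subset hx, h.symm.left_subset hy⟩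
      · have := hxy.resolve_left hadj
        exact Or.inr ⟨this.1, this.2.1, this.2.2, hadj⟩
    · rintro (⟨hxy, hx, hy⟩ | ⟨hxy, hx, hy, -⟩)
      · exact (h.mem_and_mem_of_adj hx hy hxy).imp (fun h' => ⟨Or.inl hxy, h'⟩)
          fun h' => ⟨Or.inl hxy, h'⟩
      · exact Or.inl ⟨Or.inr ⟨hxy, hx, hy⟩, h.subset_left hx, h.subset_left hy⟩
  have hdisj : Disjoint (G.edgesIn U) (G.virtualEdges S) :=
    Set.disjoint_left.2 fun e he he' => he'.2 he.1
  have h₁ := Set.ncard_union_add_ncard_inter ((G.addClique S).edgesIn V₁)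
    ((G.addClique S).edgesIn V₂)
  rw [hinter, hunion, hS, Set.ncard_union_eq hdisj] at h₁
  omega

lemma eulerIn_add_le [Finite V] (h : G.IsThreeSeparation U S V₁ V₂)
    (hU : G.ThreeConnectedOn U) (h₁ : (G.addClique S).EdgesHaveCycleAvoiding V₁)
    (h₂ : (G.addClique S).EdgesHaveCycleAvoiding V₂) :
    (G.addClique S).eulerIn V₁ + (G.addClique S).eulerIn V₂ ≤ G.eulerIn U + 2 := by
  have hc := h.ncard_nonsepIn_add_le hU h₁ h₂
  have he := h.ncard_edgesIn_add
  have hv := Set.ncard_union_add_ncard_inter V₁ V₂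
  rw [h.union, h.inter, h.card] at hv
  simp only [eulerIn]
  omega

lemma exists_nonsepIn_of_left [Finite V] (h : G.IsThreeSeparation U S V₁ V₂)
    (hU : G.ThreeConnectedOn U) (h₁ : (G.addClique S).EdgesHaveCycleAvoiding V₁)
    (h₂ : (G.addClique S).EdgesHaveCycleAvoiding V₂) (hx : x ∈ V₁) (hy : y ∈ V₁) (hz : z ∈ V₁)
    (hxy : G.Adj x y) (hyz : G.Adj y z) (hxz : G.Adj x z) :
    ∃ C ∈ G.nonsepIn U, x ∈ C ∧ y ∈ C ∧ z ∉ C := by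
  obtain ⟨C, hC, hxC, hyC, hzC⟩ := h₁ x hx y hy z hz (Or.inl hxy) (Or.inl hyz) (Or.inl hxz)
  by_cases hCS : C = S
  · subst hCS
    obtain ⟨w, hw, hwx, hwy, ht⟩ := exists_third h.card hxC hyC hxy.ne
    obtain ⟨D, hD, hxD, hyD, hwD⟩ := h₂ x (h.symm.subset_left hxC) y (h.symm.subset_left hyC)
      w (h.symm.subset_left hw) (Or.inl hxy) (Or.inr ⟨hwy.symm, hyC, hw⟩)
      (Or.inr ⟨hwx.symm, hxC, hw⟩)
    refine ⟨D, h.symm.mem_nonsepIn_of_left hU hD (fun h' => hwD (h' ▸ hw)) ?_, hxD, hyD,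
      fun hzD => hzC (h.mem_of_mem hz (hD.1 hzD))⟩
    intro p hpD hp q hqD hq hpq
    have h3 := hxy.symm
    rcases ht p hp with rfl | rfl | rfl <;> rcases ht q hq with rfl | rfl | rfl <;>
      first | assumption | contradiction
  · obtain ⟨K, hK⟩ := h.exists_nonsepIn_of_virtualEdges h₂
    obtain ⟨D, hD, hDC, -⟩ := h.exists_lift hU hK hC hCS
    rw [← hDC] at hxC hyC hzC
    exact ⟨D, hD, hxC.1, hyC.1, fun hzD => hzC ⟨hzD, hz⟩⟩

lemma edgesHaveCycleAvoiding [Finite V] (h : G.IsThreeSeparation U S V₁ V₂)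
    (hU : G.ThreeConnectedOn U) (h₁ : (G.addClique S).EdgesHaveCycleAvoiding V₁)
    (h₂ : (G.addClique S).EdgesHaveCycleAvoiding V₂) : G.EdgesHaveCycleAvoiding U := by
  intro x hx y hy z hz hxy hyz hxz
  have hside : (x ∈ V₁ ∧ y ∈ V₁ ∧ z ∈ V₁) ∨ (x ∈ V₂ ∧ y ∈ V₂ ∧ z ∈ V₂) := by
    have := h.mem_and_mem_of_adj hx hy hxy
    have := h.mem_and_mem_of_adj hy hz hyz
    have := h.mem_and_mem_of_adj hx hz hxz
    tauto
  rcases hside with ⟨h1, h2, h3⟩ | ⟨h1, h2, h3⟩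
  · exact h.exists_nonsepIn_of_left hU h₁ h₂ h1 h2 h3 hxy hyz hxz
  · exact h.symm.exists_nonsepIn_of_left hU h₂ h₁ h1 h2 h3 hxy hyz hxz

end IsThreeSeparation

end ThreeSeparation

section Induction

variable {G : SimpleGraph V} {U S : Set V} {u v x y : V}

/-- Deleting three vertices of `U` does not disconnect `G` restricted to `U`. -/
def NoThreeCut (G : SimpleGraph V) (U : Set V) : Prop :=
  ∀ S ⊆ U, S.ncard = 3 → G.PreconnectedOn (U \ S)

lemma exists_isThreeSeparation (hcut : ¬ G.NoThreeCut U) :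
    ∃ S V₁ V₂, G.IsThreeSeparation U S V₁ V₂ := by
  simp only [NoThreeCut, PreconnectedOn] at hcut
  push Not at hcut
  obtain ⟨S, hSU, hS, B, hB, hne, hcl, hnot⟩ := hcut
  have hBS : ∀ x ∈ B, x ∉ S := fun x hx => (hB hx).2
  refine ⟨S, S ∪ B, U \ B, ?_, ?_, hS, ?_, ?_, ?_⟩
  · ext x
    have h1 := @hSU x
    have h2 := @hB x
    simp only [Set.mem_union, Set.mem_sdiff] at *
    tauto
  · ext x
    have h1 := @hSU x
    have h2 := hBS x
    simp only [Set.mem_inter_iff, Set.mem_union, Set.mem_sdiff]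
    tauto
  · obtain ⟨b, hb⟩ := hne
    exact ⟨b, Or.inr hb, hBS b hb⟩
  · obtain ⟨x, hx, hxB⟩ := Set.not_subset.1 hnot
    exact ⟨x, ⟨hx.1, hxB⟩, hx.2⟩
  · rintro x ⟨hx, hxS⟩ y ⟨⟨hyU, hyB⟩, hyS⟩ hxy
    exact hyB (hcl x (hx.resolve_left hxS) y ⟨hyU, hyS⟩ hxy)

lemma NoThreeCut.preconnectedOn [Finite V] (hcut : G.NoThreeCut U) (hU : G.ThreeConnectedOn U)
    (hS : S.ncard ≤ 3) : G.PreconnectedOn (U \ S) := by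
  rw [← Set.sdiff_inter_self_eq_sdiff]
  have := Set.ncard_le_ncard (Set.inter_subset_left : S ∩ U ⊆ S) (Set.toFinite _)
  by_cases h3 : (S ∩ U).ncard = 3
  · exact hcut _ Set.inter_subset_right h3
  · exact hU.2 _ (by omega)

lemma NoThreeCut.threeConnectedOn_contractInto [Finite V] (hcut : G.NoThreeCut U)
    (hU : G.ThreeConnectedOn U) (h4 : 4 ≤ U.ncard) (hu : u ∈ U) (hv : v ∈ U) (huv : u ≠ v) :
    (G.contractInto u v).ThreeConnectedOn (U \ {v}) := by
  refine ⟨by rw [Set.ncard_sdiff_singleton_of_mem hv]; omega, fun S hS => ?_⟩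
  rw [Set.sdiff_sdiff_comm]
  by_cases huS : u ∈ S
  · rw [Set.sdiff_sdiff]
    refine (hcut.preconnectedOn hU ?_).mono fun a ha b hb hab => ⟨hab.ne, Or.inl hab⟩
    exact (Set.ncard_union_le _ _).trans (by rw [Set.ncard_singleton]; omega)
  by_cases hvS : v ∈ S
  · rw [Set.sdiff_singleton_eq_self (by simp [hvS])]
    exact (hU.2 S hS).mono fun a ha b hb hab => ⟨hab.ne, Or.inl hab⟩
  · exact (hU.2 S hS).contractInto huv ⟨hu, huS⟩ ⟨hv, hvS⟩

lemma NoThreeCut.eulerIn_contractInto_le [Finite V] (hcut : G.NoThreeCut U)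
    (hU : G.ThreeConnectedOn U) (hu : u ∈ U) (hv : v ∈ U) (huv : G.Adj u v) :
    (G.contractInto u v).eulerIn (U \ {v}) ≤ G.eulerIn U :=
  SimpleGraph.eulerIn_contractInto_le hU hu hv huv fun p _ => hcut.preconnectedOn hU <| by
    have h1 := Set.ncard_insert_le u {v, p}
    have h2 := Set.ncard_insert_le v {p}
    rw [Set.ncard_singleton] at h2
    omega

lemma ThreeConnectedOn.adj_of_ncard_le_four [Finite V] (hU : G.ThreeConnectedOn U)
    (h4 : U.ncard ≤ 4) (hx : x ∈ U) (hy : y ∈ U) (hxy : x ≠ y) : G.Adj x y := by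
  have hcard : (U \ {x, y}).ncard ≤ 2 := by
    rw [Set.ncard_sdiff (by grind) (Set.toFinite _), Set.ncard_pair hxy]
    omega
  obtain ⟨w, hw, hxw⟩ := (hU.2 _ hcard).exists_adj (u := x) (v := y) (by simp [hx]) (by simp [hy])
    hxy
  simp only [Set.mem_sdiff, Set.mem_insert_iff, Set.mem_singleton_iff, not_and, not_not] at hw
  rcases hw.2 hw.1 with rfl | rfl
  · exact absurd hxw (G.loopless.irrefl _)
  · exact hxw

lemma edgesHaveCycleAvoiding_of_complete [Finite V] (h4 : 4 ≤ U.ncard)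
    (h : ∀ x ∈ U, ∀ y ∈ U, x ≠ y → G.Adj x y) : G.EdgesHaveCycleAvoiding U := by
  intro a ha b hb c hc hab hbc hac
  obtain ⟨d, hd, hd'⟩ : ∃ d ∈ U, d ∉ ({a, b, c} : Set V) := by
    refine Set.exists_mem_notMem_of_ncard_lt_ncard ?_
    rw [Set.ncard_eq_three.2 ⟨a, b, c, hab.ne, hac.ne, hbc.ne, rfl⟩]
    omega
  simp only [Set.mem_insert_iff, Set.mem_singleton_iff, not_or] at hd'
  refine ⟨{a, b, d}, ?_, by simp, by simp, ?_⟩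
  · rw [nonsepIn_of_complete h]
    refine ⟨by grind, Set.ncard_eq_three.2 ⟨a, b, d, hab.ne, Ne.symm hd'.1, Ne.symm hd'.2.1, rfl⟩⟩
  · have := hac.ne'
    have := hbc.ne'
    have := hd'.2.2
    grind

lemma ThreeConnectedOn.edgesHaveCycleAvoiding [Finite V] (hU : G.ThreeConnectedOn U)
    (h4 : 4 ≤ U.ncard)
    (ih : ∀ u ∈ U, ∀ v ∈ U, G.Adj u v → (G.contractInto u v).EdgesHaveCycleAvoiding (U \ {v})) :
    G.EdgesHaveCycleAvoiding U := by
  intro a ha b hb c hc hab hbc hac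
  obtain ⟨d, hd, hd'⟩ : ∃ d ∈ U, d ∉ ({a, b, c} : Set V) := by
    refine Set.exists_mem_notMem_of_ncard_lt_ncard ?_
    rw [Set.ncard_eq_three.2 ⟨a, b, c, hab.ne, hac.ne, hbc.ne, rfl⟩]
    omega
  simp only [Set.mem_insert_iff, Set.mem_singleton_iff, not_or] at hd'
  obtain ⟨w, ⟨hw, hwab⟩, hcw⟩ := (hU.2 {a, b} (Set.ncard_pair hab.ne).le).exists_adj
    (u := c) (v := d) ⟨hc, by simp [hac.ne', hbc.ne']⟩ ⟨hd, by simp [hd']⟩ (Ne.symm hd'.2.2)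
  simp only [Set.mem_insert_iff, Set.mem_singleton_iff, not_or] at hwab
  obtain ⟨C, hC, haC, hbC, hcC⟩ := ih c hc w hw hcw a ⟨ha, Ne.symm hwab.1⟩ b ⟨hb, Ne.symm hwab.2⟩
    c ⟨hc, hcw.ne⟩ ⟨hab.ne, Or.inl hab⟩ ⟨hbc.ne, Or.inl hbc⟩ ⟨hac.ne, Or.inl hac⟩
  exact ⟨C, mem_nonsepIn_of_contractInto_of_notMem hc hw hcw hC hcC, haC, hbC, hcC⟩

lemma ThreeConnectedOn.exists_adj [Finite V] (hU : G.ThreeConnectedOn U) :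
    ∃ u ∈ U, ∃ v ∈ U, G.Adj u v := by
  obtain ⟨u, v, hu, hv, huv⟩ := (Set.one_lt_ncard_iff (Set.toFinite U)).1 (by have := hU.1; omega)
  have h := hU.2 ∅ (by simp)
  rw [Set.sdiff_empty] at h
  obtain ⟨w, hw, huw⟩ := h.exists_adj hu hv huv
  exact ⟨u, hu, w, hw, huw⟩

/-- A 3-connected graph on at least four vertices has Euler characteristic at least two, and every
edge of a triangle lies on an induced nonseparating cycle avoiding the third vertex. -/
theorem ThreeConnectedOn.two_le_eulerIn [Finite V] (hU : G.ThreeConnectedOn U) (h4 : 4 ≤ U.ncard) :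
    2 ≤ G.eulerIn U ∧ G.EdgesHaveCycleAvoiding U := by
  induction hn : U.ncard using Nat.strong_induction_on generalizing G U with | _ n ih =>
  subst hn
  by_cases hcut : G.NoThreeCut U
  · by_cases h5 : 5 ≤ U.ncard
    · have ih' : ∀ u ∈ U, ∀ v ∈ U, G.Adj u v → 2 ≤ (G.contractInto u v).eulerIn (U \ {v}) ∧
          (G.contractInto u v).EdgesHaveCycleAvoiding (U \ {v}) := by
        intro u hu v hv huv
        have hcard := Set.ncard_sdiff_singleton_of_mem hv
        exact ih _ (by omega) (hcut.threeConnectedOn_contractInto hU h4 hu hv huv.ne) (by omega)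
          rfl
      obtain ⟨u, hu, v, hv, huv⟩ := hU.exists_adj
      exact ⟨(ih' u hu v hv huv).1.trans (hcut.eulerIn_contractInto_le hU hu hv huv),
        hU.edgesHaveCycleAvoiding h4 fun u hu v hv huv => (ih' u hu v hv huv).2⟩
    · have hcomp : ∀ x ∈ U, ∀ y ∈ U, x ≠ y → G.Adj x y := fun x hx y hy hxy =>
        hU.adj_of_ncard_le_four (by omega) hx hy hxy
      refine ⟨?_, edgesHaveCycleAvoiding_of_complete h4 hcomp⟩
      rw [eulerIn_of_complete hcomp, show U.ncard = 4 by omega]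
      decide
  · obtain ⟨S, V₁, V₂, h⟩ := exists_isThreeSeparation hcut
    obtain ⟨h₁, h₁'⟩ := ih _ h.left_ncard_lt (h.threeConnectedOn_left hU) h.four_le_left rfl
    obtain ⟨h₂, h₂'⟩ := ih _ h.symm.left_ncard_lt (h.symm.threeConnectedOn_left hU)
      h.symm.four_le_left rfl
    have := h.eulerIn_add_le hU h₁' h₂'
    exact ⟨by omega, h.edgesHaveCycleAvoiding hU h₁' h₂'⟩

end Induction

section CliqueMinor

variable {G : SimpleGraph V} {U S V₁ V₂ A : Set V} {u v x y : V} {n : ℕ}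

/-- The sets `f i` are the branch sets of a complete minor of `G` restricted to `U`. -/
structure IsCliqueModel (G : SimpleGraph V) (U : Set V) (f : Fin n → Set V) : Prop where
  subset : ∀ i, f i ⊆ U
  nonempty : ∀ i, (f i).Nonempty
  preconnectedOn : ∀ i, G.PreconnectedOn (f i)
  disjoint : ∀ i j, i ≠ j → ∀ x ∈ f i, x ∉ f j
  adj : ∀ i j, i ≠ j → ∃ a ∈ f i, ∃ b ∈ f j, G.Adj a b

variable {f : Fin n → Set V}

lemma IsCliqueModel.le_ncard [Finite V] (hf : G.IsCliqueModel U f) : n ≤ U.ncard := by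
  choose g hg using hf.nonempty
  have hinj : Function.Injective g := by
    intro i j hij
    by_contra hne
    exact hf.disjoint i j hne (g i) (hg i) (hij ▸ hg j)
  have := Set.ncard_le_ncard (s := Set.range g) (t := U)
    (by rintro _ ⟨i, rfl⟩; exact hf.subset i (hg i)) (Set.toFinite _)
  rwa [← Set.image_univ, Set.ncard_image_of_injective _ hinj, Set.ncard_univ, Nat.card_fin] at this

lemma IsCliqueModel.contractInto (hf : G.IsCliqueModel U f) (huv : u ≠ v)
    (h : ∀ i, v ∈ f i → u ∈ f i) :
    (G.contractInto u v).IsCliqueModel (U \ {v}) fun i => f i \ {v} where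
  subset i := Set.sdiff_subset_sdiff_left (hf.subset i)
  nonempty i := by
    by_cases hv : v ∈ f i
    · exact ⟨u, h i hv, huv⟩
    · rw [Set.sdiff_singleton_eq_self hv]
      exact hf.nonempty i
  preconnectedOn i := by
    by_cases hv : v ∈ f i
    · exact (hf.preconnectedOn i).contractInto huv (h i hv) hv
    · rw [Set.sdiff_singleton_eq_self hv]
      exact (hf.preconnectedOn i).mono fun a _ b _ hab => ⟨hab.ne, Or.inl hab⟩
  disjoint i j hij x hx hx' := hf.disjoint i j hij x hx.1 hx'.1
  adj i j hij := by
    have key : ∀ i j, i ≠ j → v ∉ f j → ∃ a ∈ f i \ {v}, ∃ b ∈ f j \ {v},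
        (G.contractInto u v).Adj a b := by
      intro i j hij hj
      obtain ⟨a, ha, b, hb, hab⟩ := hf.adj i j hij
      have hbv : b ≠ v := fun h' => hj (h' ▸ hb)
      by_cases hav : a = v
      · subst hav
        exact ⟨u, ⟨h i ha, huv⟩, b, ⟨hb, hbv⟩,
          fun h' => hf.disjoint i j hij u (h i ha) (h' ▸ hb), Or.inr (Or.inl ⟨rfl, hab⟩)⟩
      · exact ⟨a, ⟨ha, hav⟩, b, ⟨hb, hbv⟩, hab.ne, Or.inl hab⟩
    by_cases hj : v ∈ f j
    · obtain ⟨b, hb, a, ha, hab⟩ := key j i hij.symm (hf.disjoint j i hij.symm v hj)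
      exact ⟨a, ha, b, hb, hab.symm⟩
    · exact key i j hij hj

lemma IsCliqueModel.exists_adj (hf : G.IsCliqueModel U f) (hU : G.PreconnectedOn U) (hx : x ∈ U)
    (hy : y ∈ U) (hxy : x ≠ y) (hadj : ¬ G.Adj x y) :
    ∃ u ∈ U, ∃ v ∈ U, G.Adj u v ∧ ∀ i, v ∈ f i → u ∈ f i := by
  by_contra! hno
  obtain ⟨x', hx', hxx'⟩ := hU.exists_adj hx hy hxy
  obtain ⟨y', hy', hyy'⟩ := hU.exists_adj hy hx hxy.symm
  obtain ⟨i, hxi, -⟩ := hno x' hx' x hx hxx'.symm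
  obtain ⟨j, hyj, -⟩ := hno y' hy' y hy hyy'.symm
  have hsing : ∀ k, ∀ p ∈ f k, ∀ q ∈ f k, p = q := by
    intro k p hp q hq
    by_contra hpq
    obtain ⟨w, hw, hpw⟩ := (hf.preconnectedOn k).exists_adj hp hq hpq
    obtain ⟨l, hpl, hwl⟩ := hno w (hf.subset k hw) p (hf.subset k hp) hpw.symm
    by_cases hkl : k = l
    · exact hwl (hkl ▸ hw)
    · exact hf.disjoint k l hkl p hp hpl
  by_cases hij : i = j
  · exact hxy (hsing j x (hij ▸ hxi) y hyj)
  · obtain ⟨a, ha, b, hb, hab⟩ := hf.adj i j hij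
    rw [hsing i a ha x hxi, hsing j b hb y hyj] at hab
    exact hadj hab

namespace IsThreeSeparation

lemma preconnectedOn_inter_left (h : G.IsThreeSeparation U S V₁ V₂) (hAU : A ⊆ U)
    (hA : G.PreconnectedOn A) : (G.addClique S).PreconnectedOn (A ∩ V₁) := by
  intro B hB hne hcl
  have := hA (B ∪ {x | x ∈ A ∧ x ∉ V₁ ∧ (B ∩ S).Nonempty}) ?_ (hne.mono Set.subset_union_left) ?_
  · rintro x ⟨hxA, hx₁⟩
    exact (this hxA).resolve_right fun h' => h'.2.1 hx₁
  · rintro x (hx | hx)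
    · exact (hB hx).1
    · exact hx.1
  · rintro x hx y hyA hxy
    by_cases hy₁ : y ∈ V₁
    · rcases hx with hx | ⟨hxA, hx₁, s, hsB, hsS⟩
      · exact Or.inl (hcl x hx y ⟨hyA, hy₁⟩ (Or.inl hxy))
      · have hyS : y ∈ S := by
          refine h.mem_of_mem hy₁ ?_
          exact ((h.mem_and_mem_of_adj (hAU hxA) (hAU hyA) hxy).resolve_left
            fun h' => hx₁ h'.1).2
        by_cases hsy : s = y
        · exact Or.inl (hsy ▸ hsB)
        · exact Or.inl (hcl s hsB y ⟨hyA, hy₁⟩ (Or.inr ⟨hsy, hsS, hyS⟩))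
    · rcases hx with hx | ⟨hxA, hx₁, hBS⟩
      · have hxA := hB hx
        refine Or.inr ⟨hyA, hy₁, x, hx, h.mem_of_mem hxA.2 ?_⟩
        exact ((h.mem_and_mem_of_adj (hAU hxA.1) (hAU hyA) hxy).resolve_left fun h' => hy₁ h'.2).1
      · exact Or.inr ⟨hyA, hy₁, hBS⟩

lemma inter_nonempty (h : G.IsThreeSeparation U S V₁ V₂) (hAU : A ⊆ U) (hA : G.PreconnectedOn A)
    (h₁ : (A ∩ V₁).Nonempty) (h₂ : (A ∩ V₂).Nonempty) : (A ∩ S).Nonempty := by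
  by_contra hno
  have hnot : ∀ x ∈ A, x ∈ V₁ → x ∉ V₂ := fun x hx hx₁ hx₂ => hno ⟨x, hx, h.mem_of_mem hx₁ hx₂⟩
  have := hA (A ∩ V₁) Set.inter_subset_left h₁ fun x hx y hy hxy => ⟨hy,
    ((h.mem_and_mem_of_adj (hAU hx.1) (hAU hy) hxy).resolve_right
      fun h' => hnot x hx.1 hx.2 h'.1).2⟩
  obtain ⟨x, hx, hx₂⟩ := h₂
  exact hnot x hx (this hx).2 hx₂

lemma isCliqueModel_left (h : G.IsThreeSeparation U S V₁ V₂) (hf : G.IsCliqueModel U f)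
    (hne : ∀ i, (f i ∩ V₁).Nonempty) :
    (G.addClique S).IsCliqueModel V₁ fun i => f i ∩ V₁ where
  subset i := Set.inter_subset_right
  nonempty := hne
  preconnectedOn i := h.preconnectedOn_inter_left (hf.subset i) (hf.preconnectedOn i)
  disjoint i j hij x hx hx' := hf.disjoint i j hij x hx.1 hx'.1
  adj i j hij := by
    obtain ⟨a, ha, b, hb, hab⟩ := hf.adj i j hij
    rcases h.mem_and_mem_of_adj (hf.subset i ha) (hf.subset j hb) hab with ⟨h₁, h₂⟩ | ⟨h₁, h₂⟩
    · exact ⟨a, ⟨ha, h₁⟩, b, ⟨hb, h₂⟩, Or.inl hab⟩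
    · obtain ⟨s, hs, hsS⟩ := h.inter_nonempty (hf.subset i) (hf.preconnectedOn i) (hne i)
        ⟨a, ha, h₁⟩
      obtain ⟨t, ht, htS⟩ := h.inter_nonempty (hf.subset j) (hf.preconnectedOn j) (hne j)
        ⟨b, hb, h₂⟩
      exact ⟨s, ⟨hs, h.subset_left hsS⟩, t, ⟨ht, h.subset_left htS⟩,
        Or.inr ⟨fun h' => hf.disjoint i j hij s hs (h' ▸ ht), hsS, htS⟩⟩

lemma inter_nonempty_or (h : G.IsThreeSeparation U S V₁ V₂) (hf : G.IsCliqueModel U f) :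
    (∀ i, (f i ∩ V₁).Nonempty) ∨ ∀ i, (f i ∩ V₂).Nonempty := by
  by_contra! hno
  obtain ⟨⟨i, hi⟩, j, hj⟩ := hno
  have hi' : ∀ x ∈ f i, x ∉ V₁ := fun x hx hx' => Set.notMem_empty x (hi ▸ ⟨hx, hx'⟩)
  have hj' : ∀ x ∈ f j, x ∉ V₂ := fun x hx hx' => Set.notMem_empty x (hj ▸ ⟨hx, hx'⟩)
  have hij : i ≠ j := by
    rintro rfl
    obtain ⟨x, hx⟩ := hf.nonempty i
    exact (h.mem_or_mem (hf.subset i hx)).elim (hi' x hx) (hj' x hx)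
  obtain ⟨a, ha, b, hb, hab⟩ := hf.adj i j hij
  exact (h.mem_and_mem_of_adj (hf.subset i ha) (hf.subset j hb) hab).elim
    (fun h' => hi' a ha h'.1) fun h' => hj' b hb h'.2

end IsThreeSeparation

lemma choose_three_sub_choose_two_add_monotone :
    Monotone fun n : ℕ => (n.choose 3 : ℤ) - n.choose 2 + n := by
  refine monotone_nat_of_le_succ fun n => ?_
  have h3 : (n + 1).choose 3 = n.choose 2 + n.choose 3 := Nat.choose_succ_succ n 2
  have h2 : (n + 1).choose 2 = n.choose 1 + n.choose 2 := Nat.choose_succ_succ n 1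
  have hle : n ≤ n.choose 2 + 1 := by
    cases n with
    | zero => omega
    | succ n =>
      have : (n + 1).choose 2 = n.choose 1 + n.choose 2 := Nat.choose_succ_succ n 1
      rw [Nat.choose_one_right] at this
      omega
  rw [Nat.choose_one_right] at h2
  rw [h3, h2]
  push_cast
  omega

/-- The Euler characteristic of a 3-connected graph is at least that of each of its complete
minors. -/
theorem IsCliqueModel.le_eulerIn [Finite V] (hf : G.IsCliqueModel U f)
    (hU : G.ThreeConnectedOn U) : (n.choose 3 : ℤ) - n.choose 2 + n ≤ G.eulerIn U := by
  induction hm : U.ncard using Nat.strong_induction_on generalizing G U f with | _ m ih =>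
  subst hm
  by_cases hcomp : ∀ x ∈ U, ∀ y ∈ U, x ≠ y → G.Adj x y
  · rw [eulerIn_of_complete hcomp]
    exact choose_three_sub_choose_two_add_monotone hf.le_ncard
  push Not at hcomp
  obtain ⟨x, hx, y, hy, hxy, hadj⟩ := hcomp
  have h5 : 4 < U.ncard := by
    by_contra! h4
    exact hadj (hU.adj_of_ncard_le_four h4 hx hy hxy)
  by_cases hcut : G.NoThreeCut U
  · have hpc := hU.2 ∅ (by simp)
    rw [Set.sdiff_empty] at hpc
    obtain ⟨u, hu, v, hv, huv, h⟩ := hf.exists_adj hpc hx hy hxy hadj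
    have hcard := Set.ncard_sdiff_singleton_of_mem hv
    exact (ih _ (by omega) (hf.contractInto huv.ne h)
      (hcut.threeConnectedOn_contractInto hU h5.le hu hv huv.ne) rfl).trans
      (hcut.eulerIn_contractInto_le hU hu hv huv)
  · obtain ⟨S, V₁, V₂, h⟩ := exists_isThreeSeparation hcut
    have h₁ := (h.threeConnectedOn_left hU).two_le_eulerIn h.four_le_left
    have h₂ := (h.symm.threeConnectedOn_left hU).two_le_eulerIn h.symm.four_le_left
    have hadd := h.eulerIn_add_le hU h₁.2 h₂.2
    rcases h.inter_nonempty_or hf with hne | hne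
    · have := ih _ h.left_ncard_lt (h.isCliqueModel_left hf hne) (h.threeConnectedOn_left hU) rfl
      omega
    · have := ih _ h.symm.left_ncard_lt (h.symm.isCliqueModel_left hf hne)
        (h.symm.threeConnectedOn_left hU) rfl
      omega

end CliqueMinor

section Final

variable {G : SimpleGraph V}

lemma ThreeConnected.threeConnectedOn_univ [Finite V] (hG : ThreeConnected G) :
    G.ThreeConnectedOn Set.univ := by
  refine ⟨?_, fun S hS => ?_⟩
  · by_contra! h
    obtain ⟨⟨x, hx⟩⟩ := (hG Set.univ (by omega)).nonempty
    exact hx trivial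
  · rw [← Set.compl_eq_univ_sdiff]
    exact preconnected_induce_iff_preconnectedOn.1 (hG S hS).preconnected

lemma ncard_nonsepCycles_sub_add [Finite V] : ((nonsepCycles G).ncard : ℤ) - G.edgeSet.ncard +
    Nat.card V = G.eulerIn Set.univ := by
  have h1 : nonsepCycles G = G.nonsepIn Set.univ := by
    ext C
    simp only [nonsepCycles, IsNonsepCycle, nonsepIn, Set.mem_ofPred_eq, Set.subset_univ, true_and,
      isInducedCycle_iff, preconnected_induce_iff_preconnectedOn, Set.compl_eq_univ_sdiff]
  have h2 : G.edgesIn Set.univ = G.edgeSet := by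
    ext e
    simp [edgesIn]
  rw [eulerIn, h1, h2, Set.ncard_univ]

lemma exists_isCliqueModel [Finite V] {n : ℕ} (h : IsMinor (⊤ : SimpleGraph (Fin n)) G) :
    ∃ f : Fin n → Set V, G.IsCliqueModel Set.univ f := by
  obtain ⟨f, hne, hc, hd, hadj⟩ := h
  exact ⟨f, fun i => Set.subset_univ _, hne,
    fun i => preconnected_induce_iff_preconnectedOn.1 (hc i).preconnected,
    fun i j hij x hx hx' => Set.disjoint_left.1 (hd hij) hx hx', hadj⟩

lemma isMinor_hadwigerNumber [Finite V] :
    IsMinor (⊤ : SimpleGraph (Fin (hadwigerNumber G))) G := by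
  refine Nat.sSup_mem (s := {n | IsMinor (⊤ : SimpleGraph (Fin n)) G}) ⟨0, ?_⟩
    ⟨(Set.univ : Set V).ncard, fun n hn => ?_⟩
  · exact ⟨fun _ => ∅, fun i => i.elim0, fun i => i.elim0, fun i => i.elim0, fun i => i.elim0⟩
  · obtain ⟨f, hf⟩ := exists_isCliqueModel hn
    exact hf.le_ncard

end Final

end SimpleGraph

/-- If `G` is a finite simple 3-connected graph with `χ(G) ≤ h(G)` (as asserted
by Hadwiger's conjecture), then
`C(χ(G),3) - C(χ(G),2) + C(χ(G),1) ≤ |C(G)| - |E(G)| + |V(G)|`. -/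
theorem stmt15 [Finite V] (G : SimpleGraph V) (hG : ThreeConnected G)
    (hchi : G.chromaticNumber ≤ (hadwigerNumber G : ℕ∞)) :
    ((G.chromaticNumber.toNat).choose 3 : ℤ) - ((G.chromaticNumber.toNat).choose 2 : ℤ)
        + ((G.chromaticNumber.toNat).choose 1 : ℤ)
      ≤ ((nonsepCycles G).ncard : ℤ) - (G.edgeSet.ncard : ℤ) + (Nat.card V : ℤ) := by
  obtain ⟨f, hf⟩ := exists_isCliqueModel (isMinor_hadwigerNumber (G := G))
  have hle := hf.le_eulerIn hG.threeConnectedOn_univ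
  have htop : G.chromaticNumber.toNat ≤ hadwigerNumber G := ENat.toNat_le_of_le_natCast hchi
  rw [ncard_nonsepCycles_sub_add, Nat.choose_one_right]
  exact (choose_three_sub_choose_two_add_monotone htop).trans hle
end
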